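/- There are constants c and C such that for every binary string x: (a) for every computable probability density function P with P(x) > 0, setting m = ⌊−log P(x)⌋, there is a finite set S ∋ x with log|S| < −log P(x) + 1, δ(x|S) ≤ δ(x|P) + 2·log K(P) + K(m) + 2·log K(m) + C, and K(S) ≤ K(P) + K(m) + C; and (b) for every total recursive function p with x in its range, there is a finite set S ∋ x with log|S| ≤ l_x(p), δ(x|S) ≤ δ(x|p) + 2·log K(p) + K(l_x(p)) + 2·log K(l_x(p)) + c, and K(S) ≤ K(p) + K(l_x(p)) + c. -/

import Mathlib

open scoped Classical

/-- Binary strings. -/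
abbrev BStr : Type := List Bool

/-- A prefix (Turing) machine: a partial computable map taking a program and an
auxiliary input to an output, such that for each auxiliary input the set of
halting programs is prefix-free. -/
structure PrefixMachine where
  eval : BStr → BStr → Part BStr
  partrec' : Partrec fun p : BStr × BStr => eval p.1 p.2
  prefixFree : ∀ y p q, (eval p y).Dom → (eval q y).Dom → p <+: q → p = q

/-- A universal prefix machine: it simulates every prefix machine via a fixed
self-delimiting prefix. -/
structure UniversalPrefixMachine extends PrefixMachine where
  universal : ∀ M : PrefixMachine, ∃ s : BStr, ∀ p y,
    toPrefixMachine.eval (s ++ p) y = M.eval p y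

/-- Canonical binary-string encoding of an encodable object (e.g. a natural
number, a pair, or a finite set of strings, the latter representing a literal
listing of the set). -/
def code {α : Type} [Encodable α] (a : α) : BStr := Nat.bits (Encodable.encode a)

namespace UniversalPrefixMachine

variable (U : UniversalPrefixMachine)

/-- Conditional prefix Kolmogorov complexity `K(x|y)` of a string given a string. -/
noncomputable def Kc (x y : BStr) : ℕ :=
  sInf {n | ∃ p : BStr, p.length = n ∧ x ∈ U.eval p y}

/-- Prefix Kolmogorov complexity `K(x)`. -/
noncomputable def K (x : BStr) : ℕ := U.Kc x []

/-- `K(x|S)`: conditional complexity of `x` given a literal listing of the finite set `S`. -/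
noncomputable def KcS (x : BStr) (S : Finset BStr) : ℕ := U.Kc x (code S)

/-- `K(S)`: complexity of a listing of the finite set `S`. -/
noncomputable def Kset (S : Finset BStr) : ℕ := U.K (code S)

/-- `K(P|S)`: conditional complexity of a listing of `P` given a listing of `S`. -/
noncomputable def KsetCond (P S : Finset BStr) : ℕ := U.Kc (code P) (code S)

/-- `K(S|x)`: conditional complexity of a listing of `S` given the string `x`. -/
noncomputable def KsetGivenStr (S : Finset BStr) (x : BStr) : ℕ := U.Kc (code S) x

/-- `K(n)` for a natural number `n`. -/
noncomputable def Knat (n : ℕ) : ℕ := U.K (code n)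

/-- `K(a|b)` for natural numbers `a`, `b`. -/
noncomputable def KnatCond (a b : ℕ) : ℕ := U.Kc (code a) (code b)

/-- Randomness deficiency `δ(x|S) = log|S| - K(x|S)` (logarithm base 2). -/
noncomputable def deficiency (x : BStr) (S : Finset BStr) : ℝ :=
  Real.logb 2 (S.card : ℝ) - (U.KcS x S : ℝ)

/-- `Λ(S) = K(S) + log|S|`. -/
noncomputable def Lam (S : Finset BStr) : ℝ :=
  (U.Kset S : ℝ) + Real.logb 2 (S.card : ℝ)

/-- Kolmogorov structure function `h_x(α) = min{log|S| : x ∈ S, K(S) ≤ α}`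
(the minimum of the empty set being `⊤`). -/
noncomputable def h (x : BStr) (α : ℕ) : EReal :=
  sInf {r : EReal | ∃ S : Finset BStr,
    x ∈ S ∧ U.Kset S ≤ α ∧ r = ((Real.logb 2 (S.card : ℝ)) : EReal)}

/-- MDL structure function `λ_x(α) = min{Λ(S) : x ∈ S, K(S) ≤ α}`. -/
noncomputable def lambdaF (x : BStr) (α : ℕ) : EReal :=
  sInf {r : EReal | ∃ S : Finset BStr,
    x ∈ S ∧ U.Kset S ≤ α ∧ r = ((U.Lam S) : EReal)}

/-- Best-fit structure function `β_x(α) = min{δ(x|S) : x ∈ S, K(S) ≤ α}`. -/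
noncomputable def betaF (x : BStr) (α : ℕ) : EReal :=
  sInf {r : EReal | ∃ S : Finset BStr,
    x ∈ S ∧ U.Kset S ≤ α ∧ r = ((U.deficiency x S) : EReal)}

end UniversalPrefixMachine

/-- `f` is `(ε,δ)`-close to `g` on `{0,…,k}`. -/
def IsClose (k : ℕ) (ε δ : ℕ → ℕ) (f g : ℕ → EReal) : Prop :=
  ∀ i, ε 0 ≤ i → i ≤ k →
    sInf {r : EReal | ∃ j, ε 0 ≤ j ∧ j ≤ k ∧ Nat.dist j i ≤ ε i ∧ r = g j}
        - (((δ i : ℕ) : ℝ) : EReal) ≤ f i ∧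
    f i ≤ sSup {r : EReal | ∃ j, ε 0 ≤ j ∧ j ≤ k ∧ Nat.dist j i ≤ ε i ∧ r = g j}
        + (((δ i : ℕ) : ℝ) : EReal)

/-- An oracle prefix machine: a machine querying an oracle `O : ℕ → ℕ`, with
prefix-free halting programs; its behaviour is generated, via a partial
computable function, from finite tables of true oracle values (so the machine
is a computable functional of the oracle). -/
structure OraclePrefixMachine where
  eval : (ℕ → ℕ) → BStr → BStr → Part BStr
  prefixFree : ∀ O y p q, (eval O p y).Dom → (eval O q y).Dom → p <+: q → p = q
  table : List (ℕ × ℕ) × BStr × BStr → Part BStr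
  table_partrec : Partrec table
  eval_spec : ∀ O p y x, x ∈ eval O p y ↔
    ∃ T : List (ℕ × ℕ), (∀ q ∈ T, O q.1 = q.2) ∧ x ∈ table (T, p, y)

/-- A universal oracle prefix machine: simulates every oracle prefix machine
via a fixed self-delimiting prefix, uniformly in the oracle. -/
structure UniversalOracleMachine extends OraclePrefixMachine where
  universal : ∀ M : OraclePrefixMachine, ∃ s : BStr, ∀ O p y,
    toOraclePrefixMachine.eval O (s ++ p) y = M.eval O p y

/-- The oracle (as a function `ℕ → ℕ`) answering queries `(z,ε)` by `A z ε`. -/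
def oracleOfApprox (A : BStr → ℚ → ℚ) : ℕ → ℕ := fun m =>
  Encodable.encode ((Encodable.decode (α := BStr × ℚ) m).map fun z => A z.1 z.2)

/-- The oracle (as a function `ℕ → ℕ`) computing the function `f` on strings. -/
def oracleOfFun (f : BStr → BStr) : ℕ → ℕ := fun m =>
  Encodable.encode ((Encodable.decode (α := BStr) m).map f)

/-- `A` approximates `P`: `|A(z,ε) − P(z)| < ε` for all `z` and rational `ε > 0`. -/
def Approximates (A : BStr → ℚ → ℚ) (P : BStr → ℝ) : Prop :=
  ∀ (z : BStr) (ε : ℚ), 0 < ε → |((A z ε : ℚ) : ℝ) - P z| < (ε : ℝ)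

/-- `K(x|P)`: the minimum length of a program that prints `x` given as oracle
any function approximating `P`. -/
noncomputable def KcondPdf (V : UniversalOracleMachine) (x : BStr) (P : BStr → ℝ) : ℕ :=
  sInf {m | ∃ p : BStr, p.length = m ∧
    ∀ A : BStr → ℚ → ℚ, Approximates A P → x ∈ V.eval (oracleOfApprox A) p []}

/-- `K(x|p)` for a total function `p` on strings: the minimum length of a
program printing `x` given `p` as oracle. -/
noncomputable def KcondFun (V : UniversalOracleMachine) (x : BStr) (f : BStr → BStr) : ℕ :=
  sInf {m | ∃ p : BStr, p.length = m ∧ x ∈ V.eval (oracleOfFun f) p []}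

/-- A computable probability density function: nonnegative, sums to 1, and some
algorithm computes `P(z)` to within any positive rational precision `ε`. -/
def IsCPDF (P : BStr → ℝ) : Prop :=
  (∀ z : BStr, 0 ≤ P z) ∧ (∑' z : BStr, P z) = 1 ∧
    ∃ g : BStr × ℚ → ℚ, Computable g ∧
      ∀ (z : BStr) (ε : ℚ), 0 < ε → |((g (z, ε) : ℚ) : ℝ) - P z| < (ε : ℝ)

/-- `K(P)`: the minimal length of a program that, given `(z,ε)` with rational
`ε > 0`, outputs a rational approximating `P(z)` to precision `ε`. -/
noncomputable def KPdf (U : UniversalPrefixMachine) (P : BStr → ℝ) : ℕ :=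
  sInf {m | ∃ p : BStr, p.length = m ∧ ∀ (z : BStr) (ε : ℚ), 0 < ε →
    ∃ q : ℚ, code q ∈ U.eval p (code (z, ε)) ∧ |((q : ℚ) : ℝ) - P z| < (ε : ℝ)}

/-- `δ(x|P) = -log P(x) - K(x|P)`. -/
noncomputable def deltaPdf (V : UniversalOracleMachine) (x : BStr) (P : BStr → ℝ) : ℝ :=
  -Real.logb 2 (P x) - (KcondPdf V x P : ℝ)

/-- `K(p)` for a total function `p` on strings: the minimal length of a program
computing `p(d)` from any `d`. -/
noncomputable def KFn (U : UniversalPrefixMachine) (f : BStr → BStr) : ℕ :=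
  sInf {m | ∃ p : BStr, p.length = m ∧ ∀ d : BStr, f d ∈ U.eval p d}

/-- `l_x(p) = min{|d| : p(d) = x}`. -/
noncomputable def lenx (f : BStr → BStr) (x : BStr) : ℕ :=
  sInf {m | ∃ d : BStr, d.length = m ∧ f d = x}

/-- `δ(x|p) = l_x(p) - K(x|p)`. -/
noncomputable def deltaFun (V : UniversalOracleMachine) (x : BStr) (f : BStr → BStr) : ℝ :=
  (lenx f x : ℝ) - (KcondFun V x f : ℝ)

/-- `K(m)` for an integer `m`. -/
noncomputable def KInt (U : UniversalPrefixMachine) (m : ℤ) : ℕ := U.K (code m)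


theorem exists_fuel {α σ : Type} [Primcodable α] [Primcodable σ] {f : α →. σ} (hf : Partrec f) :
    ∃ u : ℕ → α → Option σ, Primrec₂ u ∧
      (∀ k k' a x, k ≤ k' → u k a = some x → u k' a = some x) ∧
      (∀ a x, x ∈ f a ↔ ∃ k, u k a = some x) := by
  obtain ⟨c, hc⟩ := Nat.Partrec.Code.exists_code.1 hf
  refine ⟨fun k a => (Nat.Partrec.Code.evaln k c (Encodable.encode a)).bind
    (fun n => Encodable.decode n), ?_, ?_, ?_⟩
  · refine Primrec.option_bind (Nat.Partrec.Code.primrec_evaln.comp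
      (Primrec.pair (Primrec.pair Primrec.fst (Primrec.const c))
        (Primrec.encode.comp Primrec.snd))) (Primrec.decode.comp Primrec.snd).to₂
  · intro k k' a x hk h
    simp only [Option.bind_eq_some_iff] at h ⊢
    obtain ⟨n, h1, h2⟩ := h
    exact ⟨n, Nat.Partrec.Code.evaln_mono hk h1, h2⟩
  · intro a x
    have key : ∀ n, n ∈ c.eval (Encodable.encode a) ↔ ∃ b ∈ f a, Encodable.encode b = n := by
      intro n; rw [hc]; simp
    constructor
    · intro hx
      obtain ⟨k, hk⟩ := Nat.Partrec.Code.evaln_complete.1 ((key (Encodable.encode x)).2 ⟨x, hx, rfl⟩)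
      exact ⟨k, by simp [Option.mem_def.1 hk]⟩
    · rintro ⟨k, hk⟩
      simp only [Option.bind_eq_some_iff] at hk
      obtain ⟨n, h1, h2⟩ := hk
      obtain ⟨b, hb, hbn⟩ := (key n).1 (Nat.Partrec.Code.evaln_sound h1)
      subst hbn
      simp at h2
      subst h2; exact hb

theorem rfindOpt_mem {σ : Type} {f : ℕ → Option σ} {a : σ} (h : a ∈ Nat.rfindOpt f) :
    ∃ n, f n = some a := by
  simpa using Nat.rfindOpt_spec h

/-- Building prefix machines by witness search. -/
theorem PM_lemma (U : UniversalPrefixMachine) {W : Type} [Primcodable W]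
    (g : W × BStr × BStr → Option BStr) (hg : Computable g)
    (hpf : ∀ y w p w' p', (g (w, p, y)).isSome → (g (w', p', y)).isSome → p <+: p' → p = p') :
    ∃ s : BStr, ∀ p y,
      (∀ x, x ∈ U.eval (s ++ p) y → ∃ w, g (w, p, y) = some x) ∧
      (∀ w, (g (w, p, y)).isSome → (U.eval (s ++ p) y).Dom) := by
  let f : BStr × BStr → ℕ → Option BStr := fun a j =>
    (Encodable.decode (α := W) j).bind fun w => g (w, a.1, a.2)
  have hf : Computable₂ f := by
    refine Computable.option_bind (Computable.decode.comp Computable.snd) ?_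
    exact (hg.comp (Computable.pair Computable.snd (Computable.fst.comp Computable.fst))).to₂
  have hdom : ∀ p y, (Nat.rfindOpt (f (p, y))).Dom ↔ ∃ w, (g (w, p, y)).isSome := by
    intro p y
    rw [Nat.rfindOpt_dom]
    constructor
    · rintro ⟨n, a, h⟩
      simp only [f, Option.mem_def, Option.bind_eq_some_iff] at h
      obtain ⟨w, _, h⟩ := h
      exact ⟨w, by simp [h]⟩
    · rintro ⟨w, h⟩
      obtain ⟨a, ha⟩ := Option.isSome_iff_exists.1 h
      exact ⟨Encodable.encode w, a, by simp [f, ha]⟩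
  let M : PrefixMachine :=
    { eval := fun p y => Nat.rfindOpt (f (p, y))
      partrec' := by
        exact Partrec.rfindOpt hf
      prefixFree := by
        intro y p q hp hq hpq
        obtain ⟨w, hw⟩ := (hdom _ _).1 hp
        obtain ⟨w', hw'⟩ := (hdom _ _).1 hq
        exact hpf _ _ _ _ _ hw hw' hpq }
  obtain ⟨s, hs⟩ := U.universal M
  refine ⟨s, fun p y => ⟨?_, ?_⟩⟩
  · intro x hx
    rw [hs] at hx
    obtain ⟨n, hn⟩ := rfindOpt_mem hx
    simp only [f, Option.bind_eq_some_iff] at hn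
    obtain ⟨w, _, h⟩ := hn
    exact ⟨w, h⟩
  · intro w hw
    rw [hs]
    exact (hdom _ _).2 ⟨w, hw⟩

/-- If all witnesses produce the same output. -/
theorem PM_lemma' (U : UniversalPrefixMachine) {W : Type} [Primcodable W]
    (g : W × BStr × BStr → Option BStr) (hg : Computable g)
    (hpf : ∀ y w p w' p', (g (w, p, y)).isSome → (g (w', p', y)).isSome → p <+: p' → p = p') :
    ∃ s : BStr, ∀ p y x, (∃ w, g (w, p, y) = some x) →
      (∀ w x', g (w, p, y) = some x' → x' = x) → x ∈ U.eval (s ++ p) y := by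
  obtain ⟨s, hs⟩ := PM_lemma U g hg hpf
  refine ⟨s, fun p y x ⟨w, hw⟩ huniq => ?_⟩
  have hd := (hs p y).2 w (by simp [hw])
  obtain ⟨w', hw'⟩ := (hs p y).1 _ (Part.get_mem hd)
  have := huniq _ _ hw'
  rw [← this]; exact Part.get_mem hd

theorem mem_rfindOpt_iff {σ : Type} {f : ℕ → Option σ} {x : σ} :
    x ∈ Nat.rfindOpt f ↔ ∃ n, f n = some x ∧ ∀ m < n, f m = none := by
  unfold Nat.rfindOpt
  constructor
  · intro hx
    rw [Part.mem_bind_iff] at hx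
    obtain ⟨n, h1, h3⟩ := hx
    replace h1 := Nat.mem_rfind.1 h1
    refine ⟨n, by simpa using h3, fun m hm => ?_⟩
    have := h1.2 hm
    simpa using this
  · rintro ⟨n, h1, h2⟩
    rw [Part.mem_bind_iff]
    refine ⟨n, ?_, by simp [h1]⟩
    refine Nat.mem_rfind.2 ⟨by simp [h1], fun {m} hm => by simp [h2 m hm]⟩

theorem rfindOpt_congr_of {σ : Type} {f g : ℕ → Option σ} {N : ℕ}
    (h : ∀ j < N, f j = g j) (hN : ∀ j, N ≤ j → f j = none) {x : σ} (hx : x ∈ Nat.rfindOpt f) :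
    x ∈ Nat.rfindOpt g := by
  rw [mem_rfindOpt_iff] at hx ⊢
  obtain ⟨n, h1, h2⟩ := hx
  have hnN : n < N := by
    by_contra hh
    rw [hN n (by omega)] at h1; simp at h1
  exact ⟨n, by rw [← h n hnN]; exact h1, fun m hm => by rw [← h m (by omega)]; exact h2 m hm⟩

theorem OM_aux {W : Type} [Primcodable W]
    (G : (List ℕ × W) × BStr × BStr → Option BStr) (hG : Computable G) :
    Computable (fun (q : (List (ℕ × ℕ) × BStr × BStr) × ℕ) =>
        (Encodable.decode (α := W) q.2.unpair.2).bind fun w =>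
        G (((q.1.1.map Prod.snd).take q.2.unpair.1, w), q.1.2.1, q.1.2.2)) := by
  have hu : Computable (fun (q : (List (ℕ × ℕ) × BStr × BStr) × ℕ) => q.2.unpair) :=
    Computable.unpair.comp Computable.snd
  have h1 : Computable (fun (q : (List (ℕ × ℕ) × BStr × BStr) × ℕ) =>
      (q.1.1.map Prod.snd).take q.2.unpair.1) := by
    apply Primrec.to_comp
    refine Primrec.list_take.comp (Primrec.fst.comp (Primrec.unpair.comp Primrec.snd)) ?_
    exact Primrec.list_map (Primrec.fst.comp Primrec.fst) (Primrec.snd.comp Primrec.snd).to₂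
  have h2 : Computable (fun (r : ((List (ℕ × ℕ) × BStr × BStr) × ℕ) × W) =>
      ((((r.1.1.1.map Prod.snd).take r.1.2.unpair.1, r.2), r.1.1.2.1, r.1.1.2.2) :
        (List ℕ × W) × BStr × BStr)) := by
    refine Computable.pair (Computable.pair (h1.comp Computable.fst) Computable.snd) ?_
    exact Computable.snd.comp (Computable.fst.comp Computable.fst)
  have h3 : Computable₂ (fun (q : (List (ℕ × ℕ) × BStr × BStr) × ℕ) (w : W) =>
      G (((q.1.1.map Prod.snd).take q.2.unpair.1, w), q.1.2.1, q.1.2.2)) := hG.comp h2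
  exact Computable.option_bind (Computable.decode.comp (Computable.snd.comp hu)) h3

/-- Building oracle machines by witness search. -/
theorem OM_lemma (V : UniversalOracleMachine) {W : Type} [Primcodable W]
    (G : (List ℕ × W) × BStr × BStr → Option BStr) (hG : Computable G)
    (hpf : ∀ (O : ℕ → ℕ) y t w p t' w' p', (G (((List.range t).map O, w), p, y)).isSome →
      (G (((List.range t').map O, w'), p', y)).isSome → p <+: p' → p = p') :
    ∃ s : BStr, ∀ O p y x, (∃ t w, G (((List.range t).map O, w), p, y) = some x) →
      (∀ t w x', G (((List.range t).map O, w), p, y) = some x' → x' = x) →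
      x ∈ V.eval O (s ++ p) y := by
  let f : (ℕ → ℕ) → BStr × BStr → ℕ → Option BStr := fun O a j =>
    (Encodable.decode (α := W) j.unpair.2).bind fun w =>
      G (((List.range j.unpair.1).map O, w), a.1, a.2)
  let h : List (ℕ × ℕ) × BStr × BStr → ℕ → Option BStr := fun a j =>
    if j < a.1.length ∧ a.1.map Prod.fst = List.range a.1.length then
    (Encodable.decode (α := W) j.unpair.2).bind fun w =>
      G (((a.1.map Prod.snd).take j.unpair.1, w), a.2.1, a.2.2) else none
  have hh : Computable₂ h := by
    have hc : PrimrecPred (fun (q : (List (ℕ × ℕ) × BStr × BStr) × ℕ) => q.2 < q.1.1.length ∧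
        q.1.1.map Prod.fst = List.range q.1.1.length) := by
      refine PrimrecPred.and ?_ ?_
      · exact Primrec.nat_lt.comp Primrec.snd
          (Primrec.list_length.comp (Primrec.fst.comp Primrec.fst))
      · refine PrimrecRel.comp Primrec.eq ?_ ?_
        · exact Primrec.list_map (Primrec.fst.comp Primrec.fst) (Primrec.fst.comp Primrec.snd).to₂
        · exact Primrec.list_range.comp (Primrec.list_length.comp (Primrec.fst.comp Primrec.fst))
    have hthen : Computable (fun (q : (List (ℕ × ℕ) × BStr × BStr) × ℕ) => 
        (Encodable.decode (α := W) q.2.unpair.2).bind fun w =>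
        G (((q.1.1.map Prod.snd).take q.2.unpair.1, w), q.1.2.1, q.1.2.2)) := by
      exact OM_aux G hG
    have := Computable.cond (hc.decide.to_comp) hthen (Computable.const (none : Option BStr))
    refine this.of_eq ?_
    intro q
    simp only [h, Bool.cond_decide]
  have hdom : ∀ O p y, (Nat.rfindOpt (f O (p, y))).Dom ↔
      ∃ t w, (G (((List.range t).map O, w), p, y)).isSome := by
    intro O p y
    rw [Nat.rfindOpt_dom]
    constructor
    · rintro ⟨n, a, h⟩
      simp only [f, Option.mem_def, Option.bind_eq_some_iff] at h
      obtain ⟨w, _, h⟩ := h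
      exact ⟨_, w, by rw [h]; rfl⟩
    · rintro ⟨t, w, h⟩
      obtain ⟨a, ha⟩ := Option.isSome_iff_exists.1 h
      exact ⟨Nat.pair t (Encodable.encode w), a, by simp [f, ha]⟩
  let M : OraclePrefixMachine :=
    { eval := fun O p y => Nat.rfindOpt (f O (p, y))
      prefixFree := by
        intro O y p q hp hq hpq
        obtain ⟨t, w, hw⟩ := (hdom _ _ _).1 hp
        obtain ⟨t', w', hw'⟩ := (hdom _ _ _).1 hq
        exact hpf _ _ _ _ _ _ _ _ hw hw' hpq
      table := fun a => Nat.rfindOpt (h a)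
      table_partrec := Partrec.rfindOpt hh
      eval_spec := by
        intro O p y x
        have key : ∀ N, ∀ j < N, f O (p, y) j = h ((List.range N).map (fun i => (i, O i)), p, y) j := by
          intro N j hj
          have e1 : List.map (Prod.fst ∘ fun i => (i, O i)) (List.range N) = List.range N := by
            conv_rhs => rw [← List.map_id (List.range N)]
            rfl
          have e2 : List.take (Nat.unpair j).1 (List.map (Prod.snd ∘ fun i => (i, O i)) (List.range N))
              = List.map O (List.range (Nat.unpair j).1) := by
            rw [← List.map_take, List.take_range, min_eq_left]
            · rfl
            · exact (Nat.unpair_left_le j).trans hj.le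
          simp only [f, h, List.length_map, List.length_range, hj, true_and, List.map_map, e1, if_true, e2]
        constructor
        · intro hx
          obtain ⟨n, hn⟩ := rfindOpt_mem hx
          refine ⟨(List.range (n+1)).map (fun i => (i, O i)), by simp, ?_⟩
          have e := key (n+1)
          rw [mem_rfindOpt_iff] at hx ⊢
          obtain ⟨k, h1, h2⟩ := hx
          have hkn : k ≤ n := by
            by_contra hh
            have := h2 n (by omega)
            simp [hn] at this
          exact ⟨k, by rw [← e k (by omega)]; exact h1,
            fun m hm => by rw [← e m (by omega)]; exact h2 m hm⟩
        · rintro ⟨T, hT, hx⟩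
          obtain ⟨n, hn⟩ := rfindOpt_mem hx
          have hcond : T.map Prod.fst = List.range T.length := by
            by_contra hne
            simp [h, hne] at hn
          have hTe : T = (List.range T.length).map (fun i => (i, O i)) := by
            rw [← hcond, List.map_map]
            conv_lhs => rw [← List.map_id T]
            apply List.map_congr_left
            intro q hq
            simp [hT q hq]
          refine rfindOpt_congr_of (N := T.length) (f := h (T, p, y)) ?_ ?_ hx
          · intro j hj
            rw [key T.length j hj, ← hTe]
          · intro j hj
            simp only [h]; rw [if_neg]; intro hh; omega }
  obtain ⟨s, hs⟩ := V.universal M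
  refine ⟨s, ?_⟩
  rintro O p y x ⟨t, w, hw⟩ huniq
  rw [hs]
  have hd : (M.eval O p y).Dom := (hdom _ _ _).2 ⟨t, w, by simp [hw]⟩
  have hm := Part.get_mem hd
  obtain ⟨n, hn⟩ := rfindOpt_mem hm
  simp only [f, Option.bind_eq_some_iff] at hn
  obtain ⟨w, _, h⟩ := hn
  have := huniq _ _ _ h
  rw [this] at hm; exact hm


section primtools
variable {α β σ : Type} [Primcodable α] [Primcodable β] [Primcodable σ]

theorem prim_all {f : α → List β} {p : α → β → Bool} (hf : Primrec f) (hp : Primrec₂ p) :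
    Primrec fun a => (f a).all (p a) := by
  have : Primrec fun a => (f a).foldr (fun b s => p a b && s) true := by
    refine Primrec.list_foldr (h := fun a q => p a q.1 && q.2) hf (Primrec.const true) ?_
    exact (Primrec.and.comp (hp.comp Primrec.fst (Primrec.fst.comp Primrec.snd))
      (Primrec.snd.comp Primrec.snd)).to₂
  refine this.of_eq fun a => ?_
  induction f a with
  | nil => rfl
  | cons b l ih => simp [ih]

theorem prim_filter {f : α → List β} {p : α → β → Bool} (hf : Primrec f) (hp : Primrec₂ p) :
    Primrec fun a => (f a).filter (p a) := by
  have : Primrec fun a => (f a).filterMap (fun b => cond (p a b) (some b) none) := by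
    refine Primrec.listFilterMap hf ?_
    exact (Primrec.cond hp (Primrec.option_some.comp Primrec.snd) (Primrec.const none)).to₂
  refine this.of_eq fun a => ?_
  induction f a with
  | nil => rfl
  | cons b l ih =>
    cases h : p a b <;> simp [h, ih]

theorem prim_sum {f : α → List ℕ} (hf : Primrec f) : Primrec fun a => (f a).sum := by
  have : Primrec fun a => (f a).foldr (fun b s => b + s) 0 := by
    refine Primrec.list_foldr (h := fun _ q => q.1 + q.2) hf (Primrec.const 0) ?_
    exact (Primrec.nat_add.comp (Primrec.fst.comp Primrec.snd)
      (Primrec.snd.comp Primrec.snd)).to₂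
  exact this.of_eq fun a => rfl

theorem prim_pow : Primrec₂ (fun a b : ℕ => a ^ b) :=
  Primrec₂.unpaired'.1 Nat.Primrec.pow

theorem prim_lt {f g : α → ℕ} (hf : Primrec f) (hg : Primrec g) :
    Primrec fun a => decide (f a < g a) := (Primrec.nat_lt.comp hf hg).decide

theorem prim_le {f g : α → ℕ} (hf : Primrec f) (hg : Primrec g) :
    Primrec fun a => decide (f a ≤ g a) := (Primrec.nat_le.comp hf hg).decide

theorem prim_eq [DecidableEq β] {f g : α → β} (hf : Primrec f) (hg : Primrec g) :
    Primrec fun a => decide (f a = g a) := (PrimrecRel.comp Primrec.eq hf hg).decide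
end primtools

/-- Value of a little-endian bit string. -/
def ofBits (w : BStr) : ℕ := w.foldr (fun b n => Nat.bit b n) 0

theorem prim_ofBits : Primrec ofBits := by
  refine Primrec.list_foldr (f := fun w : BStr => w) (h := fun _ q => Nat.bit q.1 q.2) Primrec.id (Primrec.const 0) ?_
  have : Primrec₂ Nat.bit := by
    have h : Primrec₂ (fun (b : Bool) (n : ℕ) => cond b (2 * n + 1) (2 * n)) := by
      have h2 : Primrec (fun q : Bool × ℕ => 2 * q.2) :=
        Primrec.nat_mul.comp (Primrec.const 2) Primrec.snd
      exact Primrec.cond Primrec.fst (Primrec.succ.comp h2) h2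
    exact h.of_eq fun b n => by cases b <;> simp [Nat.bit]
  exact (this.comp (Primrec.fst.comp Primrec.snd) (Primrec.snd.comp Primrec.snd)).to₂

theorem ofBits_bits (n : ℕ) : ofBits (Nat.bits n) = n := by
  induction n using Nat.binaryRec' with
  | zero => simp [ofBits]
  | bit b n h ih =>
    rw [Nat.bits_append_bit _ _ h]
    simp only [ofBits, List.foldr_cons] at ih ⊢
    rw [ih]

theorem bits_rec (n : ℕ) (h : n ≠ 0) : Nat.bits n = Nat.bodd n :: Nat.bits (n / 2) := by
  have e : Nat.bit (Nat.bodd n) (n / 2) = n := by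
    rw [← Nat.div2_val]; exact Nat.bit_bodd_div2 n
  conv_lhs => rw [← e]
  apply Nat.bits_append_bit
  intro h2
  cases hb : n.bodd
  · rw [hb, h2] at e; simp at e; omega
  · rfl

theorem prim_bits : Primrec Nat.bits := by
  have : Primrec₂ (fun (_ : Unit) (n : ℕ) => Nat.bits n) := by
    refine Primrec.nat_strong_rec _ (g := fun _ l => some (cond (decide (l.length = 0)) []
      (Nat.bodd l.length :: (l.getD (l.length / 2) [])))) ?_ ?_
    · have hl : Primrec (fun q : Unit × List BStr => q.2.length) :=
        Primrec.list_length.comp Primrec.snd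
      refine (Primrec.option_some.comp (Primrec.cond (prim_eq hl (Primrec.const 0))
        (Primrec.const []) (Primrec.list_cons.comp (Primrec.nat_bodd.comp hl) ?_)))
      exact (Primrec.list_getD []).comp Primrec.snd (Primrec.nat_div.comp hl (Primrec.const 2))
    · intro _ n
      rcases Nat.eq_zero_or_pos n with h | h
      · subst h; simp
      · have h2 : n / 2 < n := Nat.div_lt_self h (by norm_num)
        simp only [List.length_map, List.length_range, Option.some.injEq]
        rw [bits_rec n (by omega)]
        have : ¬ n = 0 := by omega
        simp [this, List.getD, h2]
  exact this.comp (Primrec.const ()) Primrec.id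

/-- Self-delimiting version of a string. -/
def sd (w : BStr) : BStr := w.foldr (fun b s => true :: b :: s) [false]

theorem prim_sd : Primrec sd := by
  refine Primrec.list_foldr (f := fun w : BStr => w) (h := fun _ q => true :: q.1 :: q.2) Primrec.id (Primrec.const [false]) ?_
  exact (Primrec.list_cons.comp (Primrec.const true) (Primrec.list_cons.comp
    (Primrec.fst.comp Primrec.snd) (Primrec.snd.comp Primrec.snd))).to₂

theorem sd_length (w : BStr) : (sd w).length = 2 * w.length + 1 := by
  induction w with
  | nil => rfl
  | cons b w ih =>
    have : sd (b :: w) = true :: b :: sd w := rfl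
    rw [this]; simp [ih]; ring

theorem sd_pfx : ∀ w w' t t' : BStr, sd w ++ t = sd w' ++ t' → w = w' ∧ t = t' := by
  intro w
  induction w with
  | nil =>
    intro w' t t' h
    cases w' with
    | nil => simpa [sd] using h
    | cons b w' => simp [sd] at h
  | cons b w ih =>
    intro w' t t' h
    cases w' with
    | nil => simp [sd] at h
    | cons b' w' =>
      have e1 : sd (b :: w) = true :: b :: sd w := rfl
      have e2 : sd (b' :: w') = true :: b' :: sd w' := rfl
      rw [e1, e2] at h
      simp only [List.cons_append, List.cons.injEq, true_and] at h
      obtain ⟨h1, h2⟩ := h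
      obtain ⟨h3, h4⟩ := ih _ _ _ h2
      exact ⟨by rw [h1, h3], h4⟩

theorem U_lit (U : UniversalPrefixMachine) : ∃ s : BStr, ∀ w y, w ∈ U.eval (s ++ sd w) y := by
  obtain ⟨s, hs⟩ := PM_lemma' U (W := BStr)
    (fun q => cond (decide (q.2.1 = sd q.1)) (some q.1) none) (by
      apply Primrec.to_comp
      exact Primrec.cond (prim_eq (Primrec.fst.comp Primrec.snd) (prim_sd.comp Primrec.fst))
        (Primrec.option_some.comp Primrec.fst) (Primrec.const none)) (by
      intro y w p w' p' h h' hp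
      have e1 : p = sd w := by by_contra hh; simp [hh] at h
      have e2 : p' = sd w' := by by_contra hh; simp [hh] at h'
      obtain ⟨t, ht⟩ := hp
      have := sd_pfx w w' t [] (by rw [← e1, ht, e2]; simp)
      rw [e1, e2, this.1])
  refine ⟨s, fun w y => hs _ _ _ ⟨w, by simp⟩ ?_⟩
  intro w' x' h
  have e1 : sd w = sd w' := by by_contra hh; simp [hh] at h
  have := (sd_pfx w w' [] [] (by simp [e1])).1
  subst this
  simpa using h.symm

/-- All strings of a given length. -/
def strs (a : ℕ) : List BStr :=
  Nat.rec [[]] (fun _ l => l.flatMap fun z => [false :: z, true :: z]) a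

theorem prim_strs : Primrec strs := by
  refine Primrec.nat_rec₁ [[]] ?_
  refine Primrec.list_flatMap Primrec.snd ?_
  refine (Primrec.list_cons.comp (Primrec.list_cons.comp (Primrec.const false) Primrec.snd)
    (Primrec.list_cons.comp (Primrec.list_cons.comp (Primrec.const true) Primrec.snd)
    (Primrec.const [])))

theorem strs_succ (a : ℕ) : strs (a + 1) = (strs a).flatMap fun z => [false :: z, true :: z] := rfl

theorem mem_strs (a : ℕ) (z : BStr) : z ∈ strs a ↔ z.length = a := by
  induction a generalizing z with
  | zero => simp [strs]
  | succ a ih =>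
    rw [strs_succ]
    simp only [List.mem_flatMap, ih]
    constructor
    · rintro ⟨w, hw, h⟩
      simp at h
      rcases h with h | h <;> subst h <;> simp [hw]
    · intro h
      cases z with
      | nil => simp at h
      | cons b z => exact ⟨z, by simpa using h, by cases b <;> simp⟩

theorem strs_length (a : ℕ) : (strs a).length = 2 ^ a := by
  induction a with
  | zero => rfl
  | succ a ih =>
    rw [strs_succ, List.length_flatMap]
    simp [ih, pow_succ]

theorem strs_nodup (a : ℕ) : (strs a).Nodup := by
  induction a with
  | zero => simp [strs]
  | succ a ih =>
    rw [strs_succ, List.nodup_flatMap]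
    refine ⟨by simp, ?_⟩
    refine ih.imp ?_
    intro z z' h
    simp [Function.onFun, h.symm]

theorem encode_finset_sorted (L : List BStr)
    (hL : L.Pairwise (fun a b => Encodable.encode a < Encodable.encode b)) :
    code L.toFinset = code L := by
  unfold code
  congr 1
  have hnd : L.Nodup := hL.imp (fun {a b} h hab => by subst hab; exact lt_irrefl _ h)
  have h1 : L.toFinset = ⟨(L : Multiset BStr), by simpa using hnd⟩ := by
    ext z; simp
  rw [h1]
  show Encodable.encode (((L : Multiset BStr)).sort (Encodable.encode' BStr ⁻¹'o (· ≤ ·))) = _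
  congr 1
  refine List.Perm.eq_of_pairwise (le := fun a b : BStr => Encodable.encode a ≤ Encodable.encode b) ?_ ?_ ?_ ?_
  · intro a b _ _ h1 h2
    exact Encodable.encode_injective (le_antisymm h1 h2)
  · exact Multiset.pairwise_sort _ (Encodable.encode' BStr ⁻¹'o (· ≤ ·))
  · exact hL.imp (fun h => h.le)
  · apply Multiset.coe_eq_coe.1
    rw [Multiset.sort_eq]

/-- Sorting strings by code. -/
def sortL (L : List BStr) : List BStr :=
  (List.range (L.map Encodable.encode).sum.succ).filterMap
    fun i => (L.filter fun z => decide (Encodable.encode z = i)).head?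

theorem prim_sortL : Primrec sortL := by
  refine Primrec.listFilterMap ?_ ?_
  · exact Primrec.list_range.comp (Primrec.succ.comp (prim_sum
      (Primrec.list_map Primrec.id (Primrec.encode.comp Primrec.snd).to₂)))
  · refine Primrec.list_head?.comp (prim_filter Primrec.fst ?_)
    exact prim_eq (Primrec.encode.comp Primrec.snd) (Primrec.snd.comp Primrec.fst)

theorem sortL_aux (L : List BStr) (i : ℕ) (z : BStr)
    (h : (L.filter fun z => decide (Encodable.encode z = i)).head? = some z) :
    z ∈ L ∧ Encodable.encode z = i := by
  have := List.mem_of_mem_head? (Option.mem_def.2 h)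
  simpa using this

theorem code_sortL (L : List BStr) : code L.toFinset = code (sortL L) := by
  have hmem : (sortL L).toFinset = L.toFinset := by
    ext z
    simp only [List.mem_toFinset, sortL, List.mem_filterMap, List.mem_range]
    constructor
    · rintro ⟨i, _, h⟩
      exact (sortL_aux L i z h).1
    · intro hz
      refine ⟨Encodable.encode z, ?_, ?_⟩
      · have : Encodable.encode z ≤ (L.map Encodable.encode).sum :=
          List.le_sum_of_mem (List.mem_map.2 ⟨z, hz, rfl⟩)
        omega
      · have hne : (L.filter fun w => decide (Encodable.encode w = Encodable.encode z)) ≠ [] := by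
          intro h0
          have : z ∈ (L.filter fun w => decide (Encodable.encode w = Encodable.encode z)) := by
            simp [hz]
          rw [h0] at this; simp at this
        obtain ⟨w, hw⟩ : ∃ w, (L.filter fun w => decide (Encodable.encode w = Encodable.encode z)).head? = some w := by
          cases hh : (L.filter fun w => decide (Encodable.encode w = Encodable.encode z)) with
          | nil => exact absurd hh hne
          | cons a l => exact ⟨a, rfl⟩
        have := (sortL_aux _ _ _ hw).2
        rw [hw, Encodable.encode_injective this]
  rw [← hmem]
  apply encode_finset_sorted
  rw [sortL, List.pairwise_filterMap]
  refine List.pairwise_lt_range.imp ?_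
  intro i j hij b hb b' hb'
  rw [(sortL_aux L i b hb).2, (sortL_aux L j b' hb').2]
  exact hij

/-- Code of the finite set listed by `L`. -/
def setCode (L : List BStr) : BStr := Nat.bits (Encodable.encode (sortL L))

theorem setCode_eq (L : List BStr) : setCode L = code L.toFinset := (code_sortL L).symm

theorem prim_setCode : Primrec setCode := prim_bits.comp (Primrec.encode.comp prim_sortL)

theorem Kc_le {U : UniversalPrefixMachine} {x y p : BStr} (h : x ∈ U.eval p y) :
    U.Kc x y ≤ p.length := Nat.sInf_le ⟨p, rfl, h⟩

theorem Kc_spec (U : UniversalPrefixMachine) (x y : BStr) :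
    ∃ p : BStr, p.length = U.Kc x y ∧ x ∈ U.eval p y := by
  obtain ⟨s, hs⟩ := U_lit U
  exact Nat.sInf_mem (s := {n | ∃ p : BStr, p.length = n ∧ x ∈ U.eval p y})
    ⟨_, s ++ sd x, rfl, hs x y⟩


noncomputable def UstX (U : UniversalPrefixMachine) : ℕ → BStr × BStr → Option BStr :=
  (exists_fuel U.partrec').choose

noncomputable def Ust (U : UniversalPrefixMachine) (k : ℕ) (p y : BStr) : Option BStr :=
  UstX U k (p, y)

section
variable {U : UniversalPrefixMachine} {α : Type} [Primcodable α]

theorem prim_Ust {f : α → ℕ} {g h : α → BStr} (hf : Primrec f) (hg : Primrec g) (hh : Primrec h) :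
    Primrec fun a => Ust U (f a) (g a) (h a) :=
  (exists_fuel U.partrec').choose_spec.1.comp hf (Primrec.pair hg hh)

theorem Ust_mono {k k' : ℕ} {p y x : BStr} (hk : k ≤ k') (h : Ust U k p y = some x) :
    Ust U k' p y = some x :=
  (exists_fuel U.partrec').choose_spec.2.1 _ _ _ _ hk h

theorem mem_U_iff {p y x : BStr} : x ∈ U.eval p y ↔ ∃ k, Ust U k p y = some x :=
  (exists_fuel U.partrec').choose_spec.2.2 (p, y) x

theorem Ust_mem {k : ℕ} {p y x : BStr} (h : Ust U k p y = some x) : x ∈ U.eval p y :=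
  mem_U_iff.2 ⟨k, h⟩

theorem Ust_uniq {k k' : ℕ} {p y x x' : BStr} (h : Ust U k p y = some x)
    (h' : Ust U k' p y = some x') : x = x' := Part.mem_unique (Ust_mem h) (Ust_mem h')

theorem U_pf {p p' y x x' : BStr} (h : x ∈ U.eval p y)
    (h' : x' ∈ U.eval p' y) (hp : p <+: p') : p = p' :=
  U.prefixFree y p p' (Part.dom_iff_mem.2 ⟨_, h⟩)
    (Part.dom_iff_mem.2 ⟨_, h'⟩) hp

theorem Ust_pf {k k' : ℕ} {p p' y x x' : BStr} (h : Ust U k p y = some x)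
    (h' : Ust U k' p' y = some x') (hp : p <+: p') : p = p' :=
  U_pf (Ust_mem h) (Ust_mem h') hp

theorem Ust_concat {k k' : ℕ} {r r' q q' y x x' : BStr} (h : Ust U k r y = some x)
    (h' : Ust U k' r' y = some x') (hp : r ++ q <+: r' ++ q') : r = r' ∧ q <+: q' := by
  have e : r = r' := by
    rcases List.prefix_or_prefix_of_prefix ((List.prefix_append r q).trans hp)
      (List.prefix_append r' q') with h1 | h1
    · exact Ust_pf h h' h1
    · exact (Ust_pf h' h h1).symm
  subst e
  exact ⟨rfl, (List.prefix_append_right_inj r).1 hp⟩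

theorem Kc_Ust (U : UniversalPrefixMachine) (x y : BStr) :
    ∃ p : BStr, p.length = U.Kc x y ∧ ∃ k, Ust U k p y = some x := by
  obtain ⟨p, h1, h2⟩ := Kc_spec U x y
  exact ⟨p, h1, mem_U_iff.1 h2⟩
end

/-- uniform fuel for a list of halting computations -/
theorem Ust_uniform {U : UniversalPrefixMachine} {ι : Type} (l : List ι) (p y : ι → BStr) (x : ι → BStr)
    (h : ∀ i ∈ l, x i ∈ U.eval (p i) (y i)) :
    ∃ k, ∀ i ∈ l, Ust U k (p i) (y i) = some (x i) := by
  induction l with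
  | nil => exact ⟨0, by simp⟩
  | cons a l ih =>
    obtain ⟨k, hk⟩ := ih (fun i hi => h i (by simp [hi]))
    obtain ⟨k', hk'⟩ := mem_U_iff.1 (h a (by simp))
    refine ⟨max k k', fun i hi => ?_⟩
    rcases List.mem_cons.1 hi with rfl | hi
    · exact Ust_mono (le_max_right _ _) hk'
    · exact Ust_mono (le_max_left _ _) (hk i hi)

/-- Machine producing the code of the range set. -/
theorem b_machine1 (U : UniversalPrefixMachine) : ∃ s : BStr, ∀ (f : BStr → BStr) (l : ℕ) (r q : BStr),
    code l ∈ U.eval r [] → (∀ d, f d ∈ U.eval q d) →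
    code ((strs l).map f).toFinset ∈ U.eval (s ++ (r ++ q)) [] := by
  let g : ((BStr × BStr) × (ℕ × List BStr)) × BStr × BStr → Option BStr := fun a =>
    (Ust U a.1.2.1 a.1.1.1 []).bind fun o =>
      cond (decide (a.2.1 = a.1.1.1 ++ a.1.1.2) &&
        decide ((strs (ofBits o)).map (fun d => Ust U a.1.2.1 a.1.1.2 d) = a.1.2.2.map some))
        (some (setCode a.1.2.2)) none
  have gspec : ∀ r q k L p y x, g (((r, q), (k, L)), p, y) = some x ↔
      ∃ o, Ust U k r [] = some o ∧ p = r ++ q ∧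
        (strs (ofBits o)).map (fun d => Ust U k q d) = L.map some ∧ x = setCode L := by
    intro r q k L p y x
    simp only [g, Option.bind_eq_some_iff]
    refine exists_congr fun o => and_congr_right fun _ => ?_
    by_cases h1 : p = r ++ q <;>
      by_cases h2 : (strs (ofBits o)).map (fun d => Ust U k q d) = L.map some <;> simp [h1, h2, eq_comm]
  have hg : Computable g := by
    apply Primrec.to_comp
    have hk : Primrec (fun a : ((BStr × BStr) × (ℕ × List BStr)) × BStr × BStr => a.1.2.1) :=
      Primrec.fst.comp (Primrec.snd.comp Primrec.fst)
    have hL : Primrec (fun a : ((BStr × BStr) × (ℕ × List BStr)) × BStr × BStr => a.1.2.2) :=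
      Primrec.snd.comp (Primrec.snd.comp Primrec.fst)
    have hr : Primrec (fun a : ((BStr × BStr) × (ℕ × List BStr)) × BStr × BStr => a.1.1.1) :=
      Primrec.fst.comp (Primrec.fst.comp Primrec.fst)
    have hq : Primrec (fun a : ((BStr × BStr) × (ℕ × List BStr)) × BStr × BStr => a.1.1.2) :=
      Primrec.snd.comp (Primrec.fst.comp Primrec.fst)
    have hp : Primrec (fun a : ((BStr × BStr) × (ℕ × List BStr)) × BStr × BStr => a.2.1) :=
      Primrec.fst.comp Primrec.snd
    refine Primrec.option_bind (prim_Ust hk hr (Primrec.const [])) ?_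
    refine Primrec.cond (Primrec.and.comp ?_ ?_) ?_ (Primrec.const none)
    · exact (prim_eq hp (Primrec.list_append.comp hr hq)).comp Primrec.fst
    · refine prim_eq ?_ ?_
      · refine Primrec.list_map (prim_strs.comp (prim_ofBits.comp Primrec.snd)) ?_
        exact prim_Ust (hk.comp (Primrec.fst.comp Primrec.fst)) (hq.comp (Primrec.fst.comp Primrec.fst))
          Primrec.snd
      · exact Primrec.list_map (hL.comp Primrec.fst) (Primrec.option_some.comp Primrec.snd).to₂
    · exact Primrec.option_some.comp (prim_setCode.comp (hL.comp Primrec.fst))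
  have hone : ∀ (l k : ℕ) (q : BStr) (L : List BStr), (strs l).map (fun d => Ust U k q d) = L.map some →
      ∀ d ∈ strs l, ∃ x ∈ L, Ust U k q d = some x := by
    intro l k q L h d hd
    have : Ust U k q d ∈ (strs l).map (fun d => Ust U k q d) := List.mem_map.2 ⟨d, hd, rfl⟩
    rw [h, List.mem_map] at this
    obtain ⟨x, hx, hx'⟩ := this
    exact ⟨x, hx, hx'.symm⟩
  have hr0 : ∀ l, List.replicate l false ∈ strs l := fun l => by simp [mem_strs]
  have huniq : ∀ r q k L p y x r' q' k' L' p' y' x', g (((r, q), (k, L)), p, y) = some x →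
      g (((r', q'), (k', L')), p', y') = some x' → p <+: p' → p = p' ∧ x = x' := by
    intro r q k L p y x r' q' k' L' p' y' x' h h' hp
    obtain ⟨o, h1, rfl, h3, h4⟩ := (gspec _ _ _ _ _ _ _).1 h
    obtain ⟨o', h1', rfl, h3', h4'⟩ := (gspec _ _ _ _ _ _ _).1 h'
    obtain ⟨rfl, hq⟩ := Ust_concat h1 h1' hp
    obtain rfl := Ust_uniq h1 h1'
    obtain ⟨z, _, hz⟩ := hone _ _ _ _ h3 _ (hr0 _)
    obtain ⟨z', _, hz'⟩ := hone _ _ _ _ h3' _ (hr0 _)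
    obtain rfl := Ust_pf hz hz' hq
    refine ⟨rfl, ?_⟩
    have hLL : L.map some = L'.map some := by
      rw [← h3, ← h3']
      apply List.map_congr_left
      intro d hd
      obtain ⟨z, _, hz⟩ := hone _ _ _ _ h3 _ hd
      obtain ⟨z', _, hz'⟩ := hone _ _ _ _ h3' _ hd
      rw [hz, hz', Ust_uniq hz hz']
    have : L = L' := List.map_injective_iff.2 (Option.some_injective _) hLL
    rw [h4, h4', this]
  obtain ⟨s, hs⟩ := PM_lemma' U g hg (by
    rintro y ⟨⟨r, q⟩, ⟨k, L⟩⟩ p ⟨⟨r', q'⟩, ⟨k', L'⟩⟩ p' h h' hp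
    obtain ⟨x, hx⟩ := Option.isSome_iff_exists.1 h
    obtain ⟨x', hx'⟩ := Option.isSome_iff_exists.1 h'
    exact (huniq _ _ _ _ _ _ _ _ _ _ _ _ _ _ hx hx' hp).1)
  refine ⟨s, fun f l r q hr hq => ?_⟩
  obtain ⟨k1, hk1⟩ := mem_U_iff.1 hr
  obtain ⟨k2, hk2⟩ := Ust_uniform (U := U) (strs l) (fun _ => q) (fun d => d) f (fun d _ => hq d)
  have hw : g (((r, q), (max k1 k2, (strs l).map f)), r ++ q, []) = some (code ((strs l).map f).toFinset) := by
    refine (gspec _ _ _ _ _ _ _).2 ⟨code l, Ust_mono (le_max_left _ _) hk1, rfl, ?_, (setCode_eq _).symm⟩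
    have : ofBits (code l) = l := ofBits_bits l
    rw [this, List.map_map]
    apply List.map_congr_left
    intro d hd
    exact Ust_mono (le_max_right _ _) (hk2 d hd)
  refine hs _ _ _ ⟨_, hw⟩ ?_
  rintro ⟨⟨r', q'⟩, ⟨k', L'⟩⟩ x' hx'
  exact (huniq _ _ _ _ _ _ _ _ _ _ _ _ _ _ hx' hw (List.prefix_refl _)).2

theorem getElem?_rangeMap {O : ℕ → ℕ} {t i v : ℕ} (h : ((List.range t).map O)[i]? = some v) :
    v = O i := by
  rw [List.getElem?_map] at h
  simp only [Option.map_eq_some_iff] at h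
  obtain ⟨a, ha, rfl⟩ := h
  rw [List.getElem?_eq_some_iff] at ha
  obtain ⟨h1, h2⟩ := ha
  simp at h2; rw [h2]

theorem getElem?_rangeMap_lt (O : ℕ → ℕ) {t i : ℕ} (h : i < t) :
    ((List.range t).map O)[i]? = some (O i) := by
  simp [h]

/-- Oracle machine. -/
theorem b_machine2 (U : UniversalPrefixMachine) (V : UniversalOracleMachine) :
    ∃ s : BStr, ∀ (f : BStr → BStr) (l : ℕ) (r q x : BStr),
    code l ∈ U.eval r [] → x ∈ U.eval q (code ((strs l).map f).toFinset) →
    x ∈ V.eval (oracleOfFun f) (s ++ (r ++ q)) [] := by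
  let G : (List ℕ × ((BStr × BStr) × (ℕ × List BStr))) × BStr × BStr → Option BStr := fun a =>
    (Ust U a.1.2.2.1 a.1.2.1.1 []).bind fun o =>
      cond (decide (a.2.1 = a.1.2.1.1 ++ a.1.2.1.2) &&
        decide ((strs (ofBits o)).map (fun d => a.1.1[Encodable.encode d]?) =
          a.1.2.2.2.map (fun z => some (Encodable.encode z + 1))))
        (Ust U a.1.2.2.1 a.1.2.1.2 (setCode a.1.2.2.2)) none
  have gspec : ∀ (T : List ℕ) (r q : BStr) (k : ℕ) (L : List BStr) (p y x : BStr), G ((T, ((r, q), (k, L))), p, y) = some x ↔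
      ∃ o, Ust U k r [] = some o ∧ p = r ++ q ∧
        (strs (ofBits o)).map (fun d => T[Encodable.encode d]?) =
          L.map (fun z => some (Encodable.encode z + 1)) ∧ Ust U k q (setCode L) = some x := by
    intro T r q k L p y x
    simp only [G, Option.bind_eq_some_iff]
    refine exists_congr fun o => and_congr_right fun _ => ?_
    by_cases h1 : p = r ++ q <;>
      by_cases h2 : (strs (ofBits o)).map (fun d => T[Encodable.encode d]?) =
          L.map (fun z => some (Encodable.encode z + 1)) <;> simp [h1, h2]
  have hG : Computable G := by
    apply Primrec.to_comp
    have hw : Primrec (fun a : (List ℕ × ((BStr × BStr) × (ℕ × List BStr))) × BStr × BStr => a.1.2) :=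
      Primrec.snd.comp Primrec.fst
    have hT : Primrec (fun a : (List ℕ × ((BStr × BStr) × (ℕ × List BStr))) × BStr × BStr => a.1.1) :=
      Primrec.fst.comp Primrec.fst
    have hk : Primrec (fun a : (List ℕ × ((BStr × BStr) × (ℕ × List BStr))) × BStr × BStr => a.1.2.2.1) :=
      Primrec.fst.comp (Primrec.snd.comp hw)
    have hL : Primrec (fun a : (List ℕ × ((BStr × BStr) × (ℕ × List BStr))) × BStr × BStr => a.1.2.2.2) :=
      Primrec.snd.comp (Primrec.snd.comp hw)
    have hr : Primrec (fun a : (List ℕ × ((BStr × BStr) × (ℕ × List BStr))) × BStr × BStr => a.1.2.1.1) :=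
      Primrec.fst.comp (Primrec.fst.comp hw)
    have hq : Primrec (fun a : (List ℕ × ((BStr × BStr) × (ℕ × List BStr))) × BStr × BStr => a.1.2.1.2) :=
      Primrec.snd.comp (Primrec.fst.comp hw)
    have hp : Primrec (fun a : (List ℕ × ((BStr × BStr) × (ℕ × List BStr))) × BStr × BStr => a.2.1) :=
      Primrec.fst.comp Primrec.snd
    refine Primrec.option_bind (prim_Ust hk hr (Primrec.const [])) ?_
    refine Primrec.cond (Primrec.and.comp ?_ ?_) ?_ (Primrec.const none)
    · exact (prim_eq hp (Primrec.list_append.comp hr hq)).comp Primrec.fst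
    · refine prim_eq ?_ ?_
      · refine Primrec.list_map (prim_strs.comp (prim_ofBits.comp Primrec.snd)) ?_
        exact Primrec.list_getElem?.comp (hT.comp (Primrec.fst.comp Primrec.fst))
          (Primrec.encode.comp Primrec.snd)
      · exact Primrec.list_map (hL.comp Primrec.fst) (Primrec.option_some.comp
          (Primrec.succ.comp (Primrec.encode.comp Primrec.snd))).to₂
    · exact (prim_Ust hk hq (prim_setCode.comp hL)).comp Primrec.fst
  have hone : ∀ (O : ℕ → ℕ) (l t t' : ℕ) (L L' : List BStr),
      (strs l).map (fun d => ((List.range t).map O)[Encodable.encode d]?) =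
          L.map (fun z => some (Encodable.encode z + 1)) →
      (strs l).map (fun d => ((List.range t').map O)[Encodable.encode d]?) =
          L'.map (fun z => some (Encodable.encode z + 1)) → L = L' := by
    intro O l t t' L L' h h'
    have key : ∀ (t : ℕ) (L : List BStr), (strs l).map (fun d => ((List.range t).map O)[Encodable.encode d]?) =
          L.map (fun z : BStr => some (Encodable.encode z + 1)) → 
          (strs l).map (fun d => some (O (Encodable.encode d))) =
          L.map (fun z : BStr => some (Encodable.encode z + 1)) := by
      intro t L h
      rw [← h]
      apply List.map_congr_left
      intro d hd
      have : ((List.range t).map O)[Encodable.encode d]? ∈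
          (strs l).map (fun d => ((List.range t).map O)[Encodable.encode d]?) :=
        List.mem_map.2 ⟨d, hd, rfl⟩
      rw [h, List.mem_map] at this
      obtain ⟨x, hx, hx'⟩ := this
      rw [← hx', ← getElem?_rangeMap hx'.symm]
    have e := (key _ _ h).symm.trans (key _ _ h')
    refine List.map_injective_iff.2 ?_ e
    intro a b hab
    simpa using hab
  have huniq : ∀ O t r q k L p y x t' r' q' k' L' p' x',
      G (((List.range t).map O, ((r, q), (k, L))), p, y) = some x →
      G (((List.range t').map O, ((r', q'), (k', L'))), p', y) = some x' → p <+: p' →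
      p = p' ∧ x = x' := by
    intro O t r q k L p y x t' r' q' k' L' p' x' h h' hp
    obtain ⟨o, h1, rfl, h3, h4⟩ := (gspec _ _ _ _ _ _ _ _).1 h
    obtain ⟨o', h1', rfl, h3', h4'⟩ := (gspec _ _ _ _ _ _ _ _).1 h'
    obtain ⟨rfl, hq⟩ := Ust_concat h1 h1' hp
    obtain rfl := Ust_uniq h1 h1'
    obtain rfl := hone _ _ _ _ _ _ h3 h3'
    obtain rfl := Ust_pf h4 h4' hq
    exact ⟨rfl, Ust_uniq h4 h4'⟩
  obtain ⟨s, hs⟩ := OM_lemma V G hG (by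
    rintro O y t ⟨⟨r, q⟩, ⟨k, L⟩⟩ p t' ⟨⟨r', q'⟩, ⟨k', L'⟩⟩ p' h h' hp
    obtain ⟨x, hx⟩ := Option.isSome_iff_exists.1 h
    obtain ⟨x', hx'⟩ := Option.isSome_iff_exists.1 h'
    exact (huniq _ _ _ _ _ _ _ _ _ _ _ _ _ _ _ _ hx hx' hp).1)
  refine ⟨s, fun f l r q x hr hx => ?_⟩
  obtain ⟨k1, hk1⟩ := mem_U_iff.1 hr
  obtain ⟨k2, hk2⟩ := mem_U_iff.1 hx
  have ht : ∀ d ∈ strs l, Encodable.encode d < ((strs l).map Encodable.encode).sum + 1 := by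
    intro d hd
    have := List.le_sum_of_mem (List.mem_map.2 ⟨d, hd, rfl⟩ : Encodable.encode d ∈ (strs l).map Encodable.encode)
    omega
  have hw : G (((List.range (((strs l).map Encodable.encode).sum + 1)).map (oracleOfFun f),
      ((r, q), (max k1 k2, (strs l).map f))), r ++ q, []) = some x := by
    refine (gspec _ _ _ _ _ _ _ _).2 ⟨code l, Ust_mono (le_max_left _ _) hk1, rfl, ?_, ?_⟩
    · have : ofBits (code l) = l := ofBits_bits l
      rw [this, List.map_map]
      apply List.map_congr_left
      intro d hd
      rw [getElem?_rangeMap_lt _ (ht d hd)]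
      simp [oracleOfFun]
    · rw [setCode_eq]; exact Ust_mono (le_max_right _ _) hk2
  refine hs _ _ _ _ ⟨_, _, hw⟩ ?_
  rintro t ⟨⟨r', q'⟩, ⟨k', L'⟩⟩ x' hx'
  exact (huniq _ _ _ _ _ _ _ _ _ _ _ _ _ _ _ _ hx' hw (List.prefix_refl _)).2

theorem KFn_spec (U : UniversalPrefixMachine) (f : BStr → BStr) (hf : Computable f) :
    ∃ p : BStr, p.length = KFn U f ∧ ∀ d : BStr, f d ∈ U.eval p d := by
  obtain ⟨s, hs⟩ := PM_lemma' U (W := Unit)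
    (fun a => cond (decide (a.2.1 = [])) (some (f a.2.2)) none) (by
      refine Computable.cond ?_ ?_ (Computable.const none)
      · exact (prim_eq (Primrec.fst.comp Primrec.snd) (Primrec.const [])).to_comp
      · exact Computable.option_some.comp (hf.comp (Computable.snd.comp Computable.snd))) (by
      intro y w p w' p' h h' hp
      have e1 : p = [] := by by_contra hh; simp [hh] at h
      have e2 : p' = [] := by by_contra hh; simp [hh] at h'
      rw [e1, e2])
  refine Nat.sInf_mem (s := {n | ∃ p : BStr, p.length = n ∧ ∀ d : BStr, f d ∈ U.eval p d})
    ⟨_, s ++ [], rfl, fun d => ?_⟩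
  refine hs _ _ _ ⟨(), by simp⟩ ?_
  intro w x' h
  simpa using h.symm

theorem part_b (U : UniversalPrefixMachine) (V : UniversalOracleMachine) : ∃ c : ℕ, ∀ x : BStr,
    ∀ f : BStr → BStr, Computable f → (∃ d : BStr, f d = x) →
      ∃ S : Finset BStr, x ∈ S ∧ S.card ≤ 2 ^ lenx f x ∧
        KcondFun V x f ≤ U.KcS x S + U.Knat (lenx f x) + c ∧
        U.Kset S ≤ KFn U f + U.Knat (lenx f x) + c := by
  obtain ⟨s1, hs1⟩ := b_machine1 U
  obtain ⟨s2, hs2⟩ := b_machine2 U V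
  refine ⟨s1.length + s2.length, fun x f hf ⟨d, hd⟩ => ?_⟩
  obtain ⟨d0, hd0, hfd0⟩ := Nat.sInf_mem (s := {m | ∃ d : BStr, d.length = m ∧ f d = x}) ⟨_, d, rfl, hd⟩
  change d0.length = lenx f x at hd0
  set l := lenx f x
  refine ⟨((strs l).map f).toFinset, ?_, ?_, ?_, ?_⟩
  · simp only [List.mem_toFinset, List.mem_map]
    exact ⟨d0, (mem_strs _ _).2 hd0, hfd0⟩
  · refine (List.toFinset_card_le _).trans ?_
    simp [strs_length]
  · obtain ⟨r, hr, hr'⟩ := Kc_spec U (code l) []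
    obtain ⟨q, hq, hq'⟩ := Kc_spec U x (code ((strs l).map f).toFinset)
    have := hs2 f l r q x hr' hq'
    have h3 : KcondFun V x f ≤ (s2 ++ (r ++ q)).length := Nat.sInf_le ⟨_, rfl, this⟩
    simp only [List.length_append] at h3
    unfold UniversalPrefixMachine.Knat UniversalPrefixMachine.K UniversalPrefixMachine.KcS
    omega
  · obtain ⟨r, hr, hr'⟩ := Kc_spec U (code l) []
    obtain ⟨q, hq, hq'⟩ := KFn_spec U f hf
    have := hs1 f l r q hr' hq'
    have h3 := Kc_le this
    simp only [List.length_append] at h3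
    unfold UniversalPrefixMachine.Knat UniversalPrefixMachine.Kset UniversalPrefixMachine.K
    omega


/-- Big-endian value. -/
def bval (w : BStr) : ℕ := w.foldl (fun n b => 2 * n + cond b 1 0) 0

theorem bval_foldl (w : BStr) : ∀ n, w.foldl (fun n b => 2 * n + cond b 1 0) n = n * 2 ^ w.length + bval w := by
  induction w with
  | nil => intro n; simp [bval]
  | cons b w ih =>
    intro n
    simp only [bval, List.foldl_cons, List.length_cons]
    rw [ih, ih (2 * 0 + _)]
    rw [pow_succ]; ring

theorem bval_append (w u : BStr) : bval (w ++ u) = bval w * 2 ^ u.length + bval u := by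
  rw [bval, List.foldl_append, bval_foldl]; rfl

theorem bval_lt (w : BStr) : bval w < 2 ^ w.length := by
  induction w using List.reverseRecOn with
  | nil => simp [bval]
  | append_singleton w b ih =>
    rw [bval_append, List.length_append, pow_add]
    have : bval [b] ≤ 1 := by cases b <;> simp [bval]
    simp only [List.length_singleton, pow_one]; omega

theorem bval_surj (n v : ℕ) (h : v < 2 ^ n) : ∃ w : BStr, w.length = n ∧ bval w = v := by
  induction n generalizing v with
  | zero => exact ⟨[], rfl, by simp at h; simp [bval, h]⟩
  | succ n ih =>
    obtain ⟨w, hw, hv⟩ := ih (v / 2) (by rw [pow_succ] at h; omega)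
    refine ⟨w ++ [decide (v % 2 = 1)], by simp [hw], ?_⟩
    rw [bval_append, hv]
    have : bval [decide (v % 2 = 1)] = v % 2 := by
      rcases Nat.mod_two_eq_zero_or_one v with h | h <;> simp [bval, h]
    rw [this]; simp; omega

theorem prim_bval : Primrec bval := by
  refine Primrec.list_foldl (f := fun w : BStr => w) (h := fun _ q => 2 * q.1 + cond q.2 1 0)
    Primrec.id (Primrec.const 0) ?_
  exact (Primrec.nat_add.comp (Primrec.nat_mul.comp (Primrec.const 2) (Primrec.fst.comp Primrec.snd))
    (Primrec.cond (Primrec.snd.comp Primrec.snd) (Primrec.const 1) (Primrec.const 0))).to₂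

theorem kraft (F : Finset BStr) (h : ∀ p ∈ F, ∀ q ∈ F, p <+: q → p = q) :
    ∑ q ∈ F, ((1 : ℝ) / 2 ^ q.length) ≤ 1 := by
  obtain ⟨n, hn⟩ : ∃ n, ∀ q ∈ F, q.length ≤ n := ⟨F.sup List.length, fun q hq => Finset.le_sup (f := List.length) hq⟩
  let E : BStr → Finset BStr := fun q => (strs (n - q.length)).toFinset.image (fun u => q ++ u)
  have hE : ∀ q, (E q).card = 2 ^ (n - q.length) := by
    intro q
    rw [Finset.card_image_of_injective _ (List.append_right_injective q),
      List.toFinset_card_of_nodup (strs_nodup _), strs_length]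
  have hd : (F : Set BStr).PairwiseDisjoint E := by
    intro p hp q hq hpq
    rw [Function.onFun, Finset.disjoint_left]
    intro z hz hz'
    simp only [E, Finset.mem_image, List.mem_toFinset] at hz hz'
    obtain ⟨u, _, rfl⟩ := hz
    obtain ⟨u', _, hu'⟩ := hz'
    rcases List.prefix_or_prefix_of_prefix (List.prefix_append p u) (hu' ▸ List.prefix_append q u') with h1 | h1
    · exact hpq (h _ hp _ hq h1)
    · exact hpq (h _ hq _ hp h1).symm
  have hsub : F.biUnion E ⊆ (strs n).toFinset := by
    intro z hz
    simp only [Finset.mem_biUnion, E, Finset.mem_image, List.mem_toFinset, mem_strs] at hz ⊢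
    obtain ⟨q, hq, u, hu, rfl⟩ := hz
    have := hn q hq
    simp [hu]; omega
  have hc := Finset.card_le_card hsub
  rw [Finset.card_biUnion (fun p hp q hq hpq => hd hp hq hpq), List.toFinset_card_of_nodup (strs_nodup _), strs_length] at hc
  have hc' : (∑ q ∈ F, (2 : ℝ) ^ (n - q.length)) ≤ 2 ^ n := by
    have : ((∑ q ∈ F, (E q).card : ℕ) : ℝ) ≤ ((2 ^ n : ℕ) : ℝ) := by exact_mod_cast hc
    simpa [hE] using this
  have : ∀ q ∈ F, (1 : ℝ) / 2 ^ q.length = 2 ^ (n - q.length) / 2 ^ n := by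
    intro q hq
    have := hn q hq
    rw [div_eq_div_iff (by positivity) (by positivity), one_mul, ← pow_add]
    congr 1; omega
  rw [Finset.sum_congr rfl this, ← Finset.sum_div, div_le_one (by positivity)]
  exact hc'

section KC
variable (U : UniversalPrefixMachine) (sim : BStr → ℕ → BStr → BStr → Bool)

/-- Enumeration of halting programs. -/
noncomputable def evU (y : BStr) (t : ℕ) : Option (BStr × BStr) :=
  (Encodable.decode (α := BStr × ℕ) t).bind fun w =>
    cond (decide (Encodable.encode w = t) && (decide (w.2 = 0) || !(Ust U (w.2 - 1) w.1 y).isSome))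
      ((Ust U w.2 w.1 y).map fun o => (w.1, o)) none

def simP (y : BStr) (qo r : BStr × BStr) : Bool :=
  decide (r.1.length = qo.1.length) && sim y qo.1.length qo.2 r.2

noncomputable def trig (s : ℕ) (y : BStr) (pool : List (BStr × BStr)) (qo : BStr × BStr) : Bool :=
  decide (4 ^ s ≤ ((qo :: pool).filter (simP sim y qo)).length)

noncomputable def knextS (s : ℕ) (y : BStr) (st : List (BStr × BStr) × ℕ × ℕ) (qo : BStr × BStr) :
    List (BStr × BStr) × ℕ × ℕ :=
  cond (trig sim s y st.1 qo)
    ((qo :: st.1).filter (fun r => !(simP sim y qo r)),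
      st.2.1 * 2 ^ (qo.1.length - 2 * s) + 2 ^ st.2.2, st.2.2 + (qo.1.length - 2 * s))
    (qo :: st.1, st.2)

noncomputable def knext (s : ℕ) (y : BStr) (st : List (BStr × BStr) × ℕ × ℕ) (t : ℕ) :
    List (BStr × BStr) × ℕ × ℕ :=
  ((evU U y t).map (knextS sim s y st)).getD st

noncomputable def kst (s : ℕ) (y : BStr) (t : ℕ) : List (BStr × BStr) × ℕ × ℕ :=
  Nat.rec ([], 0, 0) (fun t st => knext U sim s y st t) t

noncomputable def kreq (s : ℕ) (y : BStr) (t : ℕ) : Option (BStr × BStr) :=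
  (evU U y t).bind fun qo => cond (trig sim s y (kst U sim s y t).1 qo) (some qo) none

variable {sim}
variable {α : Type} [Primcodable α]

theorem prim_evU : Primrec₂ (evU U) := by
  refine Primrec.option_bind (Primrec.decode.comp Primrec.snd) ?_
  have h1 : Primrec (fun q : (BStr × ℕ) × (BStr × ℕ) => q.2.1) := Primrec.fst.comp Primrec.snd
  have h2 : Primrec (fun q : (BStr × ℕ) × (BStr × ℕ) => q.2.2) := Primrec.snd.comp Primrec.snd
  have hy : Primrec (fun q : (BStr × ℕ) × (BStr × ℕ) => q.1.1) := Primrec.fst.comp Primrec.fst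
  have ht : Primrec (fun q : (BStr × ℕ) × (BStr × ℕ) => q.1.2) := Primrec.snd.comp Primrec.fst
  refine Primrec.cond (Primrec.and.comp (prim_eq (Primrec.encode.comp Primrec.snd) ht)
    (Primrec.or.comp (prim_eq h2 (Primrec.const 0)) (Primrec.not.comp (Primrec.option_isSome.comp
      (prim_Ust (Primrec.pred.comp h2) h1 hy))))) ?_ (Primrec.const none)
  refine Primrec.option_map (prim_Ust h2 h1 hy) ?_
  exact (Primrec.pair (h1.comp Primrec.fst) Primrec.snd).to₂

theorem prim_simP (hsim : Primrec fun q : (BStr × ℕ) × BStr × BStr => sim q.1.1 q.1.2 q.2.1 q.2.2)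
    {f : α → BStr} {g h : α → BStr × BStr} (hf : Primrec f) (hg : Primrec g) (hh : Primrec h) :
    Primrec fun a => simP sim (f a) (g a) (h a) := by
  have hl : Primrec fun a => (g a).1.length := Primrec.list_length.comp (Primrec.fst.comp hg)
  refine Primrec.and.comp (prim_eq (Primrec.list_length.comp (Primrec.fst.comp hh)) hl) ?_
  exact hsim.comp (Primrec.pair (Primrec.pair hf hl) (Primrec.pair (Primrec.snd.comp hg) (Primrec.snd.comp hh)))

theorem prim_trig (hsim : Primrec fun q : (BStr × ℕ) × BStr × BStr => sim q.1.1 q.1.2 q.2.1 q.2.2)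
    {s : α → ℕ} {y : α → BStr} {pool : α → List (BStr × BStr)} {qo : α → BStr × BStr}
    (hs : Primrec s) (hy : Primrec y) (hp : Primrec pool) (hq : Primrec qo) :
    Primrec fun a => trig sim (s a) (y a) (pool a) (qo a) := by
  refine prim_le (prim_pow.comp (Primrec.const 4) hs) (Primrec.list_length.comp ?_)
  refine prim_filter (Primrec.list_cons.comp hq hp) ?_
  exact prim_simP hsim (hy.comp Primrec.fst) (hq.comp Primrec.fst) Primrec.snd

theorem prim_knextS (hsim : Primrec fun q : (BStr × ℕ) × BStr × BStr => sim q.1.1 q.1.2 q.2.1 q.2.2)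
    {s : α → ℕ} {y : α → BStr} {st : α → List (BStr × BStr) × ℕ × ℕ} {qo : α → BStr × BStr}
    (hs : Primrec s) (hy : Primrec y) (hp : Primrec st) (hq : Primrec qo) :
    Primrec fun a => knextS sim (s a) (y a) (st a) (qo a) := by
  have hpool : Primrec fun a => (st a).1 := Primrec.fst.comp hp
  have hnum : Primrec fun a => (st a).2.1 := Primrec.fst.comp (Primrec.snd.comp hp)
  have he : Primrec fun a => (st a).2.2 := Primrec.snd.comp (Primrec.snd.comp hp)
  have hl : Primrec fun a => (qo a).1.length - 2 * s a :=
    Primrec.nat_sub.comp (Primrec.list_length.comp (Primrec.fst.comp hq))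
      (Primrec.nat_mul.comp (Primrec.const 2) hs)
  refine Primrec.cond (prim_trig hsim hs hy hpool hq) (Primrec.pair ?_ (Primrec.pair ?_ ?_))
    (Primrec.pair (Primrec.list_cons.comp hq hpool) (Primrec.snd.comp hp))
  · refine prim_filter (Primrec.list_cons.comp hq hpool) ?_
    exact Primrec.not.comp (prim_simP hsim (hy.comp Primrec.fst) (hq.comp Primrec.fst) Primrec.snd)
  · exact Primrec.nat_add.comp (Primrec.nat_mul.comp hnum (prim_pow.comp (Primrec.const 2) hl))
      (prim_pow.comp (Primrec.const 2) he)
  · exact Primrec.nat_add.comp he hl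

theorem prim_kst (hsim : Primrec fun q : (BStr × ℕ) × BStr × BStr => sim q.1.1 q.1.2 q.2.1 q.2.2)
    {s : α → ℕ} {y : α → BStr} {t : α → ℕ} (hs : Primrec s) (hy : Primrec y) (ht : Primrec t) :
    Primrec fun a => kst U sim (s a) (y a) (t a) := by
  refine Primrec.nat_rec' (f := t) (g := fun _ => ([], 0, 0))
    (h := fun a q => knext U sim (s a) (y a) q.2 q.1) ht (Primrec.const _) ?_
  unfold knext
  refine Primrec.option_getD.comp (Primrec.option_map ?_ ?_) (Primrec.snd.comp Primrec.snd)
  · exact (prim_evU U).comp (hy.comp Primrec.fst) (Primrec.fst.comp Primrec.snd)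
  · exact prim_knextS hsim (hs.comp (Primrec.fst.comp Primrec.fst)) (hy.comp (Primrec.fst.comp Primrec.fst))
      (Primrec.snd.comp (Primrec.snd.comp Primrec.fst)) Primrec.snd

theorem prim_kreq (hsim : Primrec fun q : (BStr × ℕ) × BStr × BStr => sim q.1.1 q.1.2 q.2.1 q.2.2)
    {s : α → ℕ} {y : α → BStr} {t : α → ℕ} (hs : Primrec s) (hy : Primrec y) (ht : Primrec t) :
    Primrec fun a => kreq U sim (s a) (y a) (t a) := by
  refine Primrec.option_bind ((prim_evU U).comp hy ht) ?_
  refine Primrec.cond ?_ (Primrec.option_some.comp Primrec.snd) (Primrec.const none)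
  exact prim_trig hsim (hs.comp Primrec.fst) (hy.comp Primrec.fst)
    (Primrec.fst.comp ((prim_kst U hsim hs hy ht).comp Primrec.fst)) Primrec.snd

variable {U}
theorem evU_spec {y : BStr} {t : ℕ} {q o : BStr} (h : evU U y t = some (q, o)) :
    o ∈ U.eval q y ∧ ∀ t' o', evU U y t' = some (q, o') → t' = t := by
  have key : ∀ {t q o}, evU U y t = some (q, o) → ∃ k, Encodable.encode (q, k) = t ∧
      Ust U k q y = some o ∧ ∀ k' < k, Ust U k' q y = none := by
    intro t q o h
    simp only [evU, Option.bind_eq_some_iff] at h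
    obtain ⟨⟨q', k⟩, _, h⟩ := h
    cases hc : (decide (Encodable.encode (q', k) = t) && (decide (k = 0) || !(Ust U (k - 1) q' y).isSome)) with
    | false => simp only at h; rw [hc] at h; simp at h
    | true =>
      simp only at h
      rw [hc] at h
      simp at h
      obtain ⟨h1, rfl⟩ := h
      simp only [Bool.and_eq_true, decide_eq_true_eq, Bool.or_eq_true] at hc
      refine ⟨k, hc.1, h1, fun k' hk' => ?_⟩
      rcases hc.2 with h0 | h0
      · omega
      · cases hu : Ust U k' q' y with
        | none => rfl
        | some x => rw [Ust_mono (by omega : k' ≤ k - 1) hu] at h0; simp at h0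
  obtain ⟨k, h1, h2, h3⟩ := key h
  refine ⟨Ust_mem h2, fun t' o' h' => ?_⟩
  obtain ⟨k', h1', h2', h3'⟩ := key h'
  have : k = k' := by
    rcases lt_trichotomy k k' with hh | hh | hh
    · rw [h3' _ hh] at h2; simp at h2
    · exact hh
    · rw [h3 _ hh] at h2'; simp at h2'
  subst this
  rw [← h1, ← h1']

theorem evU_complete {y q o : BStr} (h : o ∈ U.eval q y) : ∃ t, evU U y t = some (q, o) := by
  have hex := mem_U_iff.1 h
  have hk := Nat.find_spec hex
  refine ⟨Encodable.encode (q, Nat.find hex), ?_⟩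
  have hcond : Nat.find hex = 0 ∨ Ust U (Nat.find hex - 1) q y = none := by
    rcases Nat.eq_zero_or_pos (Nat.find hex) with h0 | h0
    · exact Or.inl h0
    · right
      cases hu : Ust U (Nat.find hex - 1) q y with
      | none => rfl
      | some x =>
        have := Ust_uniq hu hk
        subst this
        exact absurd hu (Nat.find_min hex (by omega))
  have hb : (decide (Nat.find hex = 0) || !(Ust U (Nat.find hex - 1) q y).isSome) = true := by
    rcases hcond with h0 | h0
    · simp [h0]
    · simp [h0]
  simp only [evU, Encodable.encodek, Option.bind_some]
  rw [hb, hk]; simp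
end KC


/-- Unary header `1^s 0 w`. -/
def unh (s : ℕ) (w : BStr) : BStr := (List.range s).map (fun _ => true) ++ false :: w

theorem unh_length (s : ℕ) (w : BStr) : (unh s w).length = s + 1 + w.length := by
  simp [unh]; omega

theorem unh_pfx {s s' : ℕ} {w w' : BStr} (h : unh s w <+: unh s' w') : s = s' ∧ w <+: w' := by
  have e : ∀ s w, unh s w = List.replicate s true ++ false :: w := by
    intro s w; simp [unh]
  rw [e, e] at h
  induction s generalizing s' with
  | zero =>
    cases s' with
    | zero => simpa using h
    | succ n => simp [List.replicate_succ] at h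
  | succ m ih =>
    cases s' with
    | zero => simp [List.replicate_succ] at h
    | succ n =>
      simp only [List.replicate_succ, List.cons_append, List.cons_prefix_cons, true_and] at h
      have := ih h
      exact ⟨by omega, this.2⟩

theorem prim_unh {α : Type} [Primcodable α] {f : α → ℕ} {g : α → BStr} (hf : Primrec f) (hg : Primrec g) :
    Primrec fun a => unh (f a) (g a) := by
  refine Primrec.list_append.comp (Primrec.list_map (Primrec.list_range.comp hf) (Primrec.const true).to₂) ?_
  exact Primrec.list_cons.comp (Primrec.const false) hg

noncomputable def lft (w : BStr) : ℝ := (bval w : ℝ) / 2 ^ w.length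

theorem lft_pfx {w w' : BStr} (h : w <+: w') : lft w ≤ lft w' ∧ lft w' < lft w + 1 / 2 ^ w.length := by
  obtain ⟨u, rfl⟩ := h
  have hu : (bval u : ℝ) < 2 ^ u.length := by exact_mod_cast bval_lt u
  have e : lft (w ++ u) = lft w + (bval u / 2 ^ u.length) * (1 / 2 ^ w.length) := by
    simp only [lft, bval_append, List.length_append, pow_add]
    push_cast
    field_simp
  rw [e]
  have h0 : (0 : ℝ) < 1 / 2 ^ w.length := by positivity
  have h1 : (bval u : ℝ) / 2 ^ u.length < 1 := by rw [div_lt_one (by positivity)]; exact hu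
  have h2 : 0 ≤ (bval u : ℝ) / 2 ^ u.length := by positivity
  constructor
  · nlinarith
  · nlinarith

section KC
variable {U : UniversalPrefixMachine} {sim : BStr → ℕ → BStr → BStr → Bool}

noncomputable def ct (U : UniversalPrefixMachine) (sim : BStr → ℕ → BStr → BStr → Bool) (s : ℕ) (y : BStr) (t : ℕ) : ℝ :=
  ((kst U sim s y t).2.1 : ℝ) / 2 ^ (kst U sim s y t).2.2

theorem kst_succ (s y t) : kst U sim s y (t+1) = knext U sim s y (kst U sim s y t) t := rfl

theorem kst_succ_none {s y t} (h : evU U y t = none) : kst U sim s y (t+1) = kst U sim s y t := by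
  rw [kst_succ, knext, h]; rfl

theorem kst_succ_some {s y t qo} (h : evU U y t = some qo) :
    kst U sim s y (t+1) = knextS sim s y (kst U sim s y t) qo := by
  rw [kst_succ, knext, h]; rfl

theorem kreq_iff {s y t qo} : kreq U sim s y t = some qo ↔
    evU U y t = some qo ∧ trig sim s y (kst U sim s y t).1 qo = true := by
  simp only [kreq, Option.bind_eq_some_iff]
  constructor
  · rintro ⟨r, h1, h2⟩
    cases hc : trig sim s y (kst U sim s y t).1 r with
    | false => rw [hc] at h2; simp at h2
    | true => rw [hc] at h2; simp at h2; subst h2; exact ⟨h1, hc⟩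
  · rintro ⟨h1, h2⟩
    exact ⟨qo, h1, by rw [h2]; rfl⟩

theorem ct_req {s y t qo} (h : kreq U sim s y t = some qo) :
    ct U sim s y (t+1) = ct U sim s y t + 1 / 2 ^ (qo.1.length - 2 * s) := by
  obtain ⟨h1, h2⟩ := kreq_iff.1 h
  rw [ct, kst_succ_some h1, knextS, h2, ct]
  simp only [cond_true]
  push_cast
  rw [pow_add]
  field_simp

theorem ct_mono_succ (s y t) : ct U sim s y t ≤ ct U sim s y (t+1) := by
  cases h : kreq U sim s y t with
  | some qo => rw [ct_req h]; have : (0:ℝ) < 1 / 2 ^ (qo.1.length - 2 * s) := by positivity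
               linarith
  | none =>
    cases he : evU U y t with
    | none => rw [ct, ct, kst_succ_none he]
    | some qo =>
      have : trig sim s y (kst U sim s y t).1 qo = false := by
        by_contra hc
        have := kreq_iff.2 ⟨he, by simpa using hc⟩
        rw [h] at this; simp at this
      rw [ct, ct, kst_succ_some he, knextS, this]; simp

theorem ct_mono (s y) : Monotone (ct U sim s y) := monotone_nat_of_le_succ (ct_mono_succ s y)

noncomputable def evm (U : UniversalPrefixMachine) (y : BStr) (t : ℕ) : ℝ :=
  ((evU U y t).map fun qo => (1 : ℝ) / 2 ^ qo.1.length).getD 0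

theorem evm_sum_le (y : BStr) (t : ℕ) : ∑ i ∈ Finset.range t, evm U y i ≤ 1 := by
  let I := (Finset.range t).filter fun i => (evU U y i).isSome
  let Q : ℕ → BStr := fun i => ((evU U y i).map Prod.fst).getD []
  have hQ : ∀ i ∈ I, ∃ o, evU U y i = some (Q i, o) := by
    intro i hi
    obtain ⟨⟨q, o⟩, h⟩ := Option.isSome_iff_exists.1 (Finset.mem_filter.1 hi).2
    exact ⟨o, by simp [Q, h]⟩
  have h1 : ∑ i ∈ Finset.range t, evm U y i = ∑ i ∈ I, evm U y i := by
    symm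
    apply Finset.sum_subset (Finset.filter_subset _ _)
    intro i hi hn
    have : evU U y i = none := by
      by_contra hc
      exact hn (Finset.mem_filter.2 ⟨hi, by simpa [Option.isSome_iff_ne_none] using hc⟩)
    simp [evm, this]
  have hinj : Set.InjOn Q I := by
    intro i hi j hj hij
    obtain ⟨o, ho⟩ := hQ i hi
    obtain ⟨o', ho'⟩ := hQ j hj
    rw [← hij] at ho'
    exact ((evU_spec ho).2 j o' ho').symm
  have h2 : ∑ i ∈ I, evm U y i = ∑ q ∈ I.image Q, (1 : ℝ) / 2 ^ q.length := by
    rw [Finset.sum_image hinj]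
    refine Finset.sum_congr rfl fun i hi => ?_
    obtain ⟨o, ho⟩ := hQ i hi
    simp [evm, ho]
  rw [h1, h2]
  apply kraft
  intro p hp q hq hpq
  obtain ⟨i, hi, rfl⟩ := Finset.mem_image.1 hp
  obtain ⟨j, hj, rfl⟩ := Finset.mem_image.1 hq
  obtain ⟨o, ho⟩ := hQ i hi
  obtain ⟨o', ho'⟩ := hQ j hj
  exact U.prefixFree y _ _ (Part.dom_iff_mem.2 ⟨_, (evU_spec ho).1⟩) (Part.dom_iff_mem.2 ⟨_, (evU_spec ho').1⟩) hpq

noncomputable def pmass (l : List (BStr × BStr)) : ℝ := (l.map fun r => (1 : ℝ) / 2 ^ r.1.length).sum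

theorem pmass_cons (r) (l : List (BStr × BStr)) : pmass (r :: l) = 1 / 2 ^ r.1.length + pmass l := by
  simp [pmass]

theorem pmass_filter (l : List (BStr × BStr)) (f : BStr × BStr → Bool) :
    pmass l = pmass (l.filter f) + pmass (l.filter fun r => !(f r)) := by
  induction l with
  | nil => simp [pmass]
  | cons r l ih =>
    rw [pmass_cons, ih]
    cases h : f r <;> simp [h, pmass_cons] <;> ring

theorem pmass_nonneg (l) : 0 ≤ pmass l := by
  apply List.sum_nonneg
  intro x hx
  obtain ⟨r, _, rfl⟩ := List.mem_map.1 hx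
  positivity

theorem pmass_const (l : List (BStr × BStr)) (n : ℕ) (h : ∀ r ∈ l, r.1.length = n) :
    pmass l = l.length / 2 ^ n := by
  induction l with
  | nil => simp [pmass]
  | cons r l ih =>
    have := ih (fun r hr => h r (by simp [hr]))
    rw [pmass_cons, this, h r (by simp), List.length_cons]
    push_cast; ring

theorem trig_mass {s y pool} {qo : BStr × BStr} (h : trig sim s y pool qo = true) :
    (4 : ℝ) ^ s / 2 ^ qo.1.length ≤ pmass ((qo :: pool).filter (simP sim y qo)) := by
  rw [pmass_const _ qo.1.length]
  · have : 4 ^ s ≤ ((qo :: pool).filter (simP sim y qo)).length := by simpa [trig] using h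
    have : (4 : ℝ) ^ s ≤ (((qo :: pool).filter (simP sim y qo)).length : ℝ) := by exact_mod_cast this
    gcongr
  · intro r hr
    have := (List.mem_filter.1 hr).2
    simp [simP] at this
    exact this.1

theorem sub_bound (s n : ℕ) : (1 : ℝ) / 2 ^ (n - 2 * s) ≤ 4 ^ s / 2 ^ n := by
  have e : (4 : ℝ) ^ s = 2 ^ (2 * s) := by rw [pow_mul]; norm_num
  rw [e, div_le_div_iff₀ (by positivity) (by positivity), one_mul, ← pow_add]
  exact pow_le_pow_right₀ (by norm_num) (by omega)

theorem kinv (s y t) : ct U sim s y t + pmass (kst U sim s y t).1 ≤ ∑ i ∈ Finset.range t, evm U y i := by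
  induction t with
  | zero => simp [ct, kst, pmass]
  | succ t ih =>
    rw [Finset.sum_range_succ]
    cases he : evU U y t with
    | none => simp only [ct, kst_succ_none he, evm, he] at ih ⊢; simpa using ih
    | some qo =>
      have hm : evm U y t = 1 / 2 ^ qo.1.length := by simp [evm, he]
      have hcons : pmass (qo :: (kst U sim s y t).1) = 1 / 2 ^ qo.1.length + pmass (kst U sim s y t).1 := by
        simp [pmass]
      cases ht : trig sim s y (kst U sim s y t).1 qo with
      | false =>
        have e1 : kst U sim s y (t+1) = (qo :: (kst U sim s y t).1, (kst U sim s y t).2) := by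
          rw [kst_succ_some he, knextS, ht]; rfl
        have e2 : ct U sim s y (t+1) = ct U sim s y t := by simp only [ct, e1]
        rw [e2, e1, hm]
        simp only [hcons]; linarith
      | true =>
        rw [ct_req (kreq_iff.2 ⟨he, ht⟩), kst_succ_some he, knextS, ht, hm]
        simp only [cond_true]
        have h1 := trig_mass ht
        have h2 := sub_bound s qo.1.length
        have h3 := pmass_filter (qo :: (kst U sim s y t).1) (simP sim y qo)
        linarith

theorem ct_nonneg (s y t) : 0 ≤ ct U sim s y t := by unfold ct; positivity

theorem req_len {s y t qo} (h : kreq U sim s y t = some qo) : 2 * s ≤ qo.1.length := by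
  obtain ⟨he, ht⟩ := kreq_iff.1 h
  have h1 := trig_mass ht
  have h3 := pmass_filter (qo :: (kst U sim s y t).1) (simP sim y qo)
  have h4 := pmass_nonneg ((qo :: (kst U sim s y t).1).filter fun r => !(simP sim y qo r))
  have h5 := kinv (U := U) (sim := sim) s y t
  have h6 := evm_sum_le (U := U) y (t+1)
  have hm : evm U y t = 1 / 2 ^ qo.1.length := by simp [evm, he]
  rw [Finset.sum_range_succ, hm] at h6
  have hcons : pmass (qo :: (kst U sim s y t).1) = 1 / 2 ^ qo.1.length + pmass (kst U sim s y t).1 := by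
    simp [pmass]
  have h7 := ct_nonneg (U := U) (sim := sim) s y t
  have h8 : (4 : ℝ) ^ s / 2 ^ qo.1.length ≤ 1 := by linarith
  rw [div_le_one (by positivity)] at h8
  have e : (4 : ℝ) ^ s = 2 ^ (2 * s) := by rw [pow_mul]; norm_num
  rw [e] at h8
  exact (pow_le_pow_iff_right₀ (by norm_num)).1 h8

theorem req_ct_le {s y t qo} (h : kreq U sim s y t = some qo) :
    ct U sim s y t + 1 / 2 ^ (qo.1.length - 2 * s) ≤ 1 := by
  rw [← ct_req h]
  have h5 := kinv (U := U) (sim := sim) s y (t+1)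
  have h6 := evm_sum_le (U := U) y (t+1)
  have := pmass_nonneg (kst U sim s y (t+1)).1
  linarith

/-- `w` is the codeword for the request at time `t`. -/
def cwOK (l : ℕ) (st : ℕ × ℕ) (w : BStr) : Prop :=
  w.length = l + 1 ∧ st.1 * 2 ^ (l+1) ≤ bval w * 2 ^ st.2 ∧ bval w * 2 ^ st.2 < st.1 * 2 ^ (l+1) + 2 ^ st.2

theorem cw_lft {s y t l w} (h : cwOK l (kst U sim s y t).2 w) :
    ct U sim s y t ≤ lft w ∧ lft w < ct U sim s y t + 1 / 2 ^ (l+1) := by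
  obtain ⟨h1, h2, h3⟩ := h
  have h2' : ((kst U sim s y t).2.1 : ℝ) * 2 ^ (l+1) ≤ bval w * 2 ^ (kst U sim s y t).2.2 := by exact_mod_cast h2
  have h3' : (bval w : ℝ) * 2 ^ (kst U sim s y t).2.2 < (kst U sim s y t).2.1 * 2 ^ (l+1) + 2 ^ (kst U sim s y t).2.2 := by exact_mod_cast h3
  rw [lft, h1, ct]
  constructor
  · rw [div_le_div_iff₀ (by positivity) (by positivity)]; exact h2'
  · rw [div_add_div _ _ (by positivity) (by positivity), div_lt_div_iff₀ (by positivity) (by positivity)]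
    have : (0:ℝ) < 2 ^ (l+1) := by positivity
    nlinarith

theorem cw_uniq {s y t t' w w' qo qo'} (h : kreq U sim s y t = some qo) (h' : kreq U sim s y t' = some qo')
    (hw : cwOK (qo.1.length - 2 * s) (kst U sim s y t).2 w)
    (hw' : cwOK (qo'.1.length - 2 * s) (kst U sim s y t').2 w') (hp : w <+: w') : t = t' := by
  have a1 := cw_lft hw
  have a2 := cw_lft hw'
  have a3 := lft_pfx hp
  rw [hw.1] at a3
  have b1 := ct_req h
  have b2 := ct_req h'
  have e : ∀ l : ℕ, (1:ℝ) / 2 ^ l = 1 / 2 ^ (l+1) + 1 / 2 ^ (l+1) := by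
    intro l; rw [pow_succ]; field_simp; norm_num
  rw [e] at b1 b2
  have p1 : (0:ℝ) < 1 / 2 ^ (qo'.1.length - 2 * s + 1) := by positivity
  rcases lt_trichotomy t t' with hh | hh | hh
  · have := ct_mono (U := U) (sim := sim) s y (show t + 1 ≤ t' from hh)
    linarith
  · exact hh
  · have := ct_mono (U := U) (sim := sim) s y (show t' + 1 ≤ t from hh)
    linarith

theorem cw_exists {s y t qo} (h : kreq U sim s y t = some qo) :
    ∃ w, cwOK (qo.1.length - 2 * s) (kst U sim s y t).2 w := by
  have h1 := req_ct_le h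
  set l := qo.1.length - 2 * s
  rw [ct] at h1
  set num := (kst U sim s y t).2.1
  set e := (kst U sim s y t).2.2
  have hE : 0 < 2 ^ e := by positivity
  let v := (num * 2 ^ (l+1) + 2 ^ e - 1) / 2 ^ e
  have hv1 : v * 2 ^ e ≤ num * 2 ^ (l+1) + 2 ^ e - 1 := Nat.div_mul_le_self _ _
  have hv2 : num * 2 ^ (l+1) + 2 ^ e - 1 < v * 2 ^ e + 2 ^ e := by
    have := Nat.lt_div_mul_add (a := num * 2 ^ (l+1) + 2 ^ e - 1) hE
    exact this
  have hnum : num * 2 ^ l + 2 ^ e ≤ 2 ^ e * 2 ^ l := by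
    rw [div_add_div _ _ (by positivity) (by positivity), div_le_one (by positivity)] at h1
    have : (num : ℝ) * 2 ^ l + 2 ^ e ≤ 2 ^ e * 2 ^ l := by linarith
    exact_mod_cast this
  have hv : v < 2 ^ (l+1) := by
    have : v * 2 ^ e < 2 ^ (l+1) * 2 ^ e := by
      rw [pow_succ] at hv1 ⊢
      have e3 : 2 ^ l * 2 * 2 ^ e = 2 * (2 ^ e * 2 ^ l) := by ring
      have e4 : num * (2 ^ l * 2) = 2 * (num * 2 ^ l) := by ring
      rw [e3]; rw [e4] at hv1
      omega
    exact lt_of_mul_lt_mul_right this (Nat.zero_le _)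
  obtain ⟨w, hw, hwv⟩ := bval_surj (l+1) v hv
  refine ⟨w, hw, ?_, ?_⟩
  · rw [hwv]; show num * 2 ^ (l+1) ≤ v * 2 ^ e; omega
  · rw [hwv]; show v * 2 ^ e < num * 2 ^ (l+1) + 2 ^ e; omega
end KC


section KC
variable {U : UniversalPrefixMachine} {sim : BStr → ℕ → BStr → BStr → Bool}

theorem kc_machine (hsim : Primrec fun q : (BStr × ℕ) × BStr × BStr => sim q.1.1 q.1.2 q.2.1 q.2.2) :
    ∃ σ : BStr, ∀ s y t q o, kreq U sim s y t = some (q, o) →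
      ∃ p, p.length + 2 * s = σ.length + s + q.length + 2 ∧ o ∈ U.eval p y := by
  let g : (ℕ × BStr × ℕ) × BStr × BStr → Option BStr := fun a =>
    (kreq U sim a.1.1 a.2.2 a.1.2.2).bind fun qo =>
      cond (decide (a.2.1 = unh a.1.1 a.1.2.1) &&
        (decide (a.1.2.1.length = qo.1.length - 2 * a.1.1 + 1) &&
        (decide ((kst U sim a.1.1 a.2.2 a.1.2.2).2.1 * 2 ^ (qo.1.length - 2 * a.1.1 + 1) ≤ bval a.1.2.1 * 2 ^ (kst U sim a.1.1 a.2.2 a.1.2.2).2.2) &&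
        decide (bval a.1.2.1 * 2 ^ (kst U sim a.1.1 a.2.2 a.1.2.2).2.2 <
          (kst U sim a.1.1 a.2.2 a.1.2.2).2.1 * 2 ^ (qo.1.length - 2 * a.1.1 + 1) + 2 ^ (kst U sim a.1.1 a.2.2 a.1.2.2).2.2))))
        (some qo.2) none
  have gspec : ∀ s w t p y x, g ((s, w, t), p, y) = some x ↔
      ∃ qo, kreq U sim s y t = some qo ∧ p = unh s w ∧ cwOK (qo.1.length - 2 * s) (kst U sim s y t).2 w ∧ x = qo.2 := by
    intro s w t p y x
    simp only [g, Option.bind_eq_some_iff]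
    refine exists_congr fun qo => and_congr_right fun _ => ?_
    simp only [cwOK]
    simp only [cond_eq_ite, Bool.and_eq_true, decide_eq_true_eq]
    split_ifs with h
    · simp only [Option.some.injEq]; exact ⟨fun e => ⟨h.1, h.2, e.symm⟩, fun e => e.2.2.symm⟩
    · simp only [reduceCtorEq, false_iff]; exact fun e => h ⟨e.1, e.2.1⟩
  have hg : Computable g := by
    apply Primrec.to_comp
    have hs : Primrec (fun a : (ℕ × BStr × ℕ) × BStr × BStr => a.1.1) := Primrec.fst.comp Primrec.fst
    have hw : Primrec (fun a : (ℕ × BStr × ℕ) × BStr × BStr => a.1.2.1) :=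
      Primrec.fst.comp (Primrec.snd.comp Primrec.fst)
    have ht : Primrec (fun a : (ℕ × BStr × ℕ) × BStr × BStr => a.1.2.2) :=
      Primrec.snd.comp (Primrec.snd.comp Primrec.fst)
    have hp : Primrec (fun a : (ℕ × BStr × ℕ) × BStr × BStr => a.2.1) := Primrec.fst.comp Primrec.snd
    have hy : Primrec (fun a : (ℕ × BStr × ℕ) × BStr × BStr => a.2.2) := Primrec.snd.comp Primrec.snd
    have hst := prim_kst U hsim hs hy ht
    refine Primrec.option_bind (prim_kreq U hsim hs hy ht) ?_
    have hl : Primrec (fun b : ((ℕ × BStr × ℕ) × BStr × BStr) × (BStr × BStr) => b.2.1.length - 2 * b.1.1.1 + 1) :=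
      Primrec.succ.comp (Primrec.nat_sub.comp (Primrec.list_length.comp (Primrec.fst.comp Primrec.snd))
        (Primrec.nat_mul.comp (Primrec.const 2) (hs.comp Primrec.fst)))
    have hnum : Primrec (fun b : ((ℕ × BStr × ℕ) × BStr × BStr) × (BStr × BStr) => (kst U sim b.1.1.1 b.1.2.2 b.1.1.2.2).2.1) :=
      (Primrec.fst.comp (Primrec.snd.comp hst)).comp Primrec.fst
    have he : Primrec (fun b : ((ℕ × BStr × ℕ) × BStr × BStr) × (BStr × BStr) => 2 ^ (kst U sim b.1.1.1 b.1.2.2 b.1.1.2.2).2.2) :=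
      prim_pow.comp (Primrec.const 2) ((Primrec.snd.comp (Primrec.snd.comp hst)).comp Primrec.fst)
    have hL := Primrec.nat_mul.comp hnum (prim_pow.comp (Primrec.const 2) hl)
    have hR := Primrec.nat_mul.comp (prim_bval.comp (hw.comp (Primrec.fst (β := BStr × BStr)))) he
    refine Primrec.cond (Primrec.and.comp ?_ (Primrec.and.comp ?_ (Primrec.and.comp ?_ ?_))) ?_ (Primrec.const none)
    · exact (prim_eq hp (prim_unh hs hw)).comp Primrec.fst
    · exact prim_eq (Primrec.list_length.comp (hw.comp Primrec.fst)) hl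
    · exact prim_le hL hR
    · exact prim_lt hR (Primrec.nat_add.comp hL he)
    · exact Primrec.option_some.comp (Primrec.snd.comp Primrec.snd)
  have huniq : ∀ s w t p y x s' w' t' p' x', g ((s, w, t), p, y) = some x →
      g ((s', w', t'), p', y) = some x' → p <+: p' → p = p' ∧ x = x' := by
    intro s w t p y x s' w' t' p' x' h h' hp
    obtain ⟨qo, h1, rfl, h3, rfl⟩ := (gspec _ _ _ _ _ _).1 h
    obtain ⟨qo', h1', rfl, h3', rfl⟩ := (gspec _ _ _ _ _ _).1 h'
    obtain ⟨rfl, hw⟩ := unh_pfx hp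
    obtain rfl := cw_uniq h1 h1' h3 h3' hw
    rw [h1] at h1'
    obtain rfl := Option.some.inj h1'
    have : w = w' := hw.eq_of_length (by rw [h3.1, h3'.1])
    exact ⟨by rw [this], rfl⟩
  obtain ⟨σ, hσ⟩ := PM_lemma' U g hg (by
    rintro y ⟨s, w, t⟩ p ⟨s', w', t'⟩ p' h h' hp
    obtain ⟨x, hx⟩ := Option.isSome_iff_exists.1 h
    obtain ⟨x', hx'⟩ := Option.isSome_iff_exists.1 h'
    exact (huniq _ _ _ _ _ _ _ _ _ _ _ hx hx' hp).1)
  refine ⟨σ, fun s y t q o h => ?_⟩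
  obtain ⟨w, hw⟩ := cw_exists h
  have hg1 : g ((s, w, t), unh s w, y) = some o := (gspec _ _ _ _ _ _).2 ⟨(q, o), h, rfl, hw, rfl⟩
  refine ⟨σ ++ unh s w, ?_, hσ _ _ _ ⟨_, hg1⟩ ?_⟩
  · have := hw.1
    have := req_len h
    simp only at *
    rw [List.length_append, unh_length]; omega
  · rintro ⟨s', w', t'⟩ x' hx'
    exact ((huniq _ _ _ _ _ _ _ _ _ _ _ hg1 hx' (List.prefix_refl _)).2).symm

theorem cluster (hsim : Primrec fun q : (BStr × ℕ) × BStr × BStr => sim q.1.1 q.1.2 q.2.1 q.2.2) :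
    ∃ M : ℕ, 0 < M ∧ ∀ (y : BStr) (a : ℕ) (Near : Finset BStr) (out : BStr → BStr),
      (∀ q ∈ Near, q.length = a ∧ out q ∈ U.eval q y) →
      (∀ q ∈ Near, ∀ q' ∈ Near, sim y a (out q) (out q') = true) → M ≤ Near.card →
      ∃ p o, p.length < a ∧ o ∈ U.eval p y ∧ ∃ q ∈ Near, sim y a o (out q) = true := by
  obtain ⟨σ, hσ⟩ := kc_machine (U := U) hsim
  set s := σ.length + 3
  refine ⟨4 ^ s, by positivity, fun y a Near out h1 h2 hM => ?_⟩
  by_contra hcon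
  have hno : ∀ t q o, kreq U sim s y t = some (q, o) → q.length = a → ∀ q' ∈ Near, sim y a o (out q') = false := by
    intro t q o hr hq q' hq'
    by_contra hs
    obtain ⟨p, hp, hpo⟩ := hσ s y t q o hr
    exact hcon ⟨p, o, by omega, hpo, q', hq', by simpa using hs⟩
  have hpool : ∀ t, ∀ q ∈ Near, ∀ t' < t, evU U y t' = some (q, out q) → (q, out q) ∈ (kst U sim s y t).1 := by
    intro t
    induction t with
    | zero => intro q _ t' ht'; omega
    | succ t ih =>
      intro q hq t' ht' hev
      cases he : evU U y t with
      | none =>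
        rw [kst_succ_none he]
        refine ih q hq t' ?_ hev
        rcases Nat.lt_succ_iff_lt_or_eq.1 ht' with h | h
        · exact h
        · subst h; rw [he] at hev; simp at hev
      | some qo =>
        have hmem : (q, out q) ∈ qo :: (kst U sim s y t).1 := by
          rcases Nat.lt_succ_iff_lt_or_eq.1 ht' with h | h
          · exact List.mem_cons_of_mem _ (ih q hq t' h hev)
          · subst h; rw [he] at hev; simp only [Option.some.injEq] at hev; rw [hev]; simp
        rw [kst_succ_some he, knextS]
        cases ht : trig sim s y (kst U sim s y t).1 qo with
        | false => exact hmem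
        | true =>
          simp only [cond_true, List.mem_filter]
          refine ⟨hmem, ?_⟩
          by_contra hc
          simp only [simP, Bool.not_eq_true', Bool.not_eq_false, Bool.and_eq_true, decide_eq_true_eq] at hc
          have hl : qo.1.length = a := by rw [← hc.1]; exact (h1 q hq).1
          have := hno t qo.1 qo.2 (kreq_iff.2 ⟨he, ht⟩) hl q hq
          rw [hl, this] at hc
          simp at hc
  have hne : Near.Nonempty := Finset.card_pos.1 (lt_of_lt_of_le (by positivity) hM)
  have hex : ∀ q, ∃ t, q ∈ Near → evU U y t = some (q, out q) := by
    intro q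
    by_cases hq : q ∈ Near
    · obtain ⟨t, ht⟩ := evU_complete (h1 q hq).2
      exact ⟨t, fun _ => ht⟩
    · exact ⟨0, fun h => absurd h hq⟩
  choose τ hτ using hex
  obtain ⟨q0, hq0, hmax⟩ := Finset.exists_max_image Near τ hne
  have hmem : ∀ q ∈ Near, (q, out q) ∈ ((q0, out q0) :: (kst U sim s y (τ q0)).1).filter (simP sim y (q0, out q0)) := by
    intro q hq
    rw [List.mem_filter]
    constructor
    · rcases (hmax q hq).lt_or_eq with h | h
      · exact List.mem_cons_of_mem _ (hpool _ q hq _ h (hτ q hq))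
      · have e1 := hτ q hq
        have e2 := hτ q0 hq0
        rw [h, e2] at e1
        rw [Option.some.inj e1]; simp
    · simp [simP, (h1 q hq).1, (h1 q0 hq0).1, h2 q0 hq0 q hq]
  have htrig : trig sim s y (kst U sim s y (τ q0)).1 (q0, out q0) = true := by
    simp only [trig, decide_eq_true_eq]
    refine hM.trans ?_
    have hsub : Near.image (fun q => (q, out q)) ⊆ (((q0, out q0) :: (kst U sim s y (τ q0)).1).filter (simP sim y (q0, out q0))).toFinset := by
      intro r hr
      obtain ⟨q, hq, rfl⟩ := Finset.mem_image.1 hr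
      exact List.mem_toFinset.2 (hmem q hq)
    have := Finset.card_le_card hsub
    rw [Finset.card_image_of_injective _ (fun a b h => (Prod.mk.inj h).1)] at this
    exact this.trans (List.toFinset_card_le _)
  have := hno _ q0 (out q0) (kreq_iff.2 ⟨hτ q0 hq0, htrig⟩) (h1 q0 hq0).1 q0 hq0
  rw [h2 q0 hq0 q0 hq0] at this
  simp at this
end KC


/-- The direct encoding of rationals. -/
abbrev rEnc : ℚ → ℕ := @Encodable.encode ℚ Rat.instEncodable

theorem rEnc_eq (q : ℚ) : rEnc q = Nat.pair (Encodable.encode q.num) q.den := rfl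

theorem rEnc_inj : Function.Injective rEnc := Encodable.encode_injective

/-- Absolute value of the integer with a given code. -/
def zabs (n : ℕ) : ℕ := cond (decide (n % 2 = 0)) (n / 2) (n / 2 + 1)

def isRat (n : ℕ) : Bool := decide (0 < n.unpair.2) &&
  (List.range (n.unpair.2 + 1)).all fun k =>
    !(decide (zabs n.unpair.1 % k = 0) && decide (n.unpair.2 % k = 0)) || decide (k = 1)

theorem encode_int_zabs (z : ℤ) : zabs (Encodable.encode z) = z.natAbs := by
  cases z with
  | ofNat n =>
    have : Encodable.encode (Int.ofNat n) = 2 * n := rfl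
    rw [this]; simp [zabs]
  | negSucc n =>
    have : Encodable.encode (Int.negSucc n) = 2 * n + 1 := rfl
    rw [this]
    have h : ¬ ((2 * n + 1) % 2 = 0) := by omega
    simp only [zabs, h, decide_false, cond_false, Int.natAbs_negSucc]; omega

theorem encode_int_surj (n : ℕ) : ∃ z : ℤ, Encodable.encode z = n := by
  rcases Nat.even_or_odd' n with ⟨k, rfl | rfl⟩
  · exact ⟨Int.ofNat k, rfl⟩
  · exact ⟨Int.negSucc k, rfl⟩

theorem isRat_iff (n : ℕ) : isRat n = true ↔ n ∈ Set.range rEnc := by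
  have h1 : isRat n = true ↔ 0 < n.unpair.2 ∧ Nat.Coprime (zabs n.unpair.1) n.unpair.2 := by
    simp only [isRat, Bool.and_eq_true, decide_eq_true_eq, List.all_eq_true, List.mem_range, Bool.or_eq_true,
      Bool.not_eq_true', Bool.and_eq_false_iff, decide_eq_false_iff_not]
    refine and_congr_right fun hpos => ?_
    constructor
    · intro h
      have := h (Nat.gcd (zabs n.unpair.1) n.unpair.2) (Nat.lt_succ_of_le (Nat.gcd_le_right _ hpos))
      rcases this with (h | h) | h
      · exact absurd (Nat.mod_eq_zero_of_dvd (Nat.gcd_dvd_left _ _)) h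
      · exact absurd (Nat.mod_eq_zero_of_dvd (Nat.gcd_dvd_right _ _)) h
      · exact h
    · intro h k _
      by_cases h2 : zabs n.unpair.1 % k = 0
      · by_cases h3 : n.unpair.2 % k = 0
        · right
          exact Nat.eq_one_of_dvd_coprimes h (Nat.dvd_of_mod_eq_zero h2) (Nat.dvd_of_mod_eq_zero h3)
        · exact Or.inl (Or.inr h3)
      · exact Or.inl (Or.inl h2)
  rw [h1]
  constructor
  · rintro ⟨h2, h3⟩
    obtain ⟨z, hz⟩ := encode_int_surj n.unpair.1
    rw [← hz, encode_int_zabs] at h3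
    refine ⟨⟨z, n.unpair.2, by omega, h3⟩, ?_⟩
    rw [rEnc_eq]
    simp only [hz, Nat.pair_unpair]
  · rintro ⟨q, rfl⟩
    rw [rEnc_eq, Nat.unpair_pair]
    simp only [encode_int_zabs]
    exact ⟨q.den_pos, q.reduced⟩

theorem prim_isRat : Primrec isRat := by
  have h1 : Primrec fun n : ℕ => n.unpair.1 := Primrec.fst.comp Primrec.unpair
  have h2 : Primrec fun n : ℕ => n.unpair.2 := Primrec.snd.comp Primrec.unpair
  have hz : Primrec zabs := by
    refine Primrec.cond (prim_eq (Primrec.nat_mod.comp Primrec.id (Primrec.const 2)) (Primrec.const 0)) ?_ ?_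
    · exact Primrec.nat_div.comp Primrec.id (Primrec.const 2)
    · exact Primrec.succ.comp (Primrec.nat_div.comp Primrec.id (Primrec.const 2))
  refine Primrec.and.comp (prim_lt (Primrec.const 0) h2) ?_
  refine prim_all (Primrec.list_range.comp (Primrec.succ.comp h2)) ?_
  refine Primrec.or.comp (Primrec.not.comp (Primrec.and.comp ?_ ?_)) (prim_eq Primrec.snd (Primrec.const 1))
  · exact prim_eq (Primrec.nat_mod.comp ((hz.comp h1).comp Primrec.fst) Primrec.snd) (Primrec.const 0)
  · exact prim_eq (Primrec.nat_mod.comp (h2.comp Primrec.fst) Primrec.snd) (Primrec.const 0)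

def rrank (n : ℕ) : ℕ := ((List.range n).filter isRat).length

theorem prim_rrank : Primrec rrank :=
  Primrec.list_length.comp (prim_filter Primrec.list_range (prim_isRat.comp Primrec.snd).to₂)

theorem rank_enc (q : ℚ) : (Primcodable.toEncodable (α := ℚ)).encode q = rrank (rEnc q) := by
  have : (Primcodable.toEncodable (α := ℚ)).encode q = @List.countP ℕ (fun j => @decide (j ∈ Set.range rEnc) (Encodable.decidableRangeEncode ℚ j)) (List.range (rEnc q)) := rfl
  rw [this, rrank, ← List.countP_eq_length_filter]
  congr 1
  funext j
  rw [Bool.eq_iff_iff, isRat_iff]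
  exact @decide_eq_true_iff _ (Encodable.decidableRangeEncode ℚ j)

/-- Rational with a given direct code. -/
noncomputable def rDec (n : ℕ) : ℚ := if h : n ∈ Set.range rEnc then h.choose else 0

theorem rDec_enc (q : ℚ) : rDec (rEnc q) = q := by
  have h : rEnc q ∈ Set.range rEnc := ⟨q, rfl⟩
  rw [rDec, dif_pos h]
  exact rEnc_inj h.choose_spec

theorem prim_rDec : Primrec rDec := by
  rw [← Primrec.encode_iff]
  have : (fun n => (Primcodable.toEncodable (α := ℚ)).encode (rDec n)) =
      fun n => cond (isRat n) (rrank n) (rrank (rEnc 0)) := by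
    funext n
    rw [rank_enc]
    cases h : isRat n with
    | true =>
      obtain ⟨q, rfl⟩ := (isRat_iff n).1 h
      rw [rDec_enc]; rfl
    | false =>
      have : ¬ n ∈ Set.range rEnc := by rw [← isRat_iff]; simp [h]
      rw [rDec, dif_neg this]; rfl
  rw [this]
  exact Primrec.cond prim_isRat prim_rrank (Primrec.const _)

theorem KPdf_spec (U : UniversalPrefixMachine) (P : BStr → ℝ) (hP : IsCPDF P) :
    ∃ p : BStr, p.length = KPdf U P ∧ ∀ (z : BStr) (ε : ℚ), 0 < ε →
    ∃ q : ℚ, code q ∈ U.eval p (code (z, ε)) ∧ |((q : ℚ) : ℝ) - P z| < (ε : ℝ) := by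
  obtain ⟨_, _, g, hg, hgP⟩ := hP
  have hne : {m | ∃ p : BStr, p.length = m ∧ ∀ (z : BStr) (ε : ℚ), 0 < ε →
    ∃ q : ℚ, code q ∈ U.eval p (code (z, ε)) ∧ |((q : ℚ) : ℝ) - P z| < (ε : ℝ)}.Nonempty := by
    let arg : BStr → BStr × ℚ := fun y =>
      ((Encodable.decode (α := BStr) (ofBits y).unpair.1).getD [], rDec (ofBits y).unpair.2)
    have harg : Primrec arg := by
      have hu := Primrec.unpair.comp prim_ofBits
      exact Primrec.pair (Primrec.option_getD.comp (Primrec.decode.comp (Primrec.fst.comp hu)) (Primrec.const []))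
        (prim_rDec.comp (Primrec.snd.comp hu))
    have harg' : ∀ z ε, arg (code (z, ε)) = (z, ε) := by
      intro z ε
      have : ofBits (code (z, ε)) = Nat.pair (Encodable.encode z) (rEnc ε) := ofBits_bits _
      simp only [arg, this, Nat.unpair_pair, Encodable.encodek, rDec_enc]; rfl
    let h : ℕ × BStr × BStr → Option BStr := fun a =>
      cond (decide (a.2.1 = []) && (isRat a.1 &&
        decide (rrank a.1 = (Primcodable.toEncodable (α := ℚ)).encode (g (arg a.2.2))))) (some (Nat.bits a.1)) none
    have hspec : ∀ j p y x, h (j, p, y) = some x ↔ p = [] ∧ j = rEnc (g (arg y)) ∧ x = code (g (arg y)) := by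
      intro j p y x
      simp only [h, cond_eq_ite, Bool.and_eq_true, decide_eq_true_eq]
      split_ifs with hc
      · obtain ⟨h1, h2, h3⟩ := hc
        obtain ⟨q, rfl⟩ := (isRat_iff j).1 h2
        rw [← rank_enc] at h3
        have := @Encodable.encode_injective ℚ (Primcodable.toEncodable (α := ℚ)) _ _ h3
        subst this
        simp [h1, eq_comm, code]
      · simp only [false_iff, reduceCtorEq]
        rintro ⟨h1, rfl, _⟩
        exact hc ⟨h1, (isRat_iff _).2 ⟨_, rfl⟩, (rank_enc _).symm⟩
    have hh : Computable h := by
      refine Computable.cond ?_ ?_ (Computable.const none)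
      · refine Primrec.and.to_comp.comp ?_ (Primrec.and.to_comp.comp ?_ ?_)
        · exact (prim_eq (Primrec.fst.comp Primrec.snd) (Primrec.const [])).to_comp
        · exact (prim_isRat.comp Primrec.fst).to_comp
        · have e1 : Primrec₂ (fun a b : ℕ => decide (a = b)) := prim_eq Primrec.fst Primrec.snd
          exact e1.to_comp.comp (prim_rrank.comp Primrec.fst).to_comp
            (Computable.encode.comp (hg.comp (harg.comp (Primrec.snd.comp Primrec.snd)).to_comp))
      · exact (Primrec.option_some.comp (prim_bits.comp Primrec.fst)).to_comp
    obtain ⟨s, hs⟩ := PM_lemma' U h hh (by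
      intro y w p w' p' h h' hp
      obtain ⟨x, hx⟩ := Option.isSome_iff_exists.1 h
      obtain ⟨x', hx'⟩ := Option.isSome_iff_exists.1 h'
      rw [((hspec _ _ _ _).1 hx).1, ((hspec _ _ _ _).1 hx').1])
    refine ⟨_, s ++ [], rfl, fun z ε hε => ⟨g (z, ε), ?_, hgP z ε hε⟩⟩
    apply hs
    · exact ⟨_, (hspec _ _ _ _).2 ⟨rfl, rfl, by rw [harg']⟩⟩
    · intro w x' hx'
      rw [((hspec _ _ _ _).1 hx').2.2, harg']
  obtain ⟨p, h1, h2⟩ := Nat.sInf_mem hne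
  exact ⟨p, h1, h2⟩


/-- Code of the rational `1/2^e`. -/
def epsQ (e : ℕ) : ℕ := Nat.pair 2 (2 ^ e)

theorem epsQ_eq (e : ℕ) : rEnc (1 / 2 ^ e : ℚ) = epsQ e := by
  have h : (1 / 2 ^ e : ℚ) = ((2 ^ e : ℕ) : ℚ)⁻¹ := by simp
  rw [rEnc_eq, h, Rat.inv_natCast_num_of_pos (by positivity), Rat.inv_natCast_den_of_pos (by positivity)]
  rfl

/-- Dyadic floor of the (nonnegative part of the) rational with code `n`. -/
def flo (n e : ℕ) : ℕ := cond (decide (n.unpair.1 % 2 = 0)) (n.unpair.1 / 2 * 2 ^ e / n.unpair.2) 0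

theorem flo_spec (q : ℚ) (e : ℕ) (p : ℝ) (hp : 0 ≤ p) (h : |(q : ℝ) - p| < 1 / 2 ^ e) :
    |(flo (rEnc q) e : ℝ) / 2 ^ e - p| ≤ 2 / 2 ^ e := by
  have hd : (0:ℝ) < 2 ^ e := by positivity
  set δ : ℝ := 1 / 2 ^ e with hδ
  have h2 : (2:ℝ) / 2 ^ e = 2 * δ := by rw [hδ]; ring
  have hδ0 : 0 < δ := by rw [hδ]; positivity
  rw [h2]
  rw [abs_lt] at h
  rw [rEnc_eq, flo, Nat.unpair_pair]
  simp only
  rcases le_or_gt 0 q.num with hn | hn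
  · obtain ⟨n, hn'⟩ := Int.eq_ofNat_of_zero_le hn
    have e1 : Encodable.encode q.num = 2 * n := by rw [hn']; rfl
    have e2 : decide (2 * n % 2 = 0) = true := by simp
    rw [e1, e2]
    simp only [cond_true, Nat.mul_div_cancel_left n (by norm_num : 0 < 2)]
    have hdp : 0 < q.den := q.den_pos
    have hq : (q : ℝ) = n / q.den := by
      conv_lhs => rw [← Rat.num_div_den q]
      rw [hn']; push_cast; rfl
    set f := n * 2 ^ e / q.den
    have f1 : f * q.den ≤ n * 2 ^ e := Nat.div_mul_le_self _ _
    have f2 : n * 2 ^ e < f * q.den + q.den := Nat.lt_div_mul_add hdp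
    have f1' : (f : ℝ) * q.den ≤ n * 2 ^ e := by exact_mod_cast f1
    have f2' : (n : ℝ) * 2 ^ e < f * q.den + q.den := by exact_mod_cast f2
    have hdp' : (0:ℝ) < q.den := by exact_mod_cast hdp
    have g1 : (f : ℝ) / 2 ^ e ≤ q := by
      rw [hq, div_le_div_iff₀ hd hdp']; exact f1'
    have g2 : (q : ℝ) < f / 2 ^ e + δ := by
      rw [hq, hδ, ← add_div, div_lt_div_iff₀ hdp' hd]; nlinarith
    rw [abs_le]; constructor <;> linarith
  · obtain ⟨n, hn'⟩ := Int.eq_negSucc_of_lt_zero hn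
    have e1 : Encodable.encode q.num = 2 * n + 1 := by rw [hn']; rfl
    have e2 : decide ((2 * n + 1) % 2 = 0) = false := by
      rw [decide_eq_false_iff_not]; omega
    rw [e1, e2]
    have hq : (q : ℝ) < 0 := by
      have : q < 0 := Rat.num_neg.1 hn
      exact_mod_cast this
    simp only [cond_false, Nat.cast_zero, zero_div]
    rw [abs_le]; constructor <;> linarith

theorem prim_epsQ : Primrec epsQ :=
  Primrec₂.natPair.comp (Primrec.const 2) (prim_pow.comp (Primrec.const 2) Primrec.id)

theorem prim_flo : Primrec₂ flo := by
  have h1 : Primrec fun a : ℕ × ℕ => a.1.unpair.1 := Primrec.fst.comp (Primrec.unpair.comp Primrec.fst)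
  have h2 : Primrec fun a : ℕ × ℕ => a.1.unpair.2 := Primrec.snd.comp (Primrec.unpair.comp Primrec.fst)
  refine Primrec.cond (prim_eq (Primrec.nat_mod.comp h1 (Primrec.const 2)) (Primrec.const 0)) ?_ (Primrec.const 0)
  exact Primrec.nat_div.comp (Primrec.nat_mul.comp (Primrec.nat_div.comp h1 (Primrec.const 2))
    (prim_pow.comp (Primrec.const 2) Primrec.snd)) h2

/-- The string with code `i`. -/
def strN (i : ℕ) : BStr := (Encodable.decode (α := BStr) i).getD []

def isStr (i : ℕ) : Bool := decide (Encodable.encode (strN i) = i)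

theorem strN_encode (z : BStr) : strN (Encodable.encode z) = z := by simp [strN]
theorem isStr_encode (z : BStr) : isStr (Encodable.encode z) = true := by simp [isStr, strN_encode]
theorem prim_strN : Primrec strN := Primrec.option_getD.comp Primrec.decode (Primrec.const [])
theorem prim_isStr : Primrec isStr := prim_eq (Primrec.encode.comp prim_strN) Primrec.id

/-- `P` transported to natural numbers. -/
noncomputable def PN (P : BStr → ℝ) (i : ℕ) : ℝ := if isStr i then P (strN i) else 0

theorem PN_encode (P : BStr → ℝ) (z : BStr) : PN P (Encodable.encode z) = P z := by
  simp [PN, isStr_encode, strN_encode]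

theorem PN_hasSum (P : BStr → ℝ) (h : HasSum P 1) : HasSum (PN P) 1 := by
  have hi : Function.Injective (Encodable.encode : BStr → ℕ) := Encodable.encode_injective
  refine (hi.hasSum_iff ?_).1 ?_
  · intro i hi
    have : isStr i = false := by
      by_contra hc
      apply hi
      exact ⟨strN i, by simpa [isStr] using hc⟩
    simp [PN, this]
  · convert h using 1
    funext z; exact PN_encode P z

theorem PN_nonneg (P : BStr → ℝ) (h : ∀ z, 0 ≤ P z) (i : ℕ) : 0 ≤ PN P i := by
  unfold PN; split_ifs
  · exact h _
  · exact le_refl _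

/-- Dyadic vectors. -/
noncomputable def FF (E : ℕ) (l : List ℕ) (i : ℕ) : ℝ := (l.getD i 0 : ℝ) / 2 ^ E

theorem FF_zero {E l i} (h : l.length ≤ i) : FF E l i = 0 := by
  rw [FF, List.getD_eq_default _ _ h]; simp

theorem FF_summable (E l) : Summable (FF E l) :=
  summable_of_hasFiniteSupport ((Set.finite_lt_nat l.length).subset (fun i hi => by
    by_contra h
    exact hi (FF_zero (by simpa using h))))

noncomputable def DD (f g : ℕ → ℝ) : ℝ := ∑' i, |f i - g i|

theorem DD_summable {f g : ℕ → ℝ} (hf : Summable f) (hg : Summable g) : Summable fun i => |f i - g i| :=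
  (hf.sub hg).abs

theorem DD_nonneg (f g : ℕ → ℝ) : 0 ≤ DD f g := tsum_nonneg fun _ => abs_nonneg _

theorem DD_comm (f g : ℕ → ℝ) : DD f g = DD g f := by
  unfold DD; congr; funext i; exact abs_sub_comm _ _

theorem DD_tri {f g h : ℕ → ℝ} (hf : Summable f) (hg : Summable g) (hh : Summable h) :
    DD f h ≤ DD f g + DD g h := by
  unfold DD
  rw [← (DD_summable hf hg).tsum_add (DD_summable hg hh)]
  exact (DD_summable hf hh).tsum_le_tsum (fun i => abs_sub_le _ _ _) ((DD_summable hf hg).add (DD_summable hg hh))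

theorem DD_le_pt {f g : ℕ → ℝ} (hf : Summable f) (hg : Summable g) (i : ℕ) : |f i - g i| ≤ DD f g :=
  (DD_summable hf hg).le_tsum i (fun _ _ => abs_nonneg _)

/-- Distance from a dyadic vector to a distribution as a finite sum. -/
theorem DD_fin {p : ℕ → ℝ} (hp : HasSum p 1) (h0 : ∀ i, 0 ≤ p i) (E : ℕ) (l : List ℕ) :
    DD (FF E l) p = 1 + ∑ i ∈ Finset.range l.length, (|FF E l i - p i| - p i) := by
  have h1 := (DD_summable (FF_summable E l) hp.summable).sum_add_tsum_nat_add l.length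
  have h2 := hp.summable.sum_add_tsum_nat_add l.length
  rw [hp.tsum_eq] at h2
  have h3 : ∑' i, |FF E l (i + l.length) - p (i + l.length)| = ∑' i, p (i + l.length) := by
    congr; funext i
    rw [FF_zero (by omega), zero_sub, abs_neg, abs_of_nonneg (h0 _)]
  rw [h3] at h1
  rw [DD, ← h1, Finset.sum_sub_distrib]
  linarith

noncomputable def ESTV (E : ℕ) (l : List ℕ) (e : ℕ) (v : ℕ → ℕ) : ℝ :=
  1 + ∑ i ∈ Finset.range l.length, (|FF E l i - v i / 2 ^ e| - v i / 2 ^ e + 4 * (1 / 2 ^ e))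

theorem est_sound {p : ℕ → ℝ} (hp : HasSum p 1) (h0 : ∀ i, 0 ≤ p i) (E : ℕ) (l : List ℕ) (e : ℕ) (v : ℕ → ℕ)
    (hv : ∀ i, (v i : ℝ) / 2 ^ e ≤ p i + 2 / 2 ^ e) : DD (FF E l) p ≤ ESTV E l e v := by
  rw [DD_fin hp h0, ESTV]
  gcongr with i _
  have := hv i
  have e2 : (2:ℝ) / 2 ^ e = 2 * (1 / 2 ^ e) := by ring
  rw [e2] at this
  have hd : (0:ℝ) < 1 / 2 ^ e := by positivity
  rcases abs_cases (FF E l i - p i) with ⟨h, _⟩ | ⟨h, _⟩ <;>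
    rcases abs_cases (FF E l i - v i / 2 ^ e) with ⟨h', _⟩ | ⟨h', _⟩ <;> rw [h, h'] <;> linarith

theorem est_complete {p : ℕ → ℝ} (hp : HasSum p 1) (h0 : ∀ i, 0 ≤ p i) (E : ℕ) (l : List ℕ) (e : ℕ) (v : ℕ → ℕ)
    (hv : ∀ i < l.length, |(v i : ℝ) / 2 ^ e - p i| ≤ 2 / 2 ^ e) :
    ESTV E l e v ≤ DD (FF E l) p + l.length * 8 * (1 / 2 ^ e) := by
  rw [DD_fin hp h0, ESTV]
  have : (l.length : ℝ) * 8 * (1 / 2 ^ e) = ∑ i ∈ Finset.range l.length, (8 * (1 / 2 ^ e) : ℝ) := by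
    simp; ring
  rw [this, add_assoc, ← Finset.sum_add_distrib]
  refine add_le_add le_rfl (Finset.sum_le_sum fun i hi => ?_)
  have := abs_le.1 (hv i (Finset.mem_range.1 hi))
  have e2 : (2:ℝ) / 2 ^ e = 2 * (1 / 2 ^ e) := by ring
  rw [e2] at this
  have hd : (0:ℝ) < 1 / 2 ^ e := by positivity
  rcases abs_cases (FF E l i - p i) with ⟨h, _⟩ | ⟨h, _⟩ <;>
    rcases abs_cases (FF E l i - v i / 2 ^ e) with ⟨h', _⟩ | ⟨h', _⟩ <;> rw [h, h'] <;> linarith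

def ndist (a b : ℕ) : ℕ := (a - b) + (b - a)

theorem ndist_cast (a b : ℕ) : (ndist a b : ℝ) = |(a : ℝ) - b| := by
  rcases le_total a b with h | h
  · have : ndist a b = b - a := by unfold ndist; omega
    rw [this, Nat.cast_sub h, abs_sub_comm, abs_of_nonneg]; have : (a:ℝ) ≤ b := by exact_mod_cast h
    linarith
  · have : ndist a b = a - b := by unfold ndist; omega
    rw [this, Nat.cast_sub h, abs_of_nonneg]; have : (b:ℝ) ≤ a := by exact_mod_cast h
    linarith

theorem sum_range_map (f : ℕ → ℕ) (n : ℕ) : ((List.range n).map f).sum = ∑ i ∈ Finset.range n, f i := by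
  induction n with
  | zero => simp
  | succ n ih => rw [List.range_succ, Finset.sum_range_succ]; simp [ih]

def okN (R E : ℕ) (l : List ℕ) (e : ℕ) (v : ℕ → ℕ) : Bool :=
  decide (2 ^ R * (2 ^ E * 2 ^ e + ((List.range l.length).map fun i => ndist (l.getD i 0 * 2 ^ e) (v i * 2 ^ E) + 4 * 2 ^ E).sum)
    < 2 ^ E * 2 ^ e + 2 ^ R * ((List.range l.length).map fun i => v i * 2 ^ E).sum)

theorem okN_iff (R E l e v) : okN R E l e v = true ↔ ESTV E l e v < 1 / 2 ^ R := by
  rw [okN, decide_eq_true_eq, sum_range_map, sum_range_map, ← Nat.cast_lt (α := ℝ)]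
  push_cast
  have key : ESTV E l e v = ((2 ^ E * 2 ^ e + ∑ i ∈ Finset.range l.length, (|(l.getD i 0 : ℝ) * 2 ^ e - v i * 2 ^ E| + 4 * 2 ^ E)) -
      ∑ i ∈ Finset.range l.length, (v i : ℝ) * 2 ^ E) / (2 ^ E * 2 ^ e) := by
    rw [add_sub_assoc, ← Finset.sum_sub_distrib, add_div, div_self (by positivity), Finset.sum_div, ESTV]
    congr 1
    refine Finset.sum_congr rfl fun i _ => ?_
    have : |FF E l i - v i / 2 ^ e| = |(l.getD i 0 : ℝ) * 2 ^ e - v i * 2 ^ E| / (2 ^ E * 2 ^ e) := by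
      rw [FF, div_sub_div _ _ (by positivity) (by positivity), abs_div, abs_of_pos (show (0:ℝ) < 2 ^ E * 2 ^ e by positivity)]
      congr 2; ring
    rw [this]; field_simp; ring
  rw [key, div_lt_div_iff₀ (by positivity) (by positivity)]
  simp only [ndist_cast]
  push_cast
  constructor <;> intro h <;> linarith

def simN (R E : ℕ) (l : List ℕ) (E' : ℕ) (l' : List ℕ) : Bool :=
  decide (2 ^ R * ((List.range (l.length + l'.length)).map fun i => ndist (l.getD i 0 * 2 ^ E') (l'.getD i 0 * 2 ^ E)).sum
    < 2 * (2 ^ E * 2 ^ E'))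

theorem simN_iff (R E l E' l') : simN R E l E' l' = true ↔ DD (FF E l) (FF E' l') < 2 * (1 / 2 ^ R) := by
  rw [simN, decide_eq_true_eq, sum_range_map, ← Nat.cast_lt (α := ℝ)]
  push_cast
  have key : DD (FF E l) (FF E' l') = (∑ i ∈ Finset.range (l.length + l'.length), |(l.getD i 0 : ℝ) * 2 ^ E' - l'.getD i 0 * 2 ^ E|) / (2 ^ E * 2 ^ E') := by
    rw [DD, tsum_eq_sum (s := Finset.range (l.length + l'.length)), Finset.sum_div]
    · refine Finset.sum_congr rfl fun i _ => ?_
      rw [FF, FF, div_sub_div _ _ (by positivity) (by positivity), abs_div, abs_of_pos (show (0:ℝ) < 2 ^ E * 2 ^ E' by positivity)]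
      congr 2; ring
    · intro i hi
      have : l.length + l'.length ≤ i := by simpa using hi
      rw [FF_zero (by omega), FF_zero (by omega)]; simp
  have e2 : (2:ℝ) * (1 / 2 ^ R) = 2 / 2 ^ R := by ring
  rw [key, e2, div_lt_div_iff₀ (by positivity) (by positivity)]
  simp only [ndist_cast]
  push_cast
  constructor <;> intro h <;> linarith

section prims
variable {α : Type} [Primcodable α]
theorem prim_ndist : Primrec₂ ndist :=
  Primrec.nat_add.comp (Primrec.nat_sub.comp Primrec.fst Primrec.snd) (Primrec.nat_sub.comp Primrec.snd Primrec.fst)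

theorem prim_getD0 : Primrec₂ (fun (l : List ℕ) (i : ℕ) => l.getD i 0) := Primrec.list_getD 0

theorem prim_okN {R E e : α → ℕ} {l : α → List ℕ} {v : α → ℕ → ℕ} (hR : Primrec R) (hE : Primrec E)
    (hl : Primrec l) (he : Primrec e) (hv : Primrec₂ v) :
    Primrec fun a => okN (R a) (E a) (l a) (e a) (v a) := by
  have p2 : ∀ {f : α → ℕ}, Primrec f → Primrec fun a => 2 ^ f a := fun hf => prim_pow.comp (Primrec.const 2) hf
  have hr : Primrec fun a => List.range (l a).length := Primrec.list_range.comp (Primrec.list_length.comp hl)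
  have hEe := Primrec.nat_mul.comp (p2 hE) (p2 he)
  have hm : Primrec₂ fun a i => v a i * 2 ^ E a := Primrec.nat_mul.comp hv ((p2 hE).comp Primrec.fst)
  refine prim_lt (Primrec.nat_mul.comp (p2 hR) (Primrec.nat_add.comp hEe (prim_sum (Primrec.list_map hr ?_))))
    (Primrec.nat_add.comp hEe (Primrec.nat_mul.comp (p2 hR) (prim_sum (Primrec.list_map hr hm))))
  refine Primrec.nat_add.comp (prim_ndist.comp (Primrec.nat_mul.comp (prim_getD0.comp (hl.comp Primrec.fst) Primrec.snd)
    ((p2 he).comp Primrec.fst)) hm) (Primrec.nat_mul.comp (Primrec.const 4) ((p2 hE).comp Primrec.fst))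

theorem prim_simN {R E E' : α → ℕ} {l l' : α → List ℕ} (hR : Primrec R) (hE : Primrec E)
    (hl : Primrec l) (hE' : Primrec E') (hl' : Primrec l') :
    Primrec fun a => simN (R a) (E a) (l a) (E' a) (l' a) := by
  have p2 : ∀ {f : α → ℕ}, Primrec f → Primrec fun a => 2 ^ f a := fun hf => prim_pow.comp (Primrec.const 2) hf
  refine prim_lt (Primrec.nat_mul.comp (p2 hR) (prim_sum (Primrec.list_map (Primrec.list_range.comp
    (Primrec.nat_add.comp (Primrec.list_length.comp hl) (Primrec.list_length.comp hl'))) ?_)))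
    (Primrec.nat_mul.comp (Primrec.const 2) (Primrec.nat_mul.comp (p2 hE) (p2 hE')))
  exact prim_ndist.comp (Primrec.nat_mul.comp (prim_getD0.comp (hl.comp Primrec.fst) Primrec.snd)
    ((p2 hE').comp Primrec.fst)) (Primrec.nat_mul.comp (prim_getD0.comp (hl'.comp Primrec.fst) Primrec.snd)
    ((p2 hE).comp Primrec.fst))
end prims


def decF (o : BStr) : ℕ × List ℕ := (Encodable.decode (α := ℕ × List ℕ) (ofBits o)).getD (0, [])

theorem decF_code (E : ℕ) (l : List ℕ) : decF (code (E, l)) = (E, l) := by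
  have : ofBits (code (E, l)) = Encodable.encode (E, l) := ofBits_bits _
  simp [decF, this]

theorem prim_decF : Primrec decF :=
  Primrec.option_getD.comp (Primrec.decode.comp prim_ofBits) (Primrec.const _)

def mOf (y : BStr) : ℕ := ofBits y / 2
theorem prim_mOf : Primrec mOf := Primrec.nat_div.comp prim_ofBits (Primrec.const 2)
theorem mOf_code (m : ℕ) : mOf (code (m : ℤ)) = m := by
  have h : ofBits (code (m : ℤ)) = Encodable.encode (m : ℤ) := ofBits_bits _
  have h2 : Encodable.encode (m : ℤ) = 2 * m := rfl
  rw [mOf, h, h2]; omega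

def Rof (y : BStr) (a : ℕ) : ℕ := 2 * mOf y + 3 + 2 * a
theorem prim_Rof : Primrec₂ Rof :=
  Primrec.nat_add.comp (Primrec.nat_add.comp (Primrec.nat_mul.comp (Primrec.const 2) (prim_mOf.comp Primrec.fst))
    (Primrec.const 3)) (Primrec.nat_mul.comp (Primrec.const 2) Primrec.snd)

noncomputable def Fo (o : BStr) : ℕ → ℝ := FF (decF o).1 (decF o).2
noncomputable def DP (P : BStr → ℝ) (o : BStr) : ℝ := DD (Fo o) (PN P)
theorem Fo_summable (o) : Summable (Fo o) := FF_summable _ _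

def Scond (m E v : ℕ) : Bool := decide (2 ^ E * 2 ^ (m + 2) < v * 2 ^ (2 * m + 3) + 2 ^ E)

def Slist (y o : BStr) : List BStr :=
  ((List.range (decF o).2.length).filter fun i => isStr i && Scond (mOf y) (decF o).1 ((decF o).2.getD i 0)).map strN

theorem prim_Slist : Primrec₂ Slist := by
  have hE : Primrec fun a : BStr × BStr => (decF a.2).1 := Primrec.fst.comp (prim_decF.comp Primrec.snd)
  have hl : Primrec fun a : BStr × BStr => (decF a.2).2 := Primrec.snd.comp (prim_decF.comp Primrec.snd)
  have hm : Primrec fun a : BStr × BStr => mOf a.1 := prim_mOf.comp Primrec.fst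
  refine Primrec.list_map (prim_filter (Primrec.list_range.comp (Primrec.list_length.comp hl)) ?_) (prim_strN.comp Primrec.snd).to₂
  refine Primrec.and.comp (prim_isStr.comp Primrec.snd) ?_
  have p2 : ∀ {α : Type} [Primcodable α] {f : α → ℕ}, Primrec f → Primrec fun a => 2 ^ f a :=
    fun hf => prim_pow.comp (Primrec.const 2) hf
  have hE' := p2 (hE.comp (Primrec.fst (β := ℕ)))
  have hm' := hm.comp (Primrec.fst (β := ℕ))
  exact prim_lt (Primrec.nat_mul.comp hE' (p2 (Primrec.nat_add.comp hm' (Primrec.const 2))))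
    (Primrec.nat_add.comp (Primrec.nat_mul.comp (prim_getD0.comp (hl.comp Primrec.fst) Primrec.snd)
      (p2 (Primrec.nat_add.comp (Primrec.nat_mul.comp (Primrec.const 2) hm') (Primrec.const 3)))) hE')

theorem Scond_iff (m E v : ℕ) : Scond m E v = true ↔ (1:ℝ) / 2 ^ (m+1) - 1 / 2 ^ (2 * m + 3) < v / 2 ^ E := by
  rw [Scond, decide_eq_true_eq, ← Nat.cast_lt (α := ℝ)]
  push_cast
  have e : (1:ℝ) / 2 ^ (m+1) = 2 ^ (m+2) / 2 ^ (2 * m + 3) := by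
    rw [div_eq_div_iff (by positivity) (by positivity), one_mul, ← pow_add]; congr 1; ring
  rw [e, ← sub_div, div_lt_div_iff₀ (by positivity) (by positivity)]
  constructor <;> intro h <;> nlinarith

theorem mem_Slist (y o z : BStr) : z ∈ Slist y o ↔
    (1:ℝ) / 2 ^ (mOf y + 1) - 1 / 2 ^ (2 * mOf y + 3) < Fo o (Encodable.encode z) := by
  have hpos : (0:ℝ) < 1 / 2 ^ (mOf y + 1) - 1 / 2 ^ (2 * mOf y + 3) := by
    rw [sub_pos]
    apply one_div_lt_one_div_of_lt (by positivity)
    exact pow_lt_pow_right₀ (by norm_num) (by omega)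
  simp only [Slist, List.mem_map, List.mem_filter, List.mem_range, Bool.and_eq_true, Scond_iff]
  constructor
  · rintro ⟨i, ⟨_, h2, h3⟩, rfl⟩
    have : Encodable.encode (strN i) = i := by simpa [isStr] using h2
    rw [this]; exact h3
  · intro h
    refine ⟨Encodable.encode z, ⟨?_, isStr_encode z, h⟩, strN_encode z⟩
    by_contra hc
    rw [Fo, FF_zero (by omega)] at h
    linarith

theorem S_lemma {P : BStr → ℝ} (h0 : ∀ z, 0 ≤ P z) (hs : HasSum P 1) (x y o : BStr)
    (h1 : 1 / 2 ^ (mOf y + 1) < P x) (h2 : P x ≤ 1 / 2 ^ mOf y) (hD : DP P o < 1 / 2 ^ (2 * mOf y + 3)) :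
    x ∈ (Slist y o).toFinset ∧ (((Slist y o).toFinset.card : ℕ) : ℝ) < 2 / P x := by
  have hpt : ∀ z, |Fo o (Encodable.encode z) - P z| < 1 / 2 ^ (2 * mOf y + 3) := by
    intro z
    have := DD_le_pt (Fo_summable o) (PN_hasSum P hs).summable (Encodable.encode z)
    rw [PN_encode] at this
    exact lt_of_le_of_lt this hD
  have hx : x ∈ (Slist y o).toFinset := by
    rw [List.mem_toFinset, mem_Slist]
    have := (abs_lt.1 (hpt x)).1
    linarith
  refine ⟨hx, ?_⟩
  set S := (Slist y o).toFinset
  set N : ℝ := 2 ^ (mOf y + 1) with hN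
  have hN0 : 0 < N := by positivity
  have hr : (1:ℝ) / 2 ^ (2 * mOf y + 3) = 1 / (2 * N ^ 2) := by
    rw [hN]; congr 1; rw [← pow_mul, ← pow_succ']; congr 1; ring
  have hz : ∀ z ∈ S, 1 / N - 1 / N ^ 2 ≤ P z := by
    intro z hz
    have h3 := (mem_Slist y o z).1 (List.mem_toFinset.1 hz)
    have h4 := (abs_lt.1 (hpt z)).2
    rw [hr] at h3 h4
    have : 1 / (2 * N ^ 2) + 1 / (2 * N ^ 2) = 1 / N ^ 2 := by field_simp; norm_num
    linarith
  have hsum : ∑ z ∈ S, P z ≤ 1 := sum_le_hasSum S (fun z _ => h0 z) hs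
  rw [← Finset.add_sum_erase S P hx] at hsum
  have hlow : (((S.erase x).card : ℕ) : ℝ) * (1 / N - 1 / N ^ 2) ≤ ∑ z ∈ S.erase x, P z := by
    rw [← nsmul_eq_mul]
    exact Finset.card_nsmul_le_sum _ _ _ (fun z hz' => hz z (Finset.mem_of_mem_erase hz'))
  have hc : (((S.erase x).card : ℕ) : ℝ) = S.card - 1 := by
    rw [Finset.card_erase_of_mem hx, Nat.cast_sub (Finset.card_pos.2 ⟨x, hx⟩)]; simp
  rw [hc] at hlow
  by_contra hcon
  push Not at hcon
  have hPx : 0 < P x := lt_trans (by positivity) h1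
  have h2N : P x ≤ 2 / N := by
    refine h2.trans (le_of_eq ?_)
    rw [hN, pow_succ]; field_simp
  set u := P x * N with hu
  have hu1 : 1 < u := by
    rw [div_lt_iff₀ hN0] at h1; exact h1
  have hu2 : u ≤ 2 := by
    rw [le_div_iff₀ hN0] at h2N; exact h2N
  have hN2 : N = 2 ∨ 4 ≤ N := by
    rcases Nat.eq_zero_or_pos (mOf y) with h | h
    · left; rw [hN, h]; norm_num
    · right
      rw [hN]
      calc (4:ℝ) = 2 ^ 2 := by norm_num
        _ ≤ 2 ^ (mOf y + 1) := pow_le_pow_right₀ (by norm_num) (by omega)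
  have hNge : 2 ≤ N := by rcases hN2 with h | h <;> linarith
  have ht : 0 ≤ 1 / N - 1 / N ^ 2 := by
    rw [sub_nonneg]
    apply one_div_le_one_div_of_le hN0
    nlinarith
  have key : P x + (2 / P x - 1) * (1 / N - 1 / N ^ 2) ≤ 1 := by
    have : (2 / P x - 1) * (1 / N - 1 / N ^ 2) ≤ (S.card - 1 : ℝ) * (1 / N - 1 / N ^ 2) :=
      mul_le_mul_of_nonneg_right (by linarith) ht
    linarith
  have hP : P x = u / N := by rw [hu]; field_simp
  rw [hP] at key
  have hu0 : 0 < u := by linarith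
  have e1 : u / N + (2 / (u / N) - 1) * (1 / N - 1 / N ^ 2) = (u ^ 2 * N + (2 * N - u) * (N - 1)) / (u * N ^ 2) := by
    field_simp
  rw [e1, div_le_one (by positivity)] at key
  rcases hN2 with h | h
  · rw [h] at key; nlinarith [sq_nonneg (u - 5/4)]
  · nlinarith [mul_nonneg (mul_nonneg (sub_nonneg.2 hu2) (show 0 ≤ N - u - 1 by linarith)) hN0.le]

theorem small_pow (c : ℝ) (hc : 0 ≤ c) (ε : ℝ) (hε : 0 < ε) : ∃ E : ℕ, ∀ e ≥ E, c * (1 / 2 ^ e) < ε := by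
  obtain ⟨n, hn⟩ := exists_pow_lt_of_lt_one (show 0 < ε / (c + 1) by positivity) (show (1/2 : ℝ) < 1 by norm_num)
  refine ⟨n, fun e he => ?_⟩
  have h1 : (1:ℝ) / 2 ^ e ≤ (1/2) ^ n := by
    rw [one_div_pow]
    exact one_div_le_one_div_of_le (by positivity) (pow_le_pow_right₀ (by norm_num) he)
  have h2 : (1:ℝ) / 2 ^ e < ε / (c+1) := lt_of_le_of_lt h1 hn
  rw [lt_div_iff₀ (by positivity)] at h2
  have : (0:ℝ) < 1 / 2 ^ e := by positivity
  nlinarith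

theorem approx_exists {p : ℕ → ℝ} (hp : HasSum p 1) (w : ℕ → ℕ → ℕ)
    (hw : ∀ e i, |(w e i : ℝ) / 2 ^ e - p i| ≤ 2 / 2 ^ e) (R : ℕ) :
    ∃ E l, (∀ i < l.length, l.getD i 0 = w E i) ∧ okN R E l E (fun i => l.getD i 0) = true := by
  have hR : (0:ℝ) < 1 / 2 ^ R / 2 := by positivity
  obtain ⟨j, hj⟩ := ((hp.tendsto_sum_nat).eventually (lt_mem_nhds (show 1 - 1 / 2 ^ R / 2 < 1 by linarith))).exists
  obtain ⟨E, hE⟩ := small_pow (j * 6) (by positivity) _ hR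
  have hE := hE E le_rfl
  refine ⟨E, (List.range j).map (w E), ?_, ?_⟩
  · intro i hi
    simp at hi
    simp [hi]
  · rw [okN_iff, ESTV]
    have hle : ∑ i ∈ Finset.range ((List.range j).map (w E)).length,
        (|FF E ((List.range j).map (w E)) i - ((((List.range j).map (w E)).getD i 0 : ℕ) : ℝ) / 2 ^ E| -
          ((((List.range j).map (w E)).getD i 0 : ℕ) : ℝ) / 2 ^ E + 4 * (1 / 2 ^ E)) ≤ ∑ i ∈ Finset.range j, (6 * (1 / 2 ^ E) - p i) := by
      rw [List.length_map, List.length_range]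
      refine Finset.sum_le_sum fun i hi => ?_
      have hi' := Finset.mem_range.1 hi
      have : ((List.range j).map (w E)).getD i 0 = w E i := by simp [hi']
      rw [FF, this, sub_self, abs_zero]
      have h3 := (abs_le.1 (hw E i)).1
      have e2 : (2:ℝ) / 2 ^ E = 2 * (1 / 2 ^ E) := by ring
      linarith
    rw [Finset.sum_sub_distrib] at hle
    simp only [Finset.sum_const, Finset.card_range, nsmul_eq_mul] at hle
    linarith


section
variable (U : UniversalPrefixMachine)

noncomputable def vM (k : ℕ) (q : BStr) (E i : ℕ) : Option ℕ :=
  cond (isStr i) ((Ust U k q (Nat.bits (Nat.pair i (epsQ E)))).map fun o => flo (ofBits o) E) (some 0)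

theorem prim_vM {α : Type} [Primcodable α] {k E i : α → ℕ} {q : α → BStr} (hk : Primrec k) (hq : Primrec q)
    (hE : Primrec E) (hi : Primrec i) : Primrec fun a => vM U (k a) (q a) (E a) (i a) := by
  refine Primrec.cond (prim_isStr.comp hi) (Primrec.option_map ?_ ?_) (Primrec.const _)
  · exact prim_Ust hk hq (prim_bits.comp (Primrec₂.natPair.comp hi (prim_epsQ.comp hE)))
  · exact prim_flo.comp (prim_ofBits.comp Primrec.snd) (hE.comp Primrec.fst)

theorem m0_machine : ∃ c0 : ℕ, ∀ P, IsCPDF P → ∀ y, ∃ q o, q.length = KPdf U P + c0 ∧ o ∈ U.eval q y ∧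
    DP P o < 1 / 2 ^ Rof y q.length := by
  let g : ((ℕ × BStr) × (ℕ × ℕ × List ℕ)) × BStr × BStr → Option BStr := fun a =>
    cond (decide (a.2.1 = unh a.1.1.1 a.1.1.2) &&
      ((Ust U a.1.2.1 a.1.1.2 (Nat.bits (Nat.pair 0 (epsQ 0)))).isSome &&
      (((List.range a.1.2.2.2.length).all fun i => decide (vM U a.1.2.1 a.1.1.2 a.1.2.2.1 i = some (a.1.2.2.2.getD i 0))) &&
      okN (Rof a.2.2 (2 * a.1.1.1 + 1 + a.1.1.2.length)) a.1.2.2.1 a.1.2.2.2 a.1.2.2.1 (fun i => a.1.2.2.2.getD i 0))))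
      (some (Nat.bits (Encodable.encode (a.1.2.2.1, a.1.2.2.2)))) none
  have gspec : ∀ c q k E l p y x, g (((c, q), (k, E, l)), p, y) = some x ↔
      (p = unh c q ∧ (Ust U k q (Nat.bits (Nat.pair 0 (epsQ 0)))).isSome ∧
        (∀ i < l.length, vM U k q E i = some (l.getD i 0)) ∧
        okN (Rof y (2 * c + 1 + q.length)) E l E (fun i => l.getD i 0) = true) ∧ code (E, l) = x := by
    intro c q k E l p y x
    simp only [g, cond_eq_ite, Bool.and_eq_true, decide_eq_true_eq, List.all_eq_true, List.mem_range]
    split_ifs with h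
    · simp only [Option.some.injEq]; exact ⟨fun e => ⟨h, e⟩, fun e => e.2⟩
    · constructor
      · intro e; exact absurd e (by simp)
      · intro e; exact absurd e.1 h
  have hg : Computable g := by
    apply Primrec.to_comp
    have hc : Primrec (fun a : ((ℕ × BStr) × (ℕ × ℕ × List ℕ)) × BStr × BStr => a.1.1.1) :=
      Primrec.fst.comp (Primrec.fst.comp Primrec.fst)
    have hq : Primrec (fun a : ((ℕ × BStr) × (ℕ × ℕ × List ℕ)) × BStr × BStr => a.1.1.2) :=
      Primrec.snd.comp (Primrec.fst.comp Primrec.fst)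
    have hk : Primrec (fun a : ((ℕ × BStr) × (ℕ × ℕ × List ℕ)) × BStr × BStr => a.1.2.1) :=
      Primrec.fst.comp (Primrec.snd.comp Primrec.fst)
    have hE : Primrec (fun a : ((ℕ × BStr) × (ℕ × ℕ × List ℕ)) × BStr × BStr => a.1.2.2.1) :=
      Primrec.fst.comp (Primrec.snd.comp (Primrec.snd.comp Primrec.fst))
    have hl : Primrec (fun a : ((ℕ × BStr) × (ℕ × ℕ × List ℕ)) × BStr × BStr => a.1.2.2.2) :=
      Primrec.snd.comp (Primrec.snd.comp (Primrec.snd.comp Primrec.fst))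
    have hp : Primrec (fun a : ((ℕ × BStr) × (ℕ × ℕ × List ℕ)) × BStr × BStr => a.2.1) :=
      Primrec.fst.comp Primrec.snd
    have hy : Primrec (fun a : ((ℕ × BStr) × (ℕ × ℕ × List ℕ)) × BStr × BStr => a.2.2) :=
      Primrec.snd.comp Primrec.snd
    have hv : Primrec₂ (fun (a : ((ℕ × BStr) × (ℕ × ℕ × List ℕ)) × BStr × BStr) (i : ℕ) => a.1.2.2.2.getD i 0) :=
      prim_getD0.comp (hl.comp Primrec.fst) Primrec.snd
    refine Primrec.cond (Primrec.and.comp ?_ (Primrec.and.comp ?_ (Primrec.and.comp ?_ ?_))) ?_ (Primrec.const none)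
    · exact prim_eq hp (prim_unh hc hq)
    · exact Primrec.option_isSome.comp (prim_Ust hk hq (Primrec.const _))
    · refine prim_all (Primrec.list_range.comp (Primrec.list_length.comp hl)) ?_
      exact prim_eq (prim_vM U (hk.comp Primrec.fst) (hq.comp Primrec.fst) (hE.comp Primrec.fst) Primrec.snd)
        (Primrec.option_some.comp hv)
    · refine prim_okN (prim_Rof.comp hy ?_) hE hl hE hv
      exact Primrec.nat_add.comp (Primrec.succ.comp (Primrec.nat_mul.comp (Primrec.const 2) hc)) (Primrec.list_length.comp hq)
    · exact Primrec.option_some.comp (prim_bits.comp (Primrec.encode.comp (Primrec.pair hE hl)))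
  obtain ⟨σ, hσ⟩ := PM_lemma U g hg (by
    rintro y ⟨⟨c, q⟩, ⟨k, E, l⟩⟩ p ⟨⟨c', q'⟩, ⟨k', E', l'⟩⟩ p' h h' hp
    obtain ⟨x, hx⟩ := Option.isSome_iff_exists.1 h
    obtain ⟨x', hx'⟩ := Option.isSome_iff_exists.1 h'
    obtain ⟨⟨rfl, h1, _⟩, _⟩ := (gspec _ _ _ _ _ _ _ _).1 hx
    obtain ⟨⟨rfl, h1', _⟩, _⟩ := (gspec _ _ _ _ _ _ _ _).1 hx'
    obtain ⟨rfl, hq⟩ := unh_pfx hp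
    obtain ⟨z, hz⟩ := Option.isSome_iff_exists.1 h1
    obtain ⟨z', hz'⟩ := Option.isSome_iff_exists.1 h1'
    rw [Ust_pf hz hz' hq])
  refine ⟨2 * σ.length + 1, fun P hP y => ?_⟩
  obtain ⟨q, hq, hqP⟩ := KPdf_spec U P hP
  obtain ⟨h0, hs, _⟩ := hP
  have hsum : HasSum P 1 := by
    have : Summable P := by
      by_contra hc
      rw [tsum_eq_zero_of_not_summable hc] at hs
      exact zero_ne_one hs
    rw [← hs]; exact this.hasSum
  have hqP' : ∀ (e i : ℕ), isStr i = true → ∃ r : ℚ, Nat.bits (rEnc r) ∈ U.eval q (Nat.bits (Nat.pair i (epsQ e))) ∧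
      |(r : ℝ) - P (strN i)| < 1 / 2 ^ e := by
    intro e i hi
    obtain ⟨r, h1, h2⟩ := hqP (strN i) (1 / 2 ^ e) (by positivity)
    refine ⟨r, ?_, by simpa using h2⟩
    have hc : code (strN i, (1 / 2 ^ e : ℚ)) = Nat.bits (Nat.pair i (epsQ e)) := by
      rw [← epsQ_eq]
      have : Encodable.encode (strN i) = i := by simpa [isStr] using hi
      conv_rhs => rw [← this]
      rfl
    rw [← hc]; exact h1
  have hQ : ∀ e i, ∃ r : ℚ, isStr i = true → Nat.bits (rEnc r) ∈ U.eval q (Nat.bits (Nat.pair i (epsQ e))) ∧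
      |(r : ℝ) - P (strN i)| < 1 / 2 ^ e := by
    intro e i
    by_cases hi : isStr i = true
    · obtain ⟨r, hr⟩ := hqP' e i hi
      exact ⟨r, fun _ => hr⟩
    · exact ⟨0, fun h => absurd h hi⟩
  choose Q hQ using hQ
  let w : ℕ → ℕ → ℕ := fun e i => cond (isStr i) (flo (rEnc (Q e i)) e) 0
  have hw : ∀ e i, |(w e i : ℝ) / 2 ^ e - PN P i| ≤ 2 / 2 ^ e := by
    intro e i
    cases hi : isStr i with
    | true =>
      simp only [w, hi, cond_true, PN, if_true]
      exact flo_spec _ _ _ (h0 _) (hQ e i hi).2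
    | false =>
      simp only [w, hi, cond_false, PN]
      simp
      positivity
  have hvM : ∀ k E i v, vM U k q E i = some v → v = w E i := by
    intro k E i v hv
    cases hi : isStr i with
    | true =>
      simp only [vM, hi, cond_true, Option.map_eq_some_iff] at hv
      obtain ⟨o, h1, rfl⟩ := hv
      have := Part.mem_unique (Ust_mem h1) (hQ E i hi).1
      simp only [w, hi, cond_true, this, ofBits_bits]
    | false =>
      simp [vM, hi] at hv
      simp [w, hi, hv]
  obtain ⟨E, l, hl1, hl2⟩ := approx_exists (PN_hasSum P hsum) w hw (Rof y (2 * σ.length + 1 + q.length))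
  obtain ⟨k1, hk1⟩ := mem_U_iff.1 (hQ 0 0 (by simp [isStr, strN])).1
  obtain ⟨k2, hk2⟩ := Ust_uniform (U := U) ((List.range l.length).filter isStr) (fun _ => q)
    (fun i => Nat.bits (Nat.pair i (epsQ E))) (fun i => Nat.bits (rEnc (Q E i)))
    (fun i hi => (hQ E i (by simpa using (List.mem_filter.1 hi).2)).1)
  have hw1 : g (((σ.length, q), (max k1 k2, E, l)), unh σ.length q, y) = some (code (E, l)) := by
    refine (gspec _ _ _ _ _ _ _ _).2 ⟨⟨rfl, by rw [Ust_mono (le_max_left _ _) hk1]; rfl, ?_, hl2⟩, rfl⟩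
    intro i hi
    rw [hl1 i hi]
    cases his : isStr i with
    | true =>
      have := hk2 i (List.mem_filter.2 ⟨List.mem_range.2 hi, his⟩)
      simp only [vM, his, cond_true, w, Ust_mono (le_max_right k1 k2) this, Option.map_some, ofBits_bits]
    | false => simp [vM, his, w]
  have hdom := (hσ (unh σ.length q) y).2 _ (by rw [hw1]; rfl)
  obtain ⟨⟨⟨c, q'⟩, ⟨k, E', l'⟩⟩, hwit⟩ := (hσ (unh σ.length q) y).1 _ (Part.get_mem hdom)
  obtain ⟨⟨e1, _, e3, e4⟩, e5⟩ := (gspec _ _ _ _ _ _ _ _).1 hwit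
  obtain ⟨rfl, hqq⟩ := unh_pfx (show unh σ.length q <+: unh c q' by rw [e1])
  obtain ⟨_, hqq'⟩ := unh_pfx (show unh σ.length q' <+: unh σ.length q by rw [e1])
  have hqe : q' = q := hqq'.eq_of_length_le hqq.length_le
  subst hqe
  refine ⟨σ ++ unh σ.length q', _, ?_, Part.get_mem hdom, ?_⟩
  · rw [List.length_append, unh_length, hq]; omega
  · rw [← e5]
    have hlen : (σ ++ unh σ.length q').length = 2 * σ.length + 1 + q'.length := by
      rw [List.length_append, unh_length]; omega
    rw [hlen, DP, Fo, decF_code]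
    refine lt_of_le_of_lt ?_ ((okN_iff _ _ _ _ _).1 e4)
    apply est_sound (PN_hasSum P hsum) (PN_nonneg P h0)
    intro i
    by_cases hi : i < l'.length
    · have := hvM _ _ _ _ (e3 i hi)
      simp only [this]
      have := (abs_le.1 (hw E' i)).2
      linarith
    · simp only [List.getD_eq_default _ _ (not_lt.1 hi)]
      have := PN_nonneg P h0 i
      simp only [Nat.cast_zero, zero_div]
      positivity

theorem ks_machine : ∃ c0 : ℕ, ∀ r q y o, y ∈ U.eval r [] → o ∈ U.eval q y →
    U.Kset (Slist y o).toFinset ≤ r.length + q.length + c0 := by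
  let g : (BStr × BStr × ℕ) × BStr × BStr → Option BStr := fun a =>
    cond (decide (a.2.1 = a.1.1 ++ a.1.2.1))
      ((Ust U a.1.2.2 a.1.1 []).bind fun y => (Ust U a.1.2.2 a.1.2.1 y).map fun o => setCode (Slist y o)) none
  have gspec : ∀ r q k p y' x, g ((r, q, k), p, y') = some x ↔
      p = r ++ q ∧ ∃ y, Ust U k r [] = some y ∧ ∃ o, Ust U k q y = some o ∧ setCode (Slist y o) = x := by
    intro r q k p y' x
    simp only [g, cond_eq_ite, decide_eq_true_eq]
    split_ifs with h
    · simp only [h, true_and, Option.bind_eq_some_iff, Option.map_eq_some_iff]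
    · simp [h]
  have hg : Computable g := by
    apply Primrec.to_comp
    have hr : Primrec (fun a : (BStr × BStr × ℕ) × BStr × BStr => a.1.1) := Primrec.fst.comp Primrec.fst
    have hq : Primrec (fun a : (BStr × BStr × ℕ) × BStr × BStr => a.1.2.1) :=
      Primrec.fst.comp (Primrec.snd.comp Primrec.fst)
    have hk : Primrec (fun a : (BStr × BStr × ℕ) × BStr × BStr => a.1.2.2) :=
      Primrec.snd.comp (Primrec.snd.comp Primrec.fst)
    refine Primrec.cond (prim_eq (Primrec.fst.comp Primrec.snd) (Primrec.list_append.comp hr hq)) ?_ (Primrec.const none)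
    refine Primrec.option_bind (prim_Ust hk hr (Primrec.const [])) ?_
    refine Primrec.option_map (prim_Ust (hk.comp Primrec.fst) (hq.comp Primrec.fst) Primrec.snd) ?_
    exact prim_setCode.comp (prim_Slist.comp (Primrec.snd.comp Primrec.fst) Primrec.snd)
  have huniq : ∀ r q k p y x r' q' k' p' y' x', g ((r, q, k), p, y) = some x →
      g ((r', q', k'), p', y') = some x' → p <+: p' → p = p' ∧ x = x' := by
    intro r q k p y x r' q' k' p' y' x' h h' hp
    obtain ⟨rfl, y1, h1, o, h2, rfl⟩ := (gspec _ _ _ _ _ _).1 h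
    obtain ⟨rfl, y1', h1', o', h2', rfl⟩ := (gspec _ _ _ _ _ _).1 h'
    obtain ⟨rfl, hq⟩ := Ust_concat h1 h1' hp
    obtain rfl := Ust_uniq h1 h1'
    obtain rfl := Ust_pf h2 h2' hq
    obtain rfl := Ust_uniq h2 h2'
    exact ⟨rfl, rfl⟩
  obtain ⟨σ, hσ⟩ := PM_lemma' U g hg (by
    rintro y ⟨r, q, k⟩ p ⟨r', q', k'⟩ p' h h' hp
    obtain ⟨x, hx⟩ := Option.isSome_iff_exists.1 h
    obtain ⟨x', hx'⟩ := Option.isSome_iff_exists.1 h'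
    exact (huniq _ _ _ _ _ _ _ _ _ _ _ _ hx hx' hp).1)
  refine ⟨σ.length, fun r q y o hr hq => ?_⟩
  obtain ⟨k1, hk1⟩ := mem_U_iff.1 hr
  obtain ⟨k2, hk2⟩ := mem_U_iff.1 hq
  have hw : g ((r, q, max k1 k2), r ++ q, []) = some (setCode (Slist y o)) :=
    (gspec _ _ _ _ _ _).2 ⟨rfl, y, Ust_mono (le_max_left _ _) hk1, o, Ust_mono (le_max_right _ _) hk2, rfl⟩
  have hmem := hσ (r ++ q) [] _ ⟨_, hw⟩ (by
    rintro ⟨r', q', k'⟩ x' hx'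
    exact ((huniq _ _ _ _ _ _ _ _ _ _ _ _ hw hx' (List.prefix_refl _)).2).symm)
  rw [setCode_eq] at hmem
  have := Kc_le hmem
  rw [UniversalPrefixMachine.Kset, UniversalPrefixMachine.K]
  refine this.trans ?_
  simp only [List.length_append]; omega
end


def vT (T : List ℕ) (e i : ℕ) : ℕ :=
  cond (isStr i) (flo (T.getD (Nat.pair i (epsQ e)) 0 - 1) e) 0

section
variable (U : UniversalPrefixMachine)

noncomputable def ver (T : List ℕ) (y q : BStr) : Bool :=
  ((Ust U T.length q y).map fun o =>
    okN (Rof y q.length) (decF o).1 (decF o).2 T.length.unpair.2 (vT T T.length.unpair.2)).getD false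

noncomputable def found (T : List ℕ) (a : ℕ) (y : BStr) : List BStr := (strs a).filter (ver U T y)

theorem prim_vT {α : Type} [Primcodable α] {T : α → List ℕ} {e i : α → ℕ} (hT : Primrec T) (he : Primrec e)
    (hi : Primrec i) : Primrec fun a => vT (T a) (e a) (i a) := by
  refine Primrec.cond (prim_isStr.comp hi) (prim_flo.comp (Primrec.pred.comp ?_) he) (Primrec.const 0)
  exact prim_getD0.comp hT (Primrec₂.natPair.comp hi (prim_epsQ.comp he))

theorem prim_ver {α : Type} [Primcodable α] {T : α → List ℕ} {y q : α → BStr} (hT : Primrec T) (hy : Primrec y)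
    (hq : Primrec q) : Primrec fun a => ver U (T a) (y a) (q a) := by
  have hl := Primrec.list_length.comp hT
  have he : Primrec fun a => (T a).length.unpair.2 := Primrec.snd.comp (Primrec.unpair.comp hl)
  refine Primrec.option_getD.comp (Primrec.option_map (prim_Ust hl hq hy) ?_) (Primrec.const false)
  refine prim_okN ?_ ?_ ?_ (he.comp Primrec.fst) ?_
  · exact (prim_Rof.comp hy (Primrec.list_length.comp hq)).comp Primrec.fst
  · exact Primrec.fst.comp (prim_decF.comp Primrec.snd)
  · exact Primrec.snd.comp (prim_decF.comp Primrec.snd)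
  · exact prim_vT (hT.comp (Primrec.fst.comp Primrec.fst)) (he.comp (Primrec.fst.comp Primrec.fst)) Primrec.snd

theorem prim_found {α : Type} [Primcodable α] {T : α → List ℕ} {y : α → BStr} {a : α → ℕ} (hT : Primrec T)
    (ha : Primrec a) (hy : Primrec y) : Primrec fun x => found U (T x) (a x) (y x) :=
  prim_filter (prim_strs.comp ha) (prim_ver U (hT.comp Primrec.fst) (hy.comp Primrec.fst) Primrec.snd)

theorem prim_take {α : Type} [Primcodable α] {T : α → List ℕ} {n : α → ℕ} (hT : Primrec T) (hn : Primrec n) :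
    Primrec fun x => (T x).take (n x) :=
  Primrec.list_take.comp hn hT

theorem oracle_machine (V : UniversalOracleMachine) (n : ℕ) : ∃ s : BStr, ∀ (O : ℕ → ℕ) (h : BStr) (a : ℕ) (r y p' x qs os : BStr),
    code a ∈ U.eval h [] → y ∈ U.eval r [] →
    (∀ t, n ≤ (found U ((List.range t).map O) a y).length → (found U ((List.range t).map O) a y).head? = some qs) →
    (∃ t, n ≤ (found U ((List.range t).map O) a y).length) → os ∈ U.eval qs y →
    x ∈ U.eval p' (code (Slist y os).toFinset) → x ∈ V.eval O (s ++ (h ++ (r ++ p'))) [] := by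
  let G : (List ℕ × ((BStr × BStr) × (BStr × ℕ))) × BStr × BStr → Option BStr := fun a =>
    (Ust U a.1.2.2.2 a.1.2.1.1 []).bind fun oa =>
    (Ust U a.1.2.2.2 a.1.2.1.2 []).bind fun y =>
      cond (decide (a.2.1 = a.1.2.1.1 ++ (a.1.2.1.2 ++ a.1.2.2.1)) &&
        (((List.range a.1.1.length).all fun τ => decide ((found U (a.1.1.take τ) (ofBits oa) y).length < n)) &&
          decide (n ≤ (found U a.1.1 (ofBits oa) y).length)))
        ((found U a.1.1 (ofBits oa) y).head?.bind fun q => (Ust U a.1.1.length q y).bind fun o =>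
          Ust U a.1.2.2.2 a.1.2.2.1 (setCode (Slist y o))) none
  have gspec : ∀ (T : List ℕ) (h r p' : BStr) (k : ℕ) (p y' x : BStr), G ((T, ((h, r), (p', k))), p, y') = some x ↔
      ∃ oa, Ust U k h [] = some oa ∧ ∃ y, Ust U k r [] = some y ∧ (p = h ++ (r ++ p') ∧
        (∀ τ < T.length, (found U (T.take τ) (ofBits oa) y).length < n) ∧ n ≤ (found U T (ofBits oa) y).length) ∧
        ∃ q, (found U T (ofBits oa) y).head? = some q ∧ ∃ o, Ust U T.length q y = some o ∧
        Ust U k p' (setCode (Slist y o)) = some x := by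
    intro T h r p' k p y' x
    simp only [G, Option.bind_eq_some_iff, cond_eq_ite, Bool.and_eq_true, decide_eq_true_eq, List.all_eq_true, List.mem_range]
    refine exists_congr fun oa => and_congr_right fun _ => exists_congr fun y => and_congr_right fun _ => ?_
    split_ifs with hc
    · simp only [Option.bind_eq_some_iff]
      exact ⟨fun e => ⟨hc, e⟩, fun e => e.2⟩
    · constructor
      · intro e; exact absurd e (by simp)
      · intro e; exact absurd e.1 hc
  have hG : Computable G := by
    apply Primrec.to_comp
    let A := (List ℕ × ((BStr × BStr) × (BStr × ℕ))) × BStr × BStr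
    have hw : Primrec (fun a : A => a.1.2) := Primrec.snd.comp Primrec.fst
    have hT : Primrec (fun a : A => a.1.1) := Primrec.fst.comp Primrec.fst
    have hk : Primrec (fun a : A => a.1.2.2.2) := Primrec.snd.comp (Primrec.snd.comp hw)
    have hp' : Primrec (fun a : A => a.1.2.2.1) := Primrec.fst.comp (Primrec.snd.comp hw)
    have hh : Primrec (fun a : A => a.1.2.1.1) := Primrec.fst.comp (Primrec.fst.comp hw)
    have hr : Primrec (fun a : A => a.1.2.1.2) := Primrec.snd.comp (Primrec.fst.comp hw)
    have hp : Primrec (fun a : A => a.2.1) := Primrec.fst.comp Primrec.snd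
    refine Primrec.option_bind (prim_Ust hk hh (Primrec.const [])) ?_
    refine Primrec.option_bind ((prim_Ust hk hr (Primrec.const [])).comp Primrec.fst) ?_
    have f1 : Primrec (fun b : (A × BStr) × BStr => b.1.1) := Primrec.fst.comp Primrec.fst
    have foa : Primrec (fun b : (A × BStr) × BStr => ofBits b.1.2) := prim_ofBits.comp (Primrec.snd.comp Primrec.fst)
    have fy : Primrec (fun b : (A × BStr) × BStr => b.2) := Primrec.snd
    have hF : Primrec (fun b : (A × BStr) × BStr => found U b.1.1.1.1 (ofBits b.1.2) b.2) :=
      prim_found U (hT.comp f1) foa fy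
    refine Primrec.cond (Primrec.and.comp ?_ (Primrec.and.comp ?_ ?_)) ?_ (Primrec.const none)
    · exact (prim_eq hp (Primrec.list_append.comp hh (Primrec.list_append.comp hr hp'))).comp f1
    · refine prim_all (Primrec.list_range.comp (Primrec.list_length.comp (hT.comp f1))) ?_
      refine prim_lt (Primrec.list_length.comp (prim_found U (prim_take ((hT.comp f1).comp Primrec.fst) Primrec.snd)
        (foa.comp Primrec.fst) (fy.comp Primrec.fst))) (Primrec.const n)
    · exact prim_le (Primrec.const n) (Primrec.list_length.comp hF)
    · refine Primrec.option_bind (Primrec.list_head?.comp hF) ?_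
      refine Primrec.option_bind (prim_Ust (Primrec.list_length.comp ((hT.comp f1).comp Primrec.fst)) Primrec.snd
        (fy.comp Primrec.fst)) ?_
      have g1 : Primrec (fun b : (((A × BStr) × BStr) × BStr) × BStr => b.1.1) := Primrec.fst.comp Primrec.fst
      exact prim_Ust ((hk.comp f1).comp g1) ((hp'.comp f1).comp g1)
        (prim_setCode.comp (prim_Slist.comp (fy.comp g1) Primrec.snd))
  have htake : ∀ (O : ℕ → ℕ) t t', t ≤ t' → ((List.range t').map O).take t = (List.range t).map O := by
    intro O t t' h
    rw [← List.map_take, List.take_range, min_eq_left h]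
  have huniq : ∀ O t h r p' k p y x t' h' r' p'' k' p2 x',
      G (((List.range t).map O, ((h, r), (p', k))), p, y) = some x →
      G (((List.range t').map O, ((h', r'), (p'', k'))), p2, y) = some x' → p <+: p2 →
      p = p2 ∧ x = x' := by
    intro O t h r p' k p y x t' h' r' p'' k' p2 x' hg hg' hp
    obtain ⟨oa, h1, y1, h2, ⟨rfl, h3, h4⟩, q, h5, o, h6, h7⟩ := (gspec _ _ _ _ _ _ _ _).1 hg
    obtain ⟨oa', h1', y1', h2', ⟨rfl, h3', h4'⟩, q', h5', o', h6', h7'⟩ := (gspec _ _ _ _ _ _ _ _).1 hg'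
    obtain ⟨rfl, hp1⟩ := Ust_concat h1 h1' hp
    obtain ⟨rfl, hp2⟩ := Ust_concat h2 h2' hp1
    obtain rfl := Ust_uniq h1 h1'
    obtain rfl := Ust_uniq h2 h2'
    have ht : t = t' := by
      rcases lt_trichotomy t t' with hlt | he | hlt
      · have := h3' t (by simpa using hlt)
        rw [htake O _ _ hlt.le] at this
        omega
      · exact he
      · have := h3 t' (by simpa using hlt)
        rw [htake O _ _ hlt.le] at this
        omega
    subst ht
    obtain rfl : q = q' := by simpa [h5] using h5'
    obtain rfl := Ust_uniq h6 h6'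
    obtain rfl := Ust_pf h7 h7' hp2
    obtain rfl := Ust_uniq h7 h7'
    exact ⟨rfl, rfl⟩
  obtain ⟨σ, hσ⟩ := OM_lemma V G hG (by
    rintro O y t ⟨⟨h, r⟩, ⟨p', k⟩⟩ p t' ⟨⟨h', r'⟩, ⟨p'', k'⟩⟩ p2 hs hs' hp
    obtain ⟨x, hx⟩ := Option.isSome_iff_exists.1 hs
    obtain ⟨x', hx'⟩ := Option.isSome_iff_exists.1 hs'
    exact (huniq _ _ _ _ _ _ _ _ _ _ _ _ _ _ _ _ hx hx' hp).1)
  refine ⟨σ, fun O h a r y p' x qs os hh hr hhead hex hos hx => ?_⟩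
  obtain ⟨k1, hk1⟩ := mem_U_iff.1 hh
  obtain ⟨k2, hk2⟩ := mem_U_iff.1 hr
  rw [← setCode_eq] at hx
  obtain ⟨k3, hk3⟩ := mem_U_iff.1 hx
  have hmain : ∃ t w, G (((List.range t).map O, w), (h ++ (r ++ p')), []) = some x := by
    have hn := Nat.find_spec hex
    have hmin := fun τ h => Nat.find_min hex (m := τ) h
    set t := Nat.find hex
    refine ⟨t, ((h, r), (p', max k1 (max k2 k3))), (gspec _ _ _ _ _ _ _ _).2 ?_⟩
    have hofb : ofBits (code a) = a := ofBits_bits a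
    refine ⟨_, Ust_mono (le_max_left _ _) hk1, _, Ust_mono ((le_max_left _ _).trans (le_max_right _ _)) hk2, ⟨rfl, ?_, ?_⟩,
      qs, ?_, os, ?_, Ust_mono ((le_max_right _ _).trans (le_max_right _ _)) hk3⟩
    · intro τ hτ
      have hτ' : τ < t := by simpa using hτ
      rw [hofb, htake O _ _ hτ'.le]
      exact not_le.1 (hmin τ hτ')
    · rw [hofb]; exact hn
    · rw [hofb]; exact hhead t hn
    · have := List.mem_of_head? (hhead t hn)
      have hv := (List.mem_filter.1 this).2
      unfold ver at hv
      cases hu : Ust U ((List.range t).map O).length qs y with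
      | none => rw [hu] at hv; simp at hv
      | some o => rw [Part.mem_unique (Ust_mem hu) hos]
  refine hσ O _ _ x hmain ?_
  rintro t ⟨⟨h', r'⟩, ⟨p'', k'⟩⟩ x' hx'
  obtain ⟨t0, ⟨⟨h0, r0⟩, ⟨p0, k0⟩⟩, hw0⟩ := hmain
  exact (huniq _ _ _ _ _ _ _ _ _ _ _ _ _ _ _ _ hx' hw0 List.prefix_rfl).2
end


theorem oracle_val (A : BStr → ℚ → ℚ) (i e : ℕ) (hi : isStr i = true) :
    oracleOfApprox A (Nat.pair i (epsQ e)) = rEnc (A (strN i) (1 / 2 ^ e)) + 1 := by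
  have hi' : Encodable.encode (strN i) = i := by simpa [isStr] using hi
  have hc : Nat.pair i (epsQ e) = Encodable.encode (strN i, (1 / 2 ^ e : ℚ)) := by
    rw [← epsQ_eq]
    conv_lhs => rw [← hi']
    rfl
  unfold oracleOfApprox
  rw [hc, Encodable.encodek]
  rfl

section
variable (U : UniversalPrefixMachine)

def NearP (P : BStr → ℝ) (y q : BStr) : Prop := ∃ o ∈ U.eval q y, DP P o < 1 / 2 ^ Rof y q.length

theorem ver_sound {P : BStr → ℝ} (h0 : ∀ z, 0 ≤ P z) (hs : HasSum P 1) {A : BStr → ℚ → ℚ} (hA : Approximates A P)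
    (t : ℕ) (y q : BStr) (hv : ver U ((List.range t).map (oracleOfApprox A)) y q = true) : NearP U P y q := by
  unfold ver at hv
  set T := (List.range t).map (oracleOfApprox A) with hT
  cases hu : Ust U T.length q y with
  | none => rw [hu] at hv; simp at hv
  | some o =>
    rw [hu] at hv
    simp only [Option.map_some, Option.getD_some] at hv
    refine ⟨o, Ust_mem hu, ?_⟩
    refine lt_of_le_of_lt ?_ ((okN_iff _ _ _ _ _).1 hv)
    apply est_sound (PN_hasSum P hs) (PN_nonneg P h0)
    intro i
    generalize T.length.unpair.2 = e
    have hp := PN_nonneg P h0 i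
    have hz : (0:ℝ) / 2 ^ e ≤ PN P i + 2 / 2 ^ e := by rw [zero_div]; positivity
    unfold vT
    cases hi : isStr i with
    | false => simpa using hz
    | true =>
      rw [cond_true]
      cases hg : T[Nat.pair i (epsQ e)]? with
      | none =>
        have : flo 0 e = 0 := by simp [flo]
        simpa [List.getD_eq_getElem?_getD, hg, this] using hz
      | some v =>
        have hv := getElem?_rangeMap hg
        rw [oracle_val A i e hi] at hv
        rw [List.getD_eq_getElem?_getD, hg, Option.getD_some, hv, Nat.add_sub_cancel]
        have := flo_spec (A (strN i) (1 / 2 ^ e)) e (P (strN i)) (h0 _)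
          (by simpa using hA (strN i) (1 / 2 ^ e) (by positivity))
        have := (abs_le.1 this).2
        rw [PN, if_pos hi]
        linarith

theorem ver_complete {P : BStr → ℝ} (h0 : ∀ z, 0 ≤ P z) (hs : HasSum P 1) {A : BStr → ℚ → ℚ} (hA : Approximates A P)
    (y : BStr) (L : List BStr) (hL : ∀ q ∈ L, NearP U P y q) :
    ∃ t, ∀ q ∈ L, ver U ((List.range t).map (oracleOfApprox A)) y q = true := by
  have h1 : ∀ q, ∃ o, q ∈ L → o ∈ U.eval q y ∧ DP P o < 1 / 2 ^ Rof y q.length := by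
    intro q
    by_cases h : q ∈ L
    · obtain ⟨o, ho⟩ := hL q h
      exact ⟨o, fun _ => ho⟩
    · exact ⟨[], fun h' => absurd h' h⟩
  choose out hout using h1
  obtain ⟨k, hk⟩ := Ust_uniform (U := U) L (fun q => q) (fun _ => y) out (fun q hq => (hout q hq).1)
  have h2 : ∀ q, ∃ E : ℕ, q ∈ L → ∀ e ≥ E, ((decF (out q)).2.length * 8 : ℝ) * (1 / 2 ^ e) <
      1 / 2 ^ Rof y q.length - DP P (out q) := by
    intro q
    by_cases h : q ∈ L
    · obtain ⟨E, hE⟩ := small_pow ((decF (out q)).2.length * 8 : ℝ) (by positivity)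
        (1 / 2 ^ Rof y q.length - DP P (out q)) (sub_pos.2 (hout q h).2)
      exact ⟨E, fun _ => hE⟩
    · exact ⟨0, fun h' => absurd h' h⟩
  choose Eo hEo using h2
  let e := L.toFinset.sup Eo
  let N := L.toFinset.sup fun q => (decF (out q)).2.length
  let B := (Finset.range N).sup fun i => Nat.pair i (epsQ e) + 1
  let b := max k B
  let t := Nat.pair b e
  have hbt : b ≤ t := Nat.left_le_pair _ _
  refine ⟨t, fun q hq => ?_⟩
  have hlen : ((List.range t).map (oracleOfApprox A)).length = t := by simp
  have hte : t.unpair.2 = e := by simp [t]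
  unfold ver
  rw [hlen, hte, Ust_mono ((le_max_left k B).trans hbt) (hk q hq)]
  simp only [Option.map_some, Option.getD_some]
  rw [okN_iff]
  have hqL : q ∈ L.toFinset := List.mem_toFinset.2 hq
  have hE := hEo q hq e (Finset.le_sup (f := Eo) hqL)
  have hlN : (decF (out q)).2.length ≤ N := Finset.le_sup (f := fun q => (decF (out q)).2.length) hqL
  refine lt_of_le_of_lt (est_complete (PN_hasSum P hs) (PN_nonneg P h0) _ _ _ _ ?_) (b := DP P (out q) + (decF (out q)).2.length * 8 * (1 / 2 ^ e)) (by linarith)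
  intro i hi
  unfold vT PN
  cases his : isStr i with
  | false => simp
             positivity
  | true =>
    rw [cond_true, if_pos rfl]
    have hlt : Nat.pair i (epsQ e) < t := by
      have : Nat.pair i (epsQ e) + 1 ≤ B :=
        Finset.le_sup (f := fun i => Nat.pair i (epsQ e) + 1) (Finset.mem_range.2 (hi.trans_le hlN))
      have := le_max_right k B
      omega
    have hg : ((List.range t).map (oracleOfApprox A)).getD (Nat.pair i (epsQ e)) 0 = rEnc (A (strN i) (1 / 2 ^ e)) + 1 := by
      rw [← oracle_val A i e his]
      simp [List.getD_eq_getElem?_getD, List.getElem?_map, List.getElem?_range hlt]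
    rw [hg, Nat.add_sub_cancel]
    exact flo_spec (A (strN i) (1 / 2 ^ e)) e (P (strN i)) (h0 _)
          (by simpa using hA (strN i) (1 / 2 ^ e) (by positivity))

noncomputable def NearL (P : BStr → ℝ) (y : BStr) (a : ℕ) : List BStr := (strs a).filter fun q => decide (NearP U P y q)

theorem near_oracle (V : UniversalOracleMachine) (n : ℕ) : ∃ s : BStr, ∀ (P : BStr → ℝ), (∀ z, 0 ≤ P z) → HasSum P 1 →
    ∀ (h : BStr) (a : ℕ) (r y : BStr), code a ∈ U.eval h [] → y ∈ U.eval r [] →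
    0 < n → (NearL U P y a).length = n → ∃ qs os, qs.length = a ∧ os ∈ U.eval qs y ∧ DP P os < 1 / 2 ^ Rof y a ∧
    ∀ p' x, x ∈ U.eval p' (code (Slist y os).toFinset) →
      ∀ A, Approximates A P → x ∈ V.eval (oracleOfApprox A) (s ++ (h ++ (r ++ p'))) [] := by
  obtain ⟨s, hs⟩ := oracle_machine U V n
  refine ⟨s, fun P h0 hsum h a r y hh hr hn hlen => ?_⟩
  cases hL : NearL U P y a with
  | nil => rw [hL] at hlen; simp at hlen; omega
  | cons qs rest =>
    have hq : qs ∈ NearL U P y a := by rw [hL]; simp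
    obtain ⟨hq1, hq2⟩ := List.mem_filter.1 hq
    rw [mem_strs] at hq1
    obtain ⟨os, ho1, ho2⟩ := of_decide_eq_true hq2
    rw [hq1] at ho2
    refine ⟨qs, os, hq1, ho1, ho2, fun p' x hx A hA => ?_⟩
    refine hs _ h a r y p' x qs os hh hr ?_ ?_ ho1 hx
    · intro t ht
      have hsub : (found U ((List.range t).map (oracleOfApprox A)) a y).Sublist (NearL U P y a) := by
        apply List.monotone_filter_right
        intro q hq
        exact decide_eq_true (ver_sound U h0 hsum hA t y q hq)
      rw [hsub.eq_of_length_le (by omega), hL]; rfl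
    · obtain ⟨t, ht⟩ := ver_complete U h0 hsum hA y (NearL U P y a) (fun q hq => of_decide_eq_true (List.mem_filter.1 hq).2)
      refine ⟨t, ?_⟩
      rw [← hlen]
      have : NearL U P y a = (NearL U P y a).filter (ver U ((List.range t).map (oracleOfApprox A)) y) :=
        (List.filter_eq_self.2 ht).symm
      rw [this]
      unfold NearL found
      rw [List.filter_filter]
      apply List.Sublist.length_le
      apply List.monotone_filter_right
      intro q hq
      simp at hq
      tauto
end


theorem size_add_le (m n : ℕ) : Nat.size (m + n) ≤ Nat.size m + Nat.size n + 1 := by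
  rw [Nat.size_le]
  have h1 : m < 2 ^ Nat.size m := Nat.lt_size_self m
  have h2 : n < 2 ^ Nat.size n := Nat.lt_size_self n
  have h3 : 2 ^ Nat.size m ≤ 2 ^ (Nat.size m + Nat.size n) := Nat.pow_le_pow_right (by norm_num) (by omega)
  have h4 : 2 ^ Nat.size n ≤ 2 ^ (Nat.size m + Nat.size n) := Nat.pow_le_pow_right (by norm_num) (by omega)
  rw [pow_succ]; omega

def simO (y : BStr) (a : ℕ) (o o' : BStr) : Bool :=
  simN (Rof y a) (decF o).1 (decF o).2 (decF o').1 (decF o').2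

theorem simO_iff (y a o o') : simO y a o o' = true ↔ DD (Fo o) (Fo o') < 2 * (1 / 2 ^ Rof y a) := simN_iff _ _ _ _ _

theorem prim_simO : Primrec fun q : (BStr × ℕ) × BStr × BStr => simO q.1.1 q.1.2 q.2.1 q.2.2 := by
  have h1 : Primrec fun q : (BStr × ℕ) × BStr × BStr => decF q.2.1 := prim_decF.comp (Primrec.fst.comp Primrec.snd)
  have h2 : Primrec fun q : (BStr × ℕ) × BStr × BStr => decF q.2.2 := prim_decF.comp (Primrec.snd.comp Primrec.snd)
  exact prim_simN (prim_Rof.comp (Primrec.fst.comp Primrec.fst) (Primrec.snd.comp Primrec.fst))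
    (Primrec.fst.comp h1) (Primrec.snd.comp h1) (Primrec.fst.comp h2) (Primrec.snd.comp h2)

section
variable (U : UniversalPrefixMachine)

theorem near_small : ∃ M : ℕ, ∀ (P : BStr → ℝ), HasSum P 1 → ∀ y a,
    (∀ p, NearP U P y p → a ≤ p.length) → (NearL U P y a).length < M := by
  obtain ⟨M, _, hM⟩ := cluster (U := U) (sim := simO) prim_simO
  refine ⟨M, fun P hs y a hmin => ?_⟩
  by_contra hc
  have hcard : (NearL U P y a).toFinset.card = (NearL U P y a).length :=
    List.toFinset_card_of_nodup ((strs_nodup a).filter _)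
  have h1 : ∀ q, ∃ o, q ∈ (NearL U P y a).toFinset → q.length = a ∧ o ∈ U.eval q y ∧ DP P o < 1 / 2 ^ Rof y a := by
    intro q
    by_cases h : q ∈ (NearL U P y a).toFinset
    · obtain ⟨h1, h2⟩ := List.mem_filter.1 (List.mem_toFinset.1 h)
      rw [mem_strs] at h1
      obtain ⟨o, ho⟩ := of_decide_eq_true h2
      rw [h1] at ho
      exact ⟨o, fun _ => ⟨h1, ho⟩⟩
    · exact ⟨[], fun h' => absurd h' h⟩
  choose out hout using h1
  have hp := (PN_hasSum P hs).summable
  obtain ⟨p, o, hlt, ho, q, hq, hsim⟩ := hM y a (NearL U P y a).toFinset out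
    (fun q hq => ⟨(hout q hq).1, (hout q hq).2.1⟩) (by
      intro q hq q' hq'
      rw [simO_iff]
      have t := DD_tri (Fo_summable (out q)) hp (Fo_summable (out q'))
      rw [DD_comm (PN P)] at t
      have a1 := (hout q hq).2.2
      have a2 := (hout q' hq').2.2
      unfold DP at a1 a2
      linarith) (by omega)
  rw [simO_iff] at hsim
  have t := DD_tri (Fo_summable o) (Fo_summable (out q)) hp
  have a1 := (hout q hq).2.2
  have hR : (4:ℝ) * (1 / 2 ^ Rof y a) ≤ 1 / 2 ^ Rof y p.length := by
    have : Rof y p.length + 2 ≤ Rof y a := by unfold Rof; omega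
    have h2 : (2:ℝ) ^ (Rof y p.length + 2) ≤ 2 ^ Rof y a := pow_le_pow_right₀ (by norm_num) this
    rw [pow_add] at h2
    rw [← mul_div_assoc, mul_one, div_le_div_iff₀ (by positivity) (by positivity)]
    linarith
  have hpos : (0:ℝ) < 1 / 2 ^ Rof y a := by positivity
  have := hmin p ⟨o, ho, by unfold DP at *; linarith⟩
  omega

theorem floor_facts {p : ℝ} (h0 : 0 < p) (h1 : p ≤ 1) : ∃ m : ℕ, ⌊-Real.logb 2 p⌋ = (m : ℤ) ∧
    1 / 2 ^ (m + 1) < p ∧ p ≤ 1 / 2 ^ m := by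
  have hn : 0 ≤ -Real.logb 2 p := by
    have := Real.logb_nonpos (b := 2) (by norm_num) h0.le h1
    linarith
  obtain ⟨m, hm⟩ := Int.eq_ofNat_of_zero_le (Int.floor_nonneg.2 hn)
  refine ⟨m, hm, ?_, ?_⟩
  · have h := Int.lt_floor_add_one (-Real.logb 2 p)
    rw [hm] at h
    have h' : -((m + 1 : ℕ) : ℝ) < Real.logb 2 p := by push_cast at h ⊢; linarith
    rw [Real.lt_logb_iff_rpow_lt (by norm_num) h0, Real.rpow_neg (by norm_num), Real.rpow_natCast] at h'
    rwa [one_div]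
  · have h := Int.floor_le (-Real.logb 2 p)
    rw [hm] at h
    have h' : Real.logb 2 p ≤ -((m : ℕ) : ℝ) := by push_cast at h ⊢; linarith
    rw [Real.logb_le_iff_le_rpow (by norm_num) h0, Real.rpow_neg (by norm_num), Real.rpow_natCast] at h'
    rwa [one_div]

theorem part_a (V : UniversalOracleMachine) : ∃ C : ℕ, ∀ x P, IsCPDF P → 0 < P x → ∃ S : Finset BStr, x ∈ S ∧
    (S.card : ℝ) < 2 / P x ∧
    KcondPdf V x P ≤ U.KcS x S + KInt U ⌊-Real.logb 2 (P x)⌋ + 2 * Nat.size (KPdf U P) + C ∧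
    U.Kset S ≤ KPdf U P + KInt U ⌊-Real.logb 2 (P x)⌋ + C := by
  obtain ⟨M, hM⟩ := near_small U
  obtain ⟨c0, hc0⟩ := m0_machine U
  obtain ⟨c1, hc1⟩ := ks_machine U
  obtain ⟨sl, hsl⟩ := U_lit U
  choose σ hσ using fun n => near_oracle U V n
  let c2 := (Finset.range M).sup fun n => (σ n).length
  refine ⟨c0 + c1 + c2 + sl.length + 1 + 2 * (Nat.size c0 + 1), fun x P hP hx => ?_⟩
  obtain ⟨h0, hs, _⟩ := id hP
  have hsum : HasSum P 1 := by
    have : Summable P := by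
      by_contra hc
      rw [tsum_eq_zero_of_not_summable hc] at hs
      exact zero_ne_one hs
    rw [← hs]; exact this.hasSum
  have hx1 : P x ≤ 1 := le_hasSum hsum x (fun z _ => h0 z)
  obtain ⟨m, hm, hm1, hm2⟩ := floor_facts hx hx1
  rw [hm]
  set y := code (m : ℤ) with hy
  have hmy : mOf y = m := mOf_code m
  have hex : ∃ a, ∃ q : BStr, q.length = a ∧ NearP U P y q := by
    obtain ⟨q, o, h1, h2, h3⟩ := hc0 P hP y
    exact ⟨_, q, rfl, o, h2, h3⟩
  have hfind := Nat.find_spec hex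
  have hmin : ∀ p, NearP U P y p → Nat.find hex ≤ p.length := fun p hp => Nat.find_min' hex ⟨p, rfl, hp⟩
  have hale : Nat.find hex ≤ KPdf U P + c0 := by
    obtain ⟨q, o, h1, h2, h3⟩ := hc0 P hP y
    rw [← h1]; exact hmin q ⟨o, h2, h3⟩
  generalize Nat.find hex = a at *
  obtain ⟨q0, hq0, hq0'⟩ := hfind
  have hne : 0 < (NearL U P y a).length :=
    List.length_pos_of_mem (List.mem_filter.2 ⟨(mem_strs _ _).2 hq0, decide_eq_true hq0'⟩)
  have hnM := hM P hsum y a hmin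
  obtain ⟨r, hr, hr'⟩ := Kc_spec U y []
  obtain ⟨qs, os, hq1, hq2, hq3, hq4⟩ := hσ _ P h0 hsum (sl ++ sd (code a)) a r y (hsl _ _) hr' hne rfl
  have hD : DP P os < 1 / 2 ^ (2 * mOf y + 3) := by
    refine lt_of_lt_of_le hq3 ?_
    apply one_div_le_one_div_of_le (by positivity)
    exact pow_le_pow_right₀ (by norm_num) (by unfold Rof; omega)
  obtain ⟨hS1, hS2⟩ := S_lemma h0 hsum x y os (by rw [hmy]; exact hm1) (by rw [hmy]; exact hm2) hD
  refine ⟨(Slist y os).toFinset, hS1, hS2, ?_, ?_⟩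
  · obtain ⟨p', hp', hp''⟩ := Kc_spec U x (code (Slist y os).toFinset)
    have h3 : KcondPdf V x P ≤ _ := Nat.sInf_le ⟨_, rfl, hq4 p' x hp''⟩
    have hlen : (code a).length = Nat.size a := Nat.size_eq_bits_len a
    simp only [List.length_append, sd_length, hlen] at h3
    have hc : (σ (NearL U P y a).length).length ≤ c2 :=
      Finset.le_sup (f := fun n => (σ n).length) (Finset.mem_range.2 hnM)
    have hsz := (Nat.size_le_size hale).trans (size_add_le _ _)
    unfold UniversalPrefixMachine.KcS KInt UniversalPrefixMachine.K
    rw [← hy]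
    omega
  · have := hc1 r qs y os hr' hq2
    unfold KInt UniversalPrefixMachine.K
    rw [← hy]
    omega
end

theorem size_le_log (n : ℕ) : (Nat.size n : ℝ) ≤ Real.logb 2 n + 1 := by
  rcases Nat.eq_zero_or_pos n with rfl | hn
  · simp
  · have h : 2 ^ (Nat.size n - 1) ≤ n := by
      apply Nat.lt_size.1
      have := Nat.size_pos.2 hn
      omega
    have h2 : ((Nat.size n - 1 : ℕ) : ℝ) ≤ Real.logb 2 n := by
      rw [Real.le_logb_iff_rpow_le (by norm_num) (by exact_mod_cast hn), Real.rpow_natCast]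
      exact_mod_cast h
    have h3 : (Nat.size n : ℝ) ≤ ((Nat.size n - 1 : ℕ) : ℝ) + 1 := by
      have : Nat.size n ≤ Nat.size n - 1 + 1 := by omega
      exact_mod_cast this
    linarith

theorem logb_nat_nonneg (n : ℕ) : 0 ≤ Real.logb 2 (n : ℝ) := by
  rcases Nat.eq_zero_or_pos n with rfl | hn
  · simp
  · exact Real.logb_nonneg (by norm_num) (by exact_mod_cast hn)


/-- There are constants `c` and `C` such that for every string
`x`: (a) for every computable probability density function `P` with `P(x) > 0`,
setting `m = ⌊−log P(x)⌋`, there is a finite set `S ∋ x` with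
`log|S| < −log P(x) + 1`, `δ(x|S) ≤ δ(x|P) + 2·log K(P) + K(m) + 2·log K(m) + C`
and `K(S) ≤ K(P) + K(m) + C`; and (b) for every total recursive function `p`
with `x` in its range, there is a finite set `S ∋ x` with `log|S| ≤ l_x(p)`,
`δ(x|S) ≤ δ(x|p) + 2·log K(p) + K(l_x(p)) + 2·log K(l_x(p)) + c` and
`K(S) ≤ K(p) + K(l_x(p)) + c`. -/
theorem statement16 (U : UniversalPrefixMachine) (V : UniversalOracleMachine) :
    ∃ c C : ℕ, ∀ x : BStr,
      (∀ P : BStr → ℝ, IsCPDF P → 0 < P x →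
        ∃ S : Finset BStr, x ∈ S ∧
          Real.logb 2 (S.card : ℝ) < -Real.logb 2 (P x) + 1 ∧
          U.deficiency x S ≤ deltaPdf V x P
            + 2 * Real.logb 2 ((KPdf U P : ℕ) : ℝ)
            + (KInt U ⌊-Real.logb 2 (P x)⌋ : ℝ)
            + 2 * Real.logb 2 ((KInt U ⌊-Real.logb 2 (P x)⌋ : ℕ) : ℝ) + (C : ℝ) ∧
          (U.Kset S : ℝ) ≤ (KPdf U P : ℝ) + (KInt U ⌊-Real.logb 2 (P x)⌋ : ℝ) + (C : ℝ)) ∧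
      (∀ f : BStr → BStr, Computable f → (∃ d : BStr, f d = x) →
        ∃ S : Finset BStr, x ∈ S ∧
          Real.logb 2 (S.card : ℝ) ≤ (lenx f x : ℝ) ∧
          U.deficiency x S ≤ deltaFun V x f
            + 2 * Real.logb 2 ((KFn U f : ℕ) : ℝ)
            + (U.Knat (lenx f x) : ℝ)
            + 2 * Real.logb 2 ((U.Knat (lenx f x) : ℕ) : ℝ) + (c : ℝ) ∧
          (U.Kset S : ℝ) ≤ (KFn U f : ℝ) + (U.Knat (lenx f x) : ℝ) + (c : ℝ)) := by
  obtain ⟨c, hc⟩ := part_b U V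
  obtain ⟨C, hC⟩ := part_a U V
  refine ⟨c, C + 3, fun x => ⟨fun P hP hx => ?_, fun f hf hd => ?_⟩⟩
  · obtain ⟨S, h1, h2, h3, h4⟩ := hC x P hP hx
    have hpos : (0:ℝ) < S.card := by exact_mod_cast Finset.card_pos.2 ⟨x, h1⟩
    have hl : Real.logb 2 (S.card : ℝ) < -Real.logb 2 (P x) + 1 := by
      have := Real.logb_lt_logb (b := 2) (by norm_num) hpos h2
      rw [Real.logb_div (by norm_num) hx.ne', Real.logb_self_eq_one (by norm_num)] at this
      linarith
    refine ⟨S, h1, hl, ?_, ?_⟩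
    · have h3' : (KcondPdf V x P : ℝ) ≤ U.KcS x S + KInt U ⌊-Real.logb 2 (P x)⌋ + 2 * Nat.size (KPdf U P) + C := by
        exact_mod_cast h3
      have h5 := size_le_log (KPdf U P)
      have h6 := logb_nat_nonneg (KInt U ⌊-Real.logb 2 (P x)⌋)
      unfold UniversalPrefixMachine.deficiency deltaPdf
      push_cast
      linarith
    · have h4' : (U.Kset S : ℝ) ≤ KPdf U P + KInt U ⌊-Real.logb 2 (P x)⌋ + C := by exact_mod_cast h4
      push_cast
      linarith
  · obtain ⟨S, h1, h2, h3, h4⟩ := hc x f hf hd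
    have hpos : (0:ℝ) < S.card := by exact_mod_cast Finset.card_pos.2 ⟨x, h1⟩
    have hl : Real.logb 2 (S.card : ℝ) ≤ (lenx f x : ℝ) := by
      rw [Real.logb_le_iff_le_rpow (by norm_num) hpos, Real.rpow_natCast]
      exact_mod_cast h2
    refine ⟨S, h1, hl, ?_, by exact_mod_cast h4⟩
    have h3' : (KcondFun V x f : ℝ) ≤ U.KcS x S + U.Knat (lenx f x) + c := by exact_mod_cast h3
    have h5 := logb_nat_nonneg (KFn U f)
    have h6 := logb_nat_nonneg (U.Knat (lenx f x))
    unfold UniversalPrefixMachine.deficiency deltaFun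
    linarith
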